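/- Fix an integer k ≥ 2. There exist constants c_0 > 0 and c > 0 depending only on k with the following property. For every finite field F_q (of sufficiently large characteristic in terms of k), every non-degenerate polynomial P ∈ F_q[x_1,x_2] of degree k, and every set E ⊆ F_q^2 with |E| ≥ c_0 q, the distance set satisfies |Δ_P(E,E)| ≥ c · min( q , |E| q^{−1/2} ). -/

import Mathlib

open Polynomial

structure PlaneData (k R : Type*) [Field k] [CommRing R] [Algebra k R] (x y : R) (d B : ℕ) : Prop where
  rel : ∃ c : ℕ → k[X], (∀ j, (c j).natDegree ≤ B) ∧
    y ^ d = ∑ j ∈ Finset.range d, aeval x (c j) * y ^ j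
  gen : ∀ a : R, a ∈ Submodule.span k (Set.range fun p : ℕ × Fin d => x ^ p.1 * y ^ (p.2 : ℕ))
  indep : LinearIndependent k (fun p : ℕ × Fin d => x ^ p.1 * y ^ (p.2 : ℕ))

namespace PlaneData
variable {k R : Type*} [Field k] [CommRing R] [Algebra k R] {x y : R} {d B : ℕ}

variable (k) in
/-- weight filtration -/
def W (x y : R) (B N : ℕ) : Submodule k R :=
  Submodule.span k {a | ∃ i j : ℕ, i + B * j ≤ N ∧ a = x ^ i * y ^ j}

lemma W_mono {M N : ℕ} (h : M ≤ N) : W k x y B M ≤ W k x y B N := by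
  apply Submodule.span_mono
  rintro a ⟨i, j, hij, rfl⟩
  exact ⟨i, j, hij.trans h, rfl⟩

lemma mono_mem {i j N : ℕ} (h : i + B * j ≤ N) : x ^ i * y ^ j ∈ W k x y B N :=
  Submodule.subset_span ⟨i, j, h, rfl⟩

lemma mul_mem {M N : ℕ} {a b : R} (ha : a ∈ W k x y B M) (hb : b ∈ W k x y B N) :
    a * b ∈ W k x y B (M + N) := by
  have : W k x y B M * W k x y B N ≤ W k x y B (M + N) := by
    rw [W, W, Submodule.span_mul_span, Submodule.span_le]
    rintro _ ⟨_, ⟨i, j, h, rfl⟩, _, ⟨i', j', h', rfl⟩, rfl⟩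
    have : x ^ i * y ^ j * (x ^ i' * y ^ j') = x ^ (i + i') * y ^ (j + j') := by ring
    simp only [SetLike.mem_coe]
    rw [this]
    exact mono_mem (by nlinarith)
  exact this (Submodule.mul_mem_mul ha hb)

lemma one_mem (N : ℕ) : (1 : R) ∈ W k x y B N := by
  simpa using mono_mem (k := k) (x := x) (y := y) (B := B) (i := 0) (j := 0) (N := N) (by simp)

lemma pow_mem {M : ℕ} {a : R} (ha : a ∈ W k x y B M) (n : ℕ) : a ^ n ∈ W k x y B (n * M) := by
  induction n with
  | zero => simpa using one_mem _
  | succ n ih => rw [pow_succ, Nat.succ_mul]; exact mul_mem ih ha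

lemma aeval_mem (c : k[X]) {N : ℕ} (h : c.natDegree ≤ N) : aeval x c ∈ W k x y B N := by
  rw [aeval_eq_sum_range]
  refine Submodule.sum_mem _ fun i hi => Submodule.smul_mem _ _ ?_
  have := Finset.mem_range.1 hi
  simpa using mono_mem (k := k) (x := x) (y := y) (B := B) (i := i) (j := 0) (N := N) (by omega)

/-- reduced monomials -/
def idx (d B N : ℕ) : Finset (ℕ × Fin d) :=
  ((Finset.range (N + 1)) ×ˢ Finset.univ).filter fun p => p.1 + B * (p.2 : ℕ) ≤ N

lemma mem_idx {N : ℕ} {p : ℕ × Fin d} : p ∈ idx d B N ↔ p.1 + B * (p.2 : ℕ) ≤ N := by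
  simp only [idx, Finset.mem_filter, Finset.mem_product, Finset.mem_range, Finset.mem_univ,
    and_true, and_iff_right_iff_imp]
  intro h; omega

lemma card_idx_le (N : ℕ) : (idx d B N).card ≤ d * (N + 1) := by
  refine (Finset.card_filter_le _ _).trans ?_
  simp [mul_comm]

lemma le_card_idx (N : ℕ) : d * (N + 1) ≤ (idx d B N).card + d * (B * d) := by
  have : (Finset.range (N + 1 - B * d)) ×ˢ (Finset.univ : Finset (Fin d)) ⊆ idx d B N := by
    intro p hp
    rw [mem_idx]
    simp only [Finset.mem_product, Finset.mem_range, Finset.mem_univ, and_true] at hp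
    have : B * (p.2 : ℕ) ≤ B * d := Nat.mul_le_mul_left _ p.2.2.le
    omega
  have h := Finset.card_le_card this
  simp at h
  have : d * (N + 1) ≤ d * ((N + 1 - B * d) + B * d) := Nat.mul_le_mul_left _ (by omega)
  nlinarith

lemma W_eq (H : PlaneData k R x y d B) (N : ℕ) : W k x y B N =
    Submodule.span k ((fun p : ℕ × Fin d => x ^ p.1 * y ^ (p.2 : ℕ)) '' (idx d B N)) := by
  apply le_antisymm
  · rw [W, Submodule.span_le]
    rintro _ ⟨i, j, h, rfl⟩
    induction j using Nat.strong_induction_on generalizing i with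
    | _ j ih =>
    by_cases hj : j < d
    · exact Submodule.subset_span ⟨(i, ⟨j, hj⟩), by simpa [mem_idx] using h, rfl⟩
    · obtain ⟨c, hc, hr⟩ := H.rel
      have e : x ^ i * y ^ j = ∑ s ∈ Finset.range d, ∑ t ∈ Finset.range (B + 1),
          (c s).coeff t • (x ^ (i + t) * y ^ (j - d + s)) := by
        have : y ^ j = y ^ (j - d) * y ^ d := by rw [← pow_add]; congr 1; omega
        rw [this, hr, Finset.mul_sum, Finset.mul_sum]
        refine Finset.sum_congr rfl fun s _ => ?_
        rw [aeval_eq_sum_range' (n := B + 1) (by have := hc s; omega), Finset.sum_mul,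
          Finset.mul_sum, Finset.mul_sum]
        refine Finset.sum_congr rfl fun t _ => ?_
        simp only [Algebra.smul_def]; ring
      simp only [SetLike.mem_coe] at ih ⊢
      rw [e]
      refine Submodule.sum_mem _ fun s hs => Submodule.sum_mem _ fun t ht => Submodule.smul_mem _ _ ?_
      have hs' := Finset.mem_range.1 hs
      have ht' := Finset.mem_range.1 ht
      refine ih _ (by omega) _ ?_
      obtain ⟨m, rfl⟩ : ∃ m, j = d + m := ⟨j - d, by omega⟩
      obtain ⟨u, rfl⟩ : ∃ u, d = s + u + 1 := ⟨d - s - 1, by omega⟩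
      have : s + u + 1 + m - (s + u + 1) + s = m + s := by omega
      rw [this]
      nlinarith
  · rw [Submodule.span_le]
    rintro _ ⟨p, hp, rfl⟩
    exact mono_mem (by simpa [mem_idx] using hp)

lemma finrank_W (H : PlaneData k R x y d B) (N : ℕ) :
    Module.finrank k (W k x y B N) = (idx d B N).card := by
  rw [H.W_eq]
  have := H.indep.comp (fun p : idx d B N => (p : ℕ × Fin d)) Subtype.val_injective
  have h2 := finrank_span_eq_card this
  rw [Fintype.card_coe] at h2
  rw [← h2]
  have e : ((fun p : ℕ × Fin d => x ^ p.1 * y ^ (p.2 : ℕ)) '' (idx d B N)) =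
      Set.range ((fun p : ℕ × Fin d => x ^ p.1 * y ^ (p.2 : ℕ)) ∘
        fun p : idx d B N => (p : ℕ × Fin d)) := by
    rw [Set.range_comp]; simp
  rw [e]

lemma finite_W (H : PlaneData k R x y d B) (N : ℕ) : Module.Finite k (W k x y B N) := by
  rw [H.W_eq]
  exact Module.Finite.span_of_finite k ((Finset.finite_toSet _).image _)

lemma exists_mem_W (H : PlaneData k R x y d B) (a : R) : ∃ N, a ∈ W k x y B N := by
  have := H.gen a
  induction this using Submodule.span_induction with
  | mem a h => obtain ⟨p, rfl⟩ := h; exact ⟨_, mono_mem le_rfl⟩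
  | zero => exact ⟨0, zero_mem _⟩
  | add a b _ _ ha hb =>
    obtain ⟨n, hn⟩ := ha; obtain ⟨m, hm⟩ := hb
    exact ⟨n + m, add_mem (W_mono (by omega) hn) (W_mono (by omega) hm)⟩
  | smul c a _ ha => obtain ⟨n, hn⟩ := ha; exact ⟨n, Submodule.smul_mem _ _ hn⟩

/-- Lemma Z1 -/
lemma finrank_le [IsDomain R] (H : PlaneData k R x y d B) {N : ℕ} {h : R} (h0 : h ≠ 0)
    (hh : h ∈ W k x y B N) {U : Type*} [AddCommGroup U] [Module k U] [Module.Finite k U]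
    (φ : R →ₗ[k] U) (hφ : Function.Surjective φ) (hk : ∀ a, φ (h * a) = 0) :
    Module.finrank k U ≤ d * (N + B * d) := by
  classical
  obtain ⟨n, hn⟩ : ∃ n, Submodule.map φ (W k x y B n) = ⊤ := by
    let b := Module.finBasis k U
    choose a ha using fun i => hφ (b i)
    choose m hm using fun i => H.exists_mem_W (a i)
    refine ⟨∑ i, m i, ?_⟩
    rw [eq_top_iff, ← b.span_eq, Submodule.span_le]
    rintro _ ⟨i, rfl⟩
    exact ⟨a i, W_mono (Finset.single_le_sum (f := m) (fun _ _ => Nat.zero_le _) (Finset.mem_univ i)) (hm i), ha i⟩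
  have := H.finite_W (n + N)
  have := H.finite_W n
  let f : W k x y B n →ₗ[k] W k x y B (n + N) :=
    (LinearMap.mulLeft k h).restrict (fun a ha => by
      rw [add_comm]; exact mul_mem hh ha)
  have hf : Function.Injective f := by
    intro a b hab
    have : h * (a : R) = h * b := congrArg Subtype.val hab
    exact Subtype.ext (mul_left_cancel₀ h0 this)
  let g : W k x y B (n + N) →ₗ[k] U := φ.comp (Submodule.subtype _)
  have hg : LinearMap.range g = ⊤ := by
    rw [eq_top_iff, ← hn]
    rintro _ ⟨a, ha, rfl⟩
    exact ⟨⟨a, W_mono (by omega) ha⟩, rfl⟩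
  have h1 := LinearMap.finrank_range_add_finrank_ker g
  have h2 : Module.finrank k (LinearMap.range f) ≤ Module.finrank k (LinearMap.ker g) := by
    apply Submodule.finrank_mono
    rintro _ ⟨a, rfl⟩
    exact hk _
  rw [LinearMap.finrank_range_of_inj hf] at h2
  rw [hg, finrank_top] at h1
  rw [H.finrank_W] at h1 h2
  have h3 := card_idx_le (d := d) (B := B) (n + N)
  have h4 := le_card_idx (d := d) (B := B) n
  nlinarith

/-- Lemma Z2 -/
lemma card_le [IsDomain R] (H : PlaneData k R x y d B) {N : ℕ} {h : R} (h0 : h ≠ 0)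
    (hh : h ∈ W k x y B N) (S : Finset (R →ₐ[k] k)) (hS : ∀ P ∈ S, P h = 0) :
    S.card ≤ d * (N + B * d) := by
  classical
  let φ : R →ₗ[k] (S → k) := LinearMap.pi fun P => (P : R →ₐ[k] k).toLinearMap
  have hind : LinearIndependent k (fun P : S => ((P : R →ₐ[k] k).toLinearMap : R →ₗ[k] k)) := by
    have h1 := linearIndependent_monoidHom R k
    have h2 : LinearIndependent k (fun P : S => ((((P : R →ₐ[k] k) : R →* k) : R → k))) := by
      refine h1.comp (fun P : S => ((P : R →ₐ[k] k) : R →* k)) ?_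
      intro P Q hPQ
      apply Subtype.ext
      ext a
      exact DFunLike.congr_fun hPQ a
    rw [linearIndependent_iff'] at h2 ⊢
    intro s g hg i hi
    refine h2 s g ?_ i hi
    ext a
    have := DFunLike.congr_fun hg a
    simpa using this
  have hsurj : Function.Surjective φ := by
    rw [← LinearMap.range_eq_top]
    by_contra hne
    obtain ⟨f, hf, hf2⟩ := Submodule.exists_le_ker_of_lt_top _ (lt_top_iff_ne_top.2 hne)
    apply hf
    rw [linearIndependent_iff'] at hind
    have h3 := hind Finset.univ (fun P => f (Pi.single P 1)) ?_
    · apply LinearMap.pi_ext'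
      intro P
      ext
      simpa using h3 P (Finset.mem_univ _)
    · ext a
      have h4 : f (φ a) = 0 := hf2 ⟨a, rfl⟩
      have h5 : φ a = ∑ P : S, (P : R →ₐ[k] k) a • (Pi.single P 1 : S → k) := by
        ext Q
        simp [φ, Pi.single_apply]
      rw [h5, map_sum] at h4
      simp only [LinearMap.sum_apply, LinearMap.smul_apply, LinearMap.zero_apply]
      rw [← h4]
      refine Finset.sum_congr rfl fun P _ => ?_
      simp [mul_comm]
  have := H.finrank_le h0 hh φ hsurj (by
    intro a; ext P
    simp [φ, hS P.1 P.2])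
  simpa using this

end PlaneData

open Polynomial

lemma planeData_adjoinRoot {k : Type*} [Field k] (F : k[X][X]) (hF : F.Monic) (B : ℕ)
    (hB : ∀ j, (F.coeff j).natDegree ≤ B) :
    PlaneData k (AdjoinRoot F) (algebraMap k[X] (AdjoinRoot F) X) (AdjoinRoot.root F) F.natDegree B := by
  let b : Module.Basis (ℕ × Fin F.natDegree) k (AdjoinRoot F) :=
    (Polynomial.basisMonomials k).smulTower (AdjoinRoot.powerBasisAux' hF)
  have hb0 : ∀ i : Fin F.natDegree, AdjoinRoot.powerBasisAux' hF i = AdjoinRoot.root F ^ (i : ℕ) :=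
    fun i => (AdjoinRoot.powerBasis' hF).basis_eq_pow i
  have hb : ∀ p : ℕ × Fin F.natDegree, b p = algebraMap k[X] (AdjoinRoot F) X ^ p.1 * AdjoinRoot.root F ^ (p.2 : ℕ) := by
    intro p
    rw [Module.Basis.smulTower_apply, hb0]
    simp [Algebra.smul_def, ← X_pow_eq_monomial]
  have hb' : (fun p : ℕ × Fin F.natDegree => algebraMap k[X] (AdjoinRoot F) X ^ p.1 * AdjoinRoot.root F ^ (p.2 : ℕ)) = b := by
    funext p; rw [hb]
  refine ⟨⟨fun j => - F.coeff j, fun j => by simpa using hB j, ?_⟩, ?_, ?_⟩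
  · have h := AdjoinRoot.aeval_eq (R := k[X]) (f := F) F
    rw [AdjoinRoot.mk_self, aeval_eq_sum_range, Finset.sum_range_succ, hF.coeff_natDegree, one_smul] at h
    rw [eq_neg_of_add_eq_zero_right h, ← Finset.sum_neg_distrib]
    refine Finset.sum_congr rfl fun j _ => ?_
    have : ∀ c : k[X], aeval (algebraMap k[X] (AdjoinRoot F) X) c = algebraMap k[X] (AdjoinRoot F) c := by
      intro c
      rw [aeval_algebraMap_apply, aeval_X_left_apply]
    rw [this, map_neg, neg_mul, Algebra.smul_def]
  · intro a
    rw [hb', b.span_eq]; trivial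
  · rw [hb']; exact b.linearIndependent

/-- points of the curve as homs -/
noncomputable def ptHom {k : Type*} [Field k] (F : k[X][X]) (a b : k) (h : (F.map (evalRingHom a)).eval b = 0) :
    AdjoinRoot F →ₐ[k] k :=
  { AdjoinRoot.lift (evalRingHom a) b (by rwa [eval₂_eq_eval_map]) with
    commutes' := fun r => by
      change AdjoinRoot.lift (evalRingHom a) b _ (algebraMap k (AdjoinRoot F) r) = r
      rw [IsScalarTower.algebraMap_apply k k[X] (AdjoinRoot F), AdjoinRoot.algebraMap_eq, AdjoinRoot.lift_of]
      simp }

lemma ptHom_mk {k : Type*} [Field k] (F : k[X][X]) (a b : k) (h) (u : k[X][X]) :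
    ptHom F a b h (AdjoinRoot.mk F u) = (u.map (evalRingHom a)).eval b := by
  change AdjoinRoot.lift (evalRingHom a) b (by rwa [eval₂_eq_eval_map]) (AdjoinRoot.mk F u) = _
  rw [AdjoinRoot.lift_mk, eval₂_eq_eval_map]

lemma ptHom_x {k : Type*} [Field k] (F : k[X][X]) (a b : k) (h) :
    ptHom F a b h (algebraMap k[X] (AdjoinRoot F) X) = a := by
  have := ptHom_mk F a b h (C X)
  simpa using this

lemma ptHom_y {k : Type*} [Field k] (F : k[X][X]) (a b : k) (h) :
    ptHom F a b h (AdjoinRoot.root F) = b := by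
  have := ptHom_mk F a b h X
  simpa using this

/-- a homomorphism determines a point -/
lemma hom_pt {k : Type*} [Field k] (F : k[X][X]) (P : AdjoinRoot F →ₐ[k] k) (u : k[X][X]) :
    P (AdjoinRoot.mk F u) = (u.map (evalRingHom (P (algebraMap k[X] (AdjoinRoot F) X)))).eval
      (P (AdjoinRoot.root F)) := by
  have h : (P : AdjoinRoot F →+* k).comp (AdjoinRoot.mk F) =
      eval₂RingHom (evalRingHom (P (algebraMap k[X] (AdjoinRoot F) X))) (P (AdjoinRoot.root F)) := by
    apply Polynomial.ringHom_ext'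
    · apply Polynomial.ringHom_ext'
      · ext r
        simp only [RingHom.comp_apply, RingHom.coe_coe, AdjoinRoot.mk_C]
        simp only [coe_eval₂RingHom, eval₂_C, coe_evalRingHom, eval_C]
        have := P.commutes r
        rwa [IsScalarTower.algebraMap_apply k k[X] (AdjoinRoot F)] at this
      · simp
    · simp
  have := DFunLike.congr_fun h u
  simpa [eval₂_eq_eval_map] using this

lemma hom_pt_root {k : Type*} [Field k] (F : k[X][X]) (P : AdjoinRoot F →ₐ[k] k) :
    (F.map (evalRingHom (P (algebraMap k[X] (AdjoinRoot F) X)))).eval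
      (P (AdjoinRoot.root F)) = 0 := by
  rw [← hom_pt, AdjoinRoot.mk_self, map_zero]

open Polynomial

/-- a point with formal neighbourhoods of all orders -/
def HenselPt {k R : Type*} [Field k] [CommRing R] [Algebra k R] (x y : R) (P : R →ₐ[k] k) : Prop :=
  ∀ r : ℕ, 0 < r → ∃ θ : R →ₐ[k] AdjoinRoot (X ^ r : k[X]), Function.Surjective θ ∧
    (θ x - algebraMap k _ (P x)) ^ r = 0 ∧ (θ y - algebraMap k _ (P y)) ^ r = 0

namespace PlaneData
variable {k R : Type*} [Field k] [CommRing R] [IsDomain R] [Algebra k R] {x y : R} {d B : ℕ}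

/-- the auxiliary function -/
noncomputable def aux (x y : R) (d N A r : ℕ) (β : (Fin d × Fin N) × (Fin A × Fin d) → k) : R :=
  ∑ t, β t • (x ^ (t.2.1 : ℕ) * y ^ (t.2.2 : ℕ) * ((x ^ (t.1.2 : ℕ)) ^ r * (y ^ (t.1.1 : ℕ)) ^ r))

lemma sub_pow_eq_zero' {S : Type*} [CommRing S] (p : ℕ) [Fact p.Prime] [CharP S p] (m : ℕ) {a b : S}
    (h : (a - b) ^ p ^ m = 0) : a ^ p ^ m = b ^ p ^ m := by
  rw [sub_pow_char_pow] at h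
  exact sub_eq_zero.1 h

lemma aux_inj (H : PlaneData k R x y d B) (p : ℕ) [Fact p.Prime] [CharP k p] [IsAlgClosed k]
    (hens : ∀ M : ℕ, ∃ S : Finset (R →ₐ[k] k), M < S.card ∧ ∀ P ∈ S, HenselPt x y P)
    (N A m : ℕ) (hA : d * (A + 2 * (B * d)) < p ^ m)
    (β : (Fin d × Fin N) × (Fin A × Fin d) → k) (h : aux x y d N A (p ^ m) β = 0) : β = 0 := by
  classical
  set r := p ^ m with hr
  have hr0 : 0 < r := Nat.pow_pos (Fact.out : p.Prime).pos
  have key : ∀ P : R →ₐ[k] k, HenselPt x y P → ∀ v : Fin A × Fin d,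
      ∑ u : Fin d × Fin N, β (u, v) * ((P x ^ (u.2 : ℕ)) ^ r * (P y ^ (u.1 : ℕ)) ^ r) = 0 := by
    intro P hP
    obtain ⟨θ, hs, hx, hy⟩ := hP r hr0
    have hd : (X ^ r : k[X]).Monic := monic_X_pow r
    have : Nontrivial (AdjoinRoot (X ^ r : k[X])) :=
      AdjoinRoot.nontrivial _ (by rw [degree_X_pow]; exact_mod_cast hr0.ne')
    have : CharP (AdjoinRoot (X ^ r : k[X])) p := charP_of_injective_algebraMap (algebraMap k _).injective p
    replace hx := sub_pow_eq_zero' p m hx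
    replace hy := sub_pow_eq_zero' p m hy
    set b : R := ∑ v : Fin A × Fin d, (∑ u : Fin d × Fin N, β (u, v) * ((P x ^ (u.2 : ℕ)) ^ r * (P y ^ (u.1 : ℕ)) ^ r)) •
      (x ^ (v.1 : ℕ) * y ^ (v.2 : ℕ)) with hb
    have hθ : θ b = 0 := by
      have h' : θ (aux x y d N A r β) = 0 := by rw [h, map_zero]
      rw [← h', aux, hb, map_sum, map_sum]
      refine Eq.trans ?_ (Fintype.sum_prod_type_right _).symm
      refine Finset.sum_congr rfl fun v _ => ?_
      rw [Finset.sum_smul, map_sum]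
      refine Finset.sum_congr rfl fun u _ => ?_
      have e1 : (θ x ^ (u.2 : ℕ)) ^ r = algebraMap k _ ((P x ^ (u.2 : ℕ)) ^ r) := by
        rw [pow_right_comm, hx, ← map_pow, ← map_pow, pow_right_comm]
      have e2 : (θ y ^ (u.1 : ℕ)) ^ r = algebraMap k _ ((P y ^ (u.1 : ℕ)) ^ r) := by
        rw [pow_right_comm, hy, ← map_pow, ← map_pow, pow_right_comm]
      simp only [map_mul, map_pow, Algebra.smul_def, AlgHom.commutes] at e1 e2 ⊢
      rw [e1, e2]
      ring
    have hbW : b ∈ W k x y B (A + B * d) := by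
      refine Submodule.sum_mem _ fun v _ => Submodule.smul_mem _ _ (mono_mem ?_)
      have := Nat.mul_le_mul_left B v.2.2.le
      have := v.1.2
      omega
    have hb0 : b = 0 := by
      by_contra hne
      have : Module.Finite k (AdjoinRoot (X ^ r : k[X])) := hd.finite_adjoinRoot
      have h1 := H.finrank_le hne hbW θ.toLinearMap hs (by intro a; simp [hθ])
      have h2 : Module.finrank k (AdjoinRoot (X ^ r : k[X])) = r := by
        rw [(AdjoinRoot.powerBasis' hd).finrank]
        simp
      rw [h2] at h1
      have : A + B * d + B * d = A + 2 * (B * d) := by ring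
      rw [this] at h1
      omega
    have hli : LinearIndependent k (fun v : Fin A × Fin d => x ^ (v.1 : ℕ) * y ^ (v.2 : ℕ)) := by
      refine H.indep.comp (fun v : Fin A × Fin d => (((v.1 : ℕ), v.2) : ℕ × Fin d)) ?_
      rintro ⟨a, b⟩ ⟨a', b'⟩ h
      simp only [Prod.mk.injEq] at h ⊢
      exact ⟨Fin.ext h.1, h.2⟩
    rw [Fintype.linearIndependent_iff] at hli
    exact hli _ (hb ▸ hb0)
  obtain ⟨δ, hδ⟩ : ∃ δ : (Fin d × Fin N) × (Fin A × Fin d) → k, ∀ t, δ t ^ r = β t := by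
    choose δ hδ using fun t => IsAlgClosed.exists_pow_nat_eq (β t) hr0
    exact ⟨δ, hδ⟩
  obtain ⟨S, hS, hS2⟩ := hens (d * (N + B * d + B * d))
  funext t
  obtain ⟨u, v⟩ := t
  set a : R := ∑ u : Fin d × Fin N, δ (u, v) • (x ^ (u.2 : ℕ) * y ^ (u.1 : ℕ)) with ha
  have haW : a ∈ W k x y B (N + B * d) := by
    refine Submodule.sum_mem _ fun v _ => Submodule.smul_mem _ _ (mono_mem ?_)
    have := Nat.mul_le_mul_left B v.1.2.le
    have := v.2.2
    omega
  have ha0 : a = 0 := by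
    by_contra hne
    have := H.card_le hne haW S (by
      intro P hP
      have h1 := key P (hS2 P hP) v
      have : P a ^ r = 0 := by
        rw [← h1, ha, map_sum, hr, sum_pow_char_pow]
        refine Finset.sum_congr rfl fun u _ => ?_
        rw [map_smul, smul_eq_mul, mul_pow, ← hr, hδ]
        simp [mul_pow]
      exact pow_eq_zero_iff (hr0.ne') |>.1 this)
    omega
  have hli : LinearIndependent k (fun u : Fin d × Fin N => x ^ (u.2 : ℕ) * y ^ (u.1 : ℕ)) := by
    refine H.indep.comp (fun v : Fin d × Fin N => (((v.2 : ℕ), v.1) : ℕ × Fin d)) ?_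
    rintro ⟨a, b⟩ ⟨a', b'⟩ h
    simp only [Prod.mk.injEq] at h ⊢
    exact ⟨h.2, Fin.ext h.1⟩
  rw [Fintype.linearIndependent_iff] at hli
  have := hli _ (ha ▸ ha0) u
  rw [← hδ, this]
  simp [hr0.ne']

/-- Stepanov's bound for given parameters -/
lemma stepanov_param (H : PlaneData k R x y d B) (p : ℕ) [Fact p.Prime] [CharP k p] [IsAlgClosed k]
    (hens : ∀ M : ℕ, ∃ S : Finset (R →ₐ[k] k), M < S.card ∧ ∀ P ∈ S, HenselPt x y P)
    (h : ℕ → ℕ → R) (e w : ℕ) (hw : ∀ j < d, ∀ i < e, h j i ∈ W k x y B w)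
    (N A m : ℕ) (hA : d * (A + 2 * (B * d)) < p ^ m)
    (hN : e * (p ^ m * (A + B * d) + N + w + 1) < d * N * A) (c : k)
    (S : Finset (R →ₐ[k] k))
    (hS : ∀ P ∈ S, P x ^ (p ^ m * p ^ m) = P x + c ∧
      ∀ j < d, (P y ^ (p ^ m * p ^ m)) ^ j = ∑ i ∈ Finset.range e, P (h j i) * (P y ^ (p ^ m * p ^ m)) ^ i) :
    S.card ≤ d * (A + B * d + p ^ m * (N + B * d) + B * d) := by
  classical
  set r := p ^ m with hr
  have hr0 : 0 < r := Nat.pow_pos (Fact.out : p.Prime).pos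
  have : CharP R p := charP_of_injective_algebraMap (algebraMap k R).injective p
  set T := r * (A + B * d) + N + w with hT
  have mem : ∀ (i : Fin e) (t : (Fin d × Fin N) × (Fin A × Fin d)),
      (x ^ (t.2.1 : ℕ) * y ^ (t.2.2 : ℕ)) ^ r * (x + algebraMap k R c) ^ (t.1.2 : ℕ) * h t.1.1 i ∈ W k x y B T := by
    intro i t
    refine mul_mem (mul_mem (pow_mem (mono_mem ?_) r) ?_) (hw _ t.1.1.2 _ i.2)
    · have := Nat.mul_le_mul_left B t.2.2.2.le
      have := t.2.1.2
      omega
    · have h1 : x + algebraMap k R c ∈ W k x y B 1 := by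
        refine add_mem ?_ ?_
        · simpa using mono_mem (k := k) (x := x) (y := y) (B := B) (i := 1) (j := 0) (N := 1) (by simp)
        · rw [Algebra.algebraMap_eq_smul_one]; exact Submodule.smul_mem _ _ (one_mem _)
      refine W_mono ?_ (pow_mem h1 (t.1.2 : ℕ))
      have := t.1.2.2
      omega
  let Λ : ((Fin d × Fin N) × (Fin A × Fin d) → k) →ₗ[k] (Fin e → W k x y B T) :=
    LinearMap.pi fun i => Fintype.linearCombination k (fun t => ⟨_, mem i t⟩)
  have := H.finite_W T
  have hlt : Module.finrank k (Fin e → W k x y B T) < Module.finrank k ((Fin d × Fin N) × (Fin A × Fin d) → k) := by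
    rw [Module.finrank_pi_fintype, Module.finrank_fintype_fun_eq_card]
    simp only [Finset.sum_const, Finset.card_univ, Fintype.card_fin, smul_eq_mul, Fintype.card_prod]
    rw [H.finrank_W]
    have h1 := card_idx_le (d := d) (B := B) T
    have hd : 0 < d := by
      rcases Nat.eq_zero_or_pos d with h | h
      · rw [h] at hN; simp at hN
      · exact h
    calc e * (idx d B T).card ≤ e * (d * (T + 1)) := Nat.mul_le_mul_left _ h1
      _ = d * (e * (T + 1)) := by ring
      _ < d * (d * N * A) := Nat.mul_lt_mul_of_pos_left hN hd
      _ = _ := by ring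
  obtain ⟨γ, hγ, hγ0⟩ := Submodule.exists_mem_ne_zero_of_ne_bot (LinearMap.ker_ne_bot_of_finrank_lt (f := Λ) hlt)
  obtain ⟨β, hβ⟩ : ∃ β : (Fin d × Fin N) × (Fin A × Fin d) → k, ∀ t, β t ^ r = γ t := by
    choose δ hδ using fun t => IsAlgClosed.exists_pow_nat_eq (γ t) hr0
    exact ⟨δ, hδ⟩
  have hne : aux x y d N A r β ≠ 0 := by
    intro h0
    apply hγ0
    have := H.aux_inj p hens N A m hA β h0
    funext t
    rw [← hβ, this]; simp [hr0.ne']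
  have hW : aux x y d N A r β ∈ W k x y B (A + B * d + r * (N + B * d)) := by
    refine Submodule.sum_mem _ fun t _ => Submodule.smul_mem _ _ (mul_mem (mono_mem ?_) ?_)
    · have := Nat.mul_le_mul_left B t.2.2.2.le
      have := t.2.1.2
      omega
    · rw [← mul_pow]
      refine pow_mem (mono_mem ?_) r
      have := Nat.mul_le_mul_left B t.1.1.2.le
      have := t.1.2.2
      omega
  refine H.card_le hne hW S ?_
  intro P hP
  obtain ⟨hx, hy⟩ := hS P hP
  refine (pow_eq_zero_iff hr0.ne').1 ?_
  rw [aux, map_sum, hr, sum_pow_char_pow, ← hr]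
  have hker : ∀ i : Fin e, ∑ t, γ t * ((P x ^ (t.2.1 : ℕ) * P y ^ (t.2.2 : ℕ)) ^ r * (P x + c) ^ (t.1.2 : ℕ) * P (h t.1.1 i)) = 0 := by
    intro i
    have h1 : (Λ γ) i = 0 := by
      rw [LinearMap.mem_ker.1 hγ]; rfl
    have h2 := congrArg (fun a : W k x y B T => P (a : R)) h1
    simpa [Λ, Fintype.linearCombination_apply] using h2
  calc _ = ∑ t : (Fin d × Fin N) × (Fin A × Fin d), ∑ i : Fin e, (P y ^ (r * r)) ^ (i : ℕ) *
        (γ t * ((P x ^ (t.2.1 : ℕ) * P y ^ (t.2.2 : ℕ)) ^ r * (P x + c) ^ (t.1.2 : ℕ) * P (h t.1.1 i))) := by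
        refine Finset.sum_congr rfl fun t _ => ?_
        have h3 := hy t.1.1 t.1.1.2
        rw [Finset.sum_range] at h3
        simp only [map_smul, map_mul, map_pow, smul_eq_mul, mul_pow]
        rw [hβ]
        have h4 : ((P x ^ (t.1.2 : ℕ)) ^ r) ^ r = (P x + c) ^ (t.1.2 : ℕ) := by
          rw [← hx]; ring
        have h5 : ((P y ^ (t.1.1 : ℕ)) ^ r) ^ r = ∑ i : Fin e, P (h t.1.1 i) * (P y ^ (r * r)) ^ (i : ℕ) := by
          rw [← h3]; ring
        rw [h4, h5, Finset.mul_sum, Finset.mul_sum, Finset.mul_sum]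
        refine Finset.sum_congr rfl fun i _ => ?_
        ring
    _ = ∑ i : Fin e, (P y ^ (r * r)) ^ (i : ℕ) * 0 := by
        rw [Finset.sum_comm]
        refine Finset.sum_congr rfl fun i _ => ?_
        rw [← Finset.mul_sum, hker]
    _ = 0 := by simp

/-- Stepanov's bound -/
lemma stepanov (H : PlaneData k R x y d B) (hd : 0 < d) (p : ℕ) [Fact p.Prime] [CharP k p] [IsAlgClosed k]
    (hens : ∀ M : ℕ, ∃ S : Finset (R →ₐ[k] k), M < S.card ∧ ∀ P ∈ S, HenselPt x y P)
    (h : R[X]) (hm : h.Monic) :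
    ∃ C r₀ : ℕ, ∀ m : ℕ, r₀ ≤ p ^ m → ∀ c : k, ∀ S : Finset (R →ₐ[k] k),
      (∀ P ∈ S, P x ^ (p ^ m * p ^ m) = P x + c ∧
        (h.map (P : R →+* k)).eval (P y ^ (p ^ m * p ^ m)) = 0) →
      S.card ≤ h.natDegree * (p ^ m * p ^ m) + C * p ^ m := by
  classical
  set e := h.natDegree with he
  let hh : ℕ → ℕ → R := fun j i => (X ^ j %ₘ h).coeff i
  obtain ⟨w, hw⟩ : ∃ w, ∀ j < d, ∀ i < e, hh j i ∈ W k x y B w := by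
    choose f hf using fun j i => H.exists_mem_W (hh j i)
    refine ⟨∑ j ∈ Finset.range d, ∑ i ∈ Finset.range e, f j i, fun j hj i hi => W_mono ?_ (hf j i)⟩
    exact (Finset.single_le_sum (f := fun i => f j i) (fun _ _ => Nat.zero_le _) (Finset.mem_range.2 hi)).trans
      (Finset.single_le_sum (f := fun j => ∑ i ∈ Finset.range e, f j i) (fun _ _ => Nat.zero_le _) (Finset.mem_range.2 hj))
  have hrel : ∀ (P : R →ₐ[k] k) (z : k), (h.map (P : R →+* k)).eval z = 0 → ∀ j,
      z ^ j = ∑ i ∈ Finset.range e, P (hh j i) * z ^ i := by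
    intro P z hz j
    by_cases he0 : h = 1
    · rw [he0] at hz; simp at hz
    have h1 := congrArg (fun u => (u.map (P : R →+* k)).eval z) (modByMonic_add_div (X ^ j : R[X]) h)
    simp only [Polynomial.map_add, Polynomial.map_mul, eval_add, eval_mul, hz, zero_mul, add_zero,
      Polynomial.map_pow, map_X, eval_pow, eval_X] at h1
    rw [← h1]
    rw [eval_eq_sum_range' (n := e) ((natDegree_map_le).trans_lt (natDegree_modByMonic_lt _ hm he0))]
    refine Finset.sum_congr rfl fun i _ => ?_
    simp [hh]
  set κ := 2 + 2 * d * (e * (B * d + e + w + 2)) with hκ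
  refine ⟨d + 2 * (B * d * d) + d * κ + B * d * d, κ + 2 * d * (2 * (B * d) + 2), fun m hm c S hS => ?_⟩
  set r := p ^ m with hr
  -- parameters
  set A := r / d - (2 * (B * d) + 1) with hA
  set N := e * r / d + κ with hN
  have hq1 : d * (r / d) ≤ r := Nat.mul_div_le r d
  have hq2 : r < d * (r / d) + d := by
    have := Nat.div_add_mod r d; have := Nat.mod_lt r hd; omega
  have hqd : 2 * (2 * (B * d) + 2) ≤ r / d := by
    rw [Nat.le_div_iff_mul_le hd]; nlinarith
  have hA' : A + (2 * (B * d) + 1) = r / d := by omega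
  have hA1 : d * (A + 2 * (B * d)) < r := by
    have : A + 2 * (B * d) + 1 = r / d := by omega
    nlinarith
  have hA2 : r ≤ 2 * d * A := by
    have h1 : r / d + 1 ≤ 2 * A := by omega
    nlinarith
  have hn1 : d * (e * r / d) ≤ e * r := Nat.mul_div_le _ d
  have hn2 : e * r < d * (e * r / d) + d := by
    have := Nat.div_add_mod (e * r) d; have := Nat.mod_lt (e * r) hd; omega
  have hN1 : d * N ≤ e * r + d * κ := by rw [hN, Nat.mul_add]; omega
  have hN2 : e * r + d * (κ - 1) ≤ d * N := by
    have : κ = (κ - 1) + 1 := by omega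
    rw [hN, this, Nat.mul_add, Nat.mul_add]; simp; omega
  have hN3 : N ≤ (e + 1) * r := by
    have : e * r / d ≤ e * r := Nat.div_le_self _ _
    have : κ ≤ r := by omega
    rw [hN]; nlinarith
  have hr1 : 1 ≤ r := by omega
  have hmain : e * (r * (A + B * d) + N + w + 1) < d * N * A := by
    have hApos : 0 < A := by omega
    have e1 : (e * r + d * (κ - 1)) * A ≤ d * N * A := Nat.mul_le_mul_right _ hN2
    have e2 : κ - 1 = 1 + 2 * d * (e * (B * d + e + w + 2)) := by omega
    rw [e2] at e1
    have e3 : e * (r * (B * d) + N + w + 1) ≤ e * (B * d + e + w + 2) * r := by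
      have h7 : w + 1 ≤ (w + 1) * r := Nat.le_mul_of_pos_right _ hr1
      have : r * (B * d) + N + w + 1 ≤ (B * d + e + w + 2) * r := by
        calc r * (B * d) + N + w + 1 ≤ r * (B * d) + (e + 1) * r + (w + 1) * r := by omega
          _ = _ := by ring
      calc _ ≤ e * ((B * d + e + w + 2) * r) := Nat.mul_le_mul_left _ this
        _ = _ := by ring
    have e4 : e * (B * d + e + w + 2) * r ≤ e * (B * d + e + w + 2) * (2 * d * A) := Nat.mul_le_mul_left _ hA2
    have e5 : 0 < d * A := Nat.mul_pos hd hApos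
    have e6 : e * (B * d + e + w + 2) * (2 * d * A) ≤ d * (e * (B * d + e + w + 2) * (2 * d * A)) :=
      Nat.le_mul_of_pos_left _ hd
    calc e * (r * (A + B * d) + N + w + 1) = e * r * A + e * (r * (B * d) + N + w + 1) := by ring
      _ < e * r * A + (d * (e * (B * d + e + w + 2) * (2 * d * A)) + d * A) := by omega
      _ = (e * r + d * (1 + 2 * d * (e * (B * d + e + w + 2)))) * A := by ring
      _ ≤ _ := e1
  have := H.stepanov_param p hens hh e w hw N A m hA1 hmain c S (fun P hP => ⟨(hS P hP).1, fun j _ =>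
    hrel P _ (hS P hP).2 j⟩)
  refine this.trans ?_
  rw [← hr]
  have hAr : A ≤ r := by have := Nat.div_le_self r d; omega
  have f1 : d * A ≤ d * r := Nat.mul_le_mul_left _ hAr
  have f2 : d * (B * d) + d * (B * d) ≤ 2 * (B * d * d) * r := by
    calc d * (B * d) + d * (B * d) = 2 * (B * d * d) * 1 := by ring
      _ ≤ _ := Nat.mul_le_mul_left _ hr1
  have f3 : r * (d * N) ≤ r * (e * r + d * κ) := Nat.mul_le_mul_left _ hN1
  calc d * (A + B * d + r * (N + B * d) + B * d)
      = d * A + (d * (B * d) + d * (B * d)) + r * (d * N) + B * d * d * r := by ring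
    _ ≤ d * r + 2 * (B * d * d) * r + r * (e * r + d * κ) + B * d * d * r := by omega
    _ = _ := by ring

end PlaneData

open Polynomial

section hens
variable {k : Type*} [Field k]

/-- reduction map -/
noncomputable def redU (r : ℕ) (hr : 0 < r) : AdjoinRoot (X ^ r : k[X]) →ₐ[k] k :=
  AdjoinRoot.liftAlgHom _ (Algebra.ofId k k) 0 (by simp [hr.ne'])

lemma redU_root (r : ℕ) (hr : 0 < r) : redU (k := k) r hr (AdjoinRoot.root _) = 0 := by
  simp [redU]

lemma redU_zero (r : ℕ) (hr : 0 < r) (u : AdjoinRoot (X ^ r : k[X])) (h : redU r hr u = 0) : u ^ r = 0 := by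
  induction u using AdjoinRoot.induction_on with
  | ih q =>
  have h1 : q.eval 0 = 0 := by
    have : redU r hr (AdjoinRoot.mk _ q) = q.eval 0 := by
      rw [redU, AdjoinRoot.liftAlgHom_mk]
      simp [eval₂_eq_eval_map, Algebra.ofId]
    rw [← this]; exact h
  rw [← coeff_zero_eq_eval_zero, ← X_dvd_iff] at h1
  rw [← map_pow, AdjoinRoot.mk_eq_zero]
  exact pow_dvd_pow_of_dvd h1 r

lemma henselPt_of (F : k[X][X]) (P : AdjoinRoot F →ₐ[k] k)
    (hP : P (AdjoinRoot.mk F (derivative F)) ≠ 0) :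
    HenselPt (algebraMap k[X] (AdjoinRoot F) X) (AdjoinRoot.root F) P := by
  intro r hr
  set a := P (algebraMap k[X] (AdjoinRoot F) X) with ha
  set b := P (AdjoinRoot.root F) with hb
  let U := AdjoinRoot (X ^ r : k[X])
  let φ : k[X] →ₐ[k] U := aeval (algebraMap k U a + AdjoinRoot.root _)
  have hcomm : ∀ c : k, redU r hr (algebraMap k U c) = c := fun c => (redU r hr).commutes c
  have hred : (redU r hr : U →ₐ[k] k).comp φ = aeval a := by
    ext
    simp [φ, redU_root, hcomm]
  have hred' : ((redU r hr : U →ₐ[k] k) : U →+* k).comp (φ : k[X] →+* U) = evalRingHom a := by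
    have := congrArg (fun f : k[X] →ₐ[k] k => (f : k[X] →+* k)) hred
    refine RingHom.ext fun q => ?_
    have := DFunLike.congr_fun this q
    simpa [coe_aeval_eq_eval] using this
  have hev : ∀ G : k[X][X], redU r hr ((G.map (φ : k[X] →+* U)).eval (algebraMap k U b)) =
      (G.map (evalRingHom a)).eval b := by
    intro G
    rw [← hred', ← Polynomial.map_map]
    have : b = redU r hr (algebraMap k U b) := (hcomm b).symm
    conv_rhs => rw [this]
    rw [← AlgHom.coe_toRingHom, eval_map_apply]
  have hnil : ∀ u : U, redU r hr u = 0 → IsNilpotent u := fun u hu => ⟨r, redU_zero r hr u hu⟩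
  have hunit : ∀ u : U, redU r hr u ≠ 0 → IsUnit u := by
    intro u hu
    have h1 : IsNilpotent (u - algebraMap k U (redU r hr u)) := hnil _ (by rw [map_sub, hcomm, sub_self])
    have h2 : IsUnit (algebraMap k U (redU r hr u)) := (IsUnit.mk0 _ hu).map _
    have := h1.isUnit_add_left_of_commute h2 (Commute.all _ _)
    simpa using this
  obtain ⟨y', ⟨hy1, hy2⟩, -⟩ := Polynomial.existsUnique_nilpotent_sub_and_aeval_eq_zero
    (P := F.map (φ : k[X] →+* U)) (x := algebraMap k U b)
    (hnil _ (by
      rw [coe_aeval_eq_eval, hev, ha, hb]; exact hom_pt_root F P))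
    (hunit _ (by
      rw [coe_aeval_eq_eval, derivative_map, hev, ha, hb, ← hom_pt]; exact hP))
  have hyroot : F.eval₂ (φ : k[X] →+* U) y' = 0 := by
    rw [eval₂_eq_eval_map]
    rwa [coe_aeval_eq_eval] at hy2
  let θ : AdjoinRoot F →ₐ[k] U := AdjoinRoot.liftAlgHom F φ y' hyroot
  have hθx : θ (algebraMap k[X] (AdjoinRoot F) X) = algebraMap k U a + AdjoinRoot.root _ := by
    simp [θ, φ]
  have hθy : θ (AdjoinRoot.root F) = y' := by simp [θ]
  refine ⟨θ, ?_, ?_, ?_⟩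
  · rw [← AlgHom.range_eq_top, eq_top_iff, ← AdjoinRoot.adjoinRoot_eq_top]
    apply Algebra.adjoin_le
    rintro _ rfl
    refine ⟨algebraMap k[X] (AdjoinRoot F) X - algebraMap k _ a, ?_⟩
    change θ _ = _
    rw [map_sub, hθx]; simp
  · rw [hθx]
    apply redU_zero r hr
    rw [add_sub_cancel_left]
    exact redU_root r hr
  · rw [hθy]
    apply redU_zero r hr
    rw [map_sub]
    have h1 : IsNilpotent (redU r hr (algebraMap k U b - y')) := hy1.map (redU r hr)
    have h2 := h1.eq_zero
    rw [map_sub] at h2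
    rw [← neg_sub, h2, neg_zero]

end hens

open Polynomial

/-- evaluation of a bivariate polynomial -/
noncomputable abbrev ev2 {k : Type*} [Field k] (u : k[X][X]) (a b : k) : k := (u.map (evalRingHom a)).eval b

section
variable {k : Type*} [Field k]

lemma ev2_mul (u v : k[X][X]) (a b : k) : ev2 (u * v) a b = ev2 u a b * ev2 v a b := by
  simp [ev2]

lemma ev2_sub (u v : k[X][X]) (a b : k) : ev2 (u - v) a b = ev2 u a b - ev2 v a b := by
  simp [ev2]

lemma isDomain_adj (F : k[X][X]) (hF : Irreducible F) : IsDomain (AdjoinRoot F) :=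
  AdjoinRoot.isDomain_of_prime hF.prime

open PlaneData in
lemma mk_mem_W (F u : k[X][X]) (B M D : ℕ) (hM : ∀ j, (u.coeff j).natDegree ≤ M) (hD : u.natDegree ≤ D) :
    AdjoinRoot.mk F u ∈ W k (algebraMap k[X] (AdjoinRoot F) X) (AdjoinRoot.root F) B (M + B * D) := by
  rw [← AdjoinRoot.aeval_eq, aeval_eq_sum_range]
  refine Submodule.sum_mem _ fun j hj => ?_
  rw [Algebra.smul_def]
  refine mul_mem ?_ (W_mono ?_ (mono_mem (i := 0) (j := j) le_rfl) |> fun h => by simpa using h)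
  · have := aeval_mem (k := k) (x := algebraMap k[X] (AdjoinRoot F) X) (y := AdjoinRoot.root F) (B := B)
      (u.coeff j) (hM j)
    rwa [aeval_algebraMap_apply, aeval_X_left_apply] at this
  · have := Finset.mem_range.1 hj
    have : j ≤ D := by omega
    have := Nat.mul_le_mul_left B this
    omega

lemma exists_homs (F : k[X][X]) (S : Finset (k × k)) (hS : ∀ s ∈ S, ev2 F s.1 s.2 = 0) :
    ∃ S' : Finset (AdjoinRoot F →ₐ[k] k), S'.card = S.card ∧ ∀ P ∈ S',
      (P (algebraMap k[X] (AdjoinRoot F) X), P (AdjoinRoot.root F)) ∈ S := by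
  classical
  let f : S → (AdjoinRoot F →ₐ[k] k) := fun s => ptHom F s.1.1 s.1.2 (hS s.1 s.2)
  have hfs : ∀ s : S, (f s (algebraMap k[X] (AdjoinRoot F) X), f s (AdjoinRoot.root F)) = s.1 := by
    intro s
    exact Prod.ext (ptHom_x F s.1.1 s.1.2 (hS s.1 s.2)) (ptHom_y F s.1.1 s.1.2 (hS s.1 s.2))
  have hf : Function.Injective f := by
    intro s t hst
    apply Subtype.ext
    rw [← hfs s, ← hfs t, hst]
  refine ⟨Finset.univ.image f, ?_, ?_⟩
  · rw [Finset.card_image_of_injective _ hf, Finset.card_univ, Fintype.card_coe]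
  · intro P hP
    obtain ⟨s, -, rfl⟩ := Finset.mem_image.1 hP
    rw [hfs]; exact s.2

/-- Lemma Z for pairs -/
lemma pairs_card_le (F : k[X][X]) (hF : F.Monic) (hi : Irreducible F) (B : ℕ)
    (hB : ∀ j, (F.coeff j).natDegree ≤ B) (u : k[X][X]) (hu : ¬ F ∣ u) (M D : ℕ)
    (hM : ∀ j, (u.coeff j).natDegree ≤ M) (hD : u.natDegree ≤ D) (S : Finset (k × k))
    (hS : ∀ s ∈ S, ev2 F s.1 s.2 = 0 ∧ ev2 u s.1 s.2 = 0) :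
    S.card ≤ F.natDegree * (M + B * D + B * F.natDegree) := by
  have := isDomain_adj F hi
  have H := planeData_adjoinRoot F hF B hB
  have h0 : AdjoinRoot.mk F u ≠ 0 := by rwa [Ne, AdjoinRoot.mk_eq_zero]
  obtain ⟨S', h1, h2⟩ := exists_homs F S (fun s hs => (hS s hs).1)
  rw [← h1]
  refine H.card_le h0 (mk_mem_W F u B M D hM hD) S' fun P hP => ?_
  rw [hom_pt]
  exact (hS _ (h2 P hP)).2

lemma exists_coeff_bound (F : k[X][X]) : ∃ B, ∀ j, (F.coeff j).natDegree ≤ B := by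
  refine ⟨∑ j ∈ F.support, (F.coeff j).natDegree, fun j => ?_⟩
  by_cases hj : j ∈ F.support
  · exact Finset.single_le_sum (f := fun j => (F.coeff j).natDegree) (fun _ _ => Nat.zero_le _) hj
  · rw [notMem_support_iff.1 hj]; simp

lemma pairs_bound (F : k[X][X]) (hF : F.Monic) (hi : Irreducible F) (u : k[X][X]) (hu : ¬ F ∣ u) :
    ∃ C : ℕ, ∀ S : Finset (k × k), (∀ s ∈ S, ev2 F s.1 s.2 = 0 ∧ ev2 u s.1 s.2 = 0) → S.card ≤ C := by
  obtain ⟨B, hB⟩ := exists_coeff_bound F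
  obtain ⟨M, hM⟩ := exists_coeff_bound u
  exact ⟨_, fun S hS => pairs_card_le F hF hi B hB u hu M _ hM le_rfl S hS⟩

lemma not_dvd_derivative (F : k[X][X]) (h0 : derivative F ≠ 0) : ¬ F ∣ derivative F := by
  intro h
  have h1 := natDegree_le_of_dvd h h0
  have h2 := natDegree_derivative_lt (p := F) (by
    intro h; apply h0; rw [eq_C_of_natDegree_eq_zero h]; simp)
  omega

lemma card_fiber [IsAlgClosed k] [DecidableEq k] (F : k[X][X]) (hF : F.Monic) (a : k)
    (h : ∀ b, ev2 F a b = 0 → ev2 (derivative F) a b ≠ 0) :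
    (F.map (evalRingHom a)).roots.toFinset.card = F.natDegree := by
  have hm := hF.map (evalRingHom a)
  rw [Multiset.toFinset_card_of_nodup, ← (IsAlgClosed.splits _).natDegree_eq_card_roots, hF.natDegree_map]
  refine nodup_roots ?_
  rw [separable_def]
  refine IsCoprime.symm ?_
  by_contra hc
  have := isCoprime_of_irreducible_dvd (x := derivative (F.map (evalRingHom a))) (y := F.map (evalRingHom a)) (by
    rintro ⟨-, h0⟩
    exact hm.ne_zero h0) (by
    intro z hz h1 h2
    obtain ⟨b, hb⟩ := IsAlgClosed.exists_root z (by
      intro h0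
      exact hz.not_isUnit (isUnit_iff_degree_eq_zero.2 h0))
    refine h b (hb.dvd h2) ?_
    have := hb.dvd h1
    rwa [derivative_map] at this)
  exact hc this

lemma natDegree_pos_of (F : k[X][X]) (hF : F.Monic) (hi : Irreducible F) : 0 < F.natDegree := by
  rcases Nat.eq_zero_or_pos F.natDegree with h | h
  · exact absurd (hF.natDegree_eq_zero.1 h) hi.ne_one
  · exact h

lemma hens_all [IsAlgClosed k] (F : k[X][X]) (hF : F.Monic) (hi : Irreducible F) (h0 : derivative F ≠ 0) (M : ℕ) :
    ∃ S : Finset (AdjoinRoot F →ₐ[k] k), M < S.card ∧ ∀ P ∈ S,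
      HenselPt (algebraMap k[X] (AdjoinRoot F) X) (AdjoinRoot.root F) P := by
  classical
  obtain ⟨C, hC⟩ := pairs_bound F hF hi _ (not_dvd_derivative F h0)
  have hd := natDegree_pos_of F hF hi
  have hroot : ∀ a : k, ∃ b, ev2 F a b = 0 := by
    intro a
    refine IsAlgClosed.exists_root (F.map (evalRingHom a)) ?_
    rw [degree_eq_natDegree (hF.map _).ne_zero, hF.natDegree_map]
    exact_mod_cast hd.ne'
  choose f hf using hroot
  have : Infinite k := IsAlgClosed.instInfinite
  obtain ⟨A, hA⟩ := Infinite.exists_subset_card_eq k (M + C + 1)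
  let S0 := A.image (fun a => (a, f a))
  have hS0 : S0.card = M + C + 1 := by
    rw [Finset.card_image_of_injective _ (fun a b h => congrArg Prod.fst h), hA]
  have hS1 : ∀ s ∈ S0, ev2 F s.1 s.2 = 0 := by
    intro s hs
    obtain ⟨a, -, rfl⟩ := Finset.mem_image.1 hs
    exact hf a
  have h1 := hC (S0.filter fun s => ev2 (derivative F) s.1 s.2 = 0) (by
    intro s hs
    rw [Finset.mem_filter] at hs
    exact ⟨hS1 s hs.1, hs.2⟩)
  have h2 := Finset.card_filter_add_card_filter_not (s := S0) (fun s => ev2 (derivative F) s.1 s.2 = 0)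
  obtain ⟨S', h3, h4⟩ := exists_homs F (S0.filter fun s => ¬ ev2 (derivative F) s.1 s.2 = 0) (by
    intro s hs
    exact hS1 s (Finset.mem_filter.1 hs).1)
  refine ⟨S', by omega, fun P hP => henselPt_of F P ?_⟩
  rw [hom_pt]
  exact (Finset.mem_filter.1 (h4 P hP)).2

/-- the counting statement over the algebraically closed field -/
lemma count_main [IsAlgClosed k] (p : ℕ) [Fact p.Prime] [CharP k p] (F : k[X][X]) (hF : F.Monic)
    (hi : Irreducible F) (h0 : derivative F ≠ 0) :
    ∃ C r₀ : ℕ, ∀ m : ℕ, 0 < m → r₀ ≤ p ^ m → ∀ c : k,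
      (∀ a b : k, a ^ (p ^ m * p ^ m) = a + c → ev2 F a b = 0 → ev2 F a (b ^ (p ^ m * p ^ m)) = 0) →
      ∀ S : Finset (k × k), (∀ a b, (a, b) ∈ S ↔
        ev2 F a b = 0 ∧ a ^ (p ^ m * p ^ m) = a + c ∧ b ^ (p ^ m * p ^ m) = b) →
      S.card ≤ p ^ m * p ^ m + C * p ^ m ∧ p ^ m * p ^ m ≤ S.card + C * p ^ m := by
  classical
  obtain ⟨B, hB⟩ := exists_coeff_bound F
  have := isDomain_adj F hi
  have H := planeData_adjoinRoot F hF B hB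
  have hd := natDegree_pos_of F hF hi
  set R := AdjoinRoot F with hR
  set d := F.natDegree with hd'
  obtain ⟨C1, r1, h1⟩ := H.stepanov hd p (hens_all F hF hi h0) (X - C (AdjoinRoot.root F)) (monic_X_sub_C _)
  let FR : R[X] := F.map (algebraMap k[X] R)
  have hFR : FR.Monic := hF.map _
  have hFRroot : FR.IsRoot (AdjoinRoot.root F) := by
    change eval _ _ = 0
    rw [eval_map_algebraMap, AdjoinRoot.aeval_eq, AdjoinRoot.mk_self]
  let G : R[X] := FR /ₘ (X - C (AdjoinRoot.root F))
  have hG : (X - C (AdjoinRoot.root F)) * G = FR := mul_divByMonic_eq_iff_isRoot.2 hFRroot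
  have hGm : G.Monic := (monic_X_sub_C (AdjoinRoot.root F)).of_mul_monic_left (by rw [hG]; exact hFR)
  have hGd : G.natDegree = d - 1 := by
    have := natDegree_divByMonic FR (monic_X_sub_C (AdjoinRoot.root F))
    rw [natDegree_X_sub_C, hF.natDegree_map] at this
    exact this
  obtain ⟨C2, r2, h2⟩ := H.stepanov hd p (hens_all F hF hi h0) G hGm
  obtain ⟨C3, h3⟩ := pairs_bound F hF hi _ (not_dvd_derivative F h0)
  refine ⟨C1 + C2 + d * C3, r1 + r2, fun m hm hr c hfrob S hS => ?_⟩
  set Q := p ^ m * p ^ m with hQ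
  have hr1 : 1 ≤ p ^ m := Nat.pow_pos (Fact.out : p.Prime).pos
  have hQ1 : 1 < Q := by
    have : 1 < p ^ m := Nat.one_lt_pow hm.ne' (Fact.out : p.Prime).one_lt
    rw [hQ]; nlinarith
  -- upper bound for S
  have hup : S.card ≤ Q + C1 * p ^ m := by
    obtain ⟨S', e1, e2⟩ := exists_homs F S (fun s hs => ((hS s.1 s.2).1 hs).1)
    rw [← e1]
    have := h1 m (by omega) c S' (by
      intro P hP
      obtain ⟨-, f2, f3⟩ := (hS _ _).1 (e2 P hP)
      refine ⟨f2, ?_⟩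
      rw [f3]; simp)
    rw [natDegree_X_sub_C, one_mul] at this
    exact this
  refine ⟨hup.trans (by nlinarith [Nat.zero_le (C2 * p ^ m), Nat.zero_le (d * C3 * p ^ m)]), ?_⟩
  -- the total set
  let Z : Finset k := (X ^ Q - X - C c : k[X]).roots.toFinset
  have hpol : (X ^ Q - X - C c : k[X]) = X ^ Q + (- X - C c) := by ring
  have hdeg : (- X - C c : k[X]).natDegree ≤ 1 := by
    have : (- X - C c : k[X]) = -(X + C c) := by ring
    rw [this, natDegree_neg, natDegree_X_add_C]
  have hmon : (X ^ Q - X - C c : k[X]).Monic := by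
    rw [hpol]
    exact monic_X_pow_add (lt_of_le_of_lt (degree_le_of_natDegree_le hdeg) (by exact_mod_cast hQ1))
  have hnd : (X ^ Q - X - C c : k[X]).natDegree = Q := by
    rw [hpol, natDegree_add_eq_left_of_natDegree_lt, natDegree_X_pow]
    rw [natDegree_X_pow]; omega
  have hZmem : ∀ a, a ∈ Z ↔ a ^ Q = a + c := by
    intro a
    simp only [Z, Multiset.mem_toFinset, mem_roots hmon.ne_zero, IsRoot.def, eval_sub, eval_pow, eval_X, eval_C]
    rw [sub_sub, sub_eq_zero]
  have hpQ : (Q : k) = 0 := by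
    rw [hQ]; push_cast; rw [CharP.cast_eq_zero k p]; simp [hm.ne']
  have hZcard : Z.card = Q := by
    rw [Multiset.toFinset_card_of_nodup, ← (IsAlgClosed.splits _).natDegree_eq_card_roots, hnd]
    refine nodup_roots ?_
    rw [separable_def]
    have : derivative (X ^ Q - X - C c : k[X]) = -1 := by
      rw [derivative_sub, derivative_sub, derivative_X_pow, hpQ]; simp
    rw [this]
    exact isCoprime_one_right.neg_right
  let T : Finset (k × k) := Z.biUnion fun a => (F.map (evalRingHom a)).roots.toFinset.image fun b => (a, b)
  have hT : ∀ a b, (a, b) ∈ T ↔ ev2 F a b = 0 ∧ a ^ Q = a + c := by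
    intro a b
    simp only [T, Finset.mem_biUnion, Finset.mem_image, Multiset.mem_toFinset]
    constructor
    · rintro ⟨a', ha', b', hb', h⟩
      obtain ⟨rfl, rfl⟩ := Prod.mk.inj h
      exact ⟨(mem_roots (hF.map _).ne_zero).1 hb', (hZmem _).1 ha'⟩
    · rintro ⟨h, h'⟩
      exact ⟨a, (hZmem a).2 h', b, (mem_roots (hF.map _).ne_zero).2 h, rfl⟩
  -- bad fibers
  let bad : Finset (k × k) := T.filter fun s => ev2 (derivative F) s.1 s.2 = 0
  have hbad : bad.card ≤ C3 := h3 bad (by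
    intro s hs
    rw [Finset.mem_filter] at hs
    exact ⟨((hT s.1 s.2).1 hs.1).1, hs.2⟩)
  have hTcard : d * Q ≤ T.card + d * C3 := by
    have e1 : T.card = ∑ a ∈ Z, (F.map (evalRingHom a)).roots.toFinset.card := by
      rw [Finset.card_biUnion]
      · refine Finset.sum_congr rfl fun a _ => ?_
        rw [Finset.card_image_of_injective _ (fun b b' h => congrArg Prod.snd h)]
      · intro a _ a' _ hne
        rw [Function.onFun, Finset.disjoint_left]
        intro s hs hs'
        obtain ⟨b, -, rfl⟩ := Finset.mem_image.1 hs
        obtain ⟨b', -, h⟩ := Finset.mem_image.1 hs'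
        exact hne (congrArg Prod.fst h).symm
    have e2 : ∑ a ∈ Z \ bad.image Prod.fst, d ≤ T.card := by
      rw [e1]
      refine le_trans (Finset.sum_le_sum fun a ha => ?_) (Finset.sum_le_sum_of_subset (Finset.sdiff_subset (t := bad.image Prod.fst)))
      rw [card_fiber F hF a]
      intro b hb hb'
      rw [Finset.mem_sdiff] at ha
      apply ha.2
      exact Finset.mem_image.2 ⟨(a, b), Finset.mem_filter.2 ⟨(hT a b).2 ⟨hb, (hZmem a).1 ha.1⟩, hb'⟩, rfl⟩
    rw [Finset.sum_const, smul_eq_mul] at e2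
    have e3 : Z.card ≤ (Z \ bad.image Prod.fst).card + C3 := by
      have := Finset.le_card_sdiff (bad.image Prod.fst) Z
      have := (Finset.card_image_le (s := bad) (f := Prod.fst)).trans hbad
      omega
    rw [hZcard] at e3
    nlinarith
  -- upper bound for the complement
  let S2 : Finset (k × k) := T \ S
  have hup2 : S2.card ≤ (d - 1) * Q + C2 * p ^ m := by
    obtain ⟨S', e1, e2⟩ := exists_homs F S2 (fun s hs => ((hT s.1 s.2).1 (Finset.mem_sdiff.1 hs).1).1)
    rw [← e1]
    have := h2 m (by omega) c S' (by
      intro P hP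
      obtain ⟨f1, f2⟩ := Finset.mem_sdiff.1 (e2 P hP)
      obtain ⟨f3, f4⟩ := (hT _ _).1 f1
      refine ⟨f4, ?_⟩
      have f5 : P (AdjoinRoot.root F) ^ Q ≠ P (AdjoinRoot.root F) := by
        intro f6
        exact f2 ((hS _ _).2 ⟨f3, f4, f6⟩)
      have f7 := hfrob _ _ f4 f3
      have f8 : FR.map (P : R →+* k) = F.map (evalRingHom (P (algebraMap k[X] R X))) := by
        rw [Polynomial.map_map]
        congr 1
        apply Polynomial.ringHom_ext
        · intro r
          simp only [RingHom.comp_apply, RingHom.coe_coe, coe_evalRingHom, eval_C]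
          have := P.commutes r
          rwa [IsScalarTower.algebraMap_apply k k[X] R] at this
        · simp
      rw [ev2, ← f8, ← hG, Polynomial.map_mul, eval_mul] at f7
      rcases mul_eq_zero.1 f7 with h | h
      · exfalso; apply f5
        simpa [sub_eq_zero] using h
      · exact h)
    rw [hGd] at this
    exact this
  have hsub : T.card ≤ S2.card + S.card := by
    have := Finset.le_card_sdiff S T
    change T.card ≤ (T \ S).card + S.card
    omega
  obtain ⟨d', hd''⟩ : ∃ d', d = d' + 1 := ⟨d - 1, by omega⟩
  have : d * C3 ≤ d * C3 * p ^ m := Nat.le_mul_of_pos_right _ hr1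
  have e9 : d - 1 = d' := by omega
  rw [e9] at hup2
  have e10 : d * Q = d' * Q + Q := by rw [hd'']; ring
  have e11 : (C1 + C2 + d * C3) * p ^ m = C1 * p ^ m + C2 * p ^ m + d * C3 * p ^ m := by ring
  omega
end

open Polynomial

section
/-- coprime degree base change -/
lemma irreducible_map_of_coprime {F0 M : Type*} [Field F0] [Field M] [Algebra F0 M] [FiniteDimensional F0 M]
    (f : F0[X]) (hm : f.Monic) (hi : Irreducible f) (hc : f.natDegree.Coprime (Module.finrank F0 M)) :
    Irreducible (f.map (algebraMap F0 M)) := by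
  have hd : 0 < f.natDegree := hi.natDegree_pos
  have hfm : (f.map (algebraMap F0 M)).Monic := hm.map _
  obtain ⟨u, hum, hu, hudvd⟩ := exists_monic_irreducible_factor (f.map (algebraMap F0 M)) (by
    intro h
    have := natDegree_eq_zero_of_isUnit h
    rw [hm.natDegree_map] at this; omega)
  have : Fact (Irreducible u) := ⟨hu⟩
  let N := AdjoinRoot u
  have hfin : FiniteDimensional M N := hum.finite_adjoinRoot
  have hfr : Module.finrank M N = u.natDegree := by
    rw [(AdjoinRoot.powerBasis hu.ne_zero).finrank, AdjoinRoot.powerBasis_dim]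
  have : FiniteDimensional F0 N := FiniteDimensional.trans F0 M N
  let α : N := AdjoinRoot.root u
  have hα : aeval α f = 0 := by
    obtain ⟨v, hv⟩ := hudvd
    rw [← aeval_map_algebraMap M, hv, map_mul, AdjoinRoot.aeval_eq, AdjoinRoot.mk_self, zero_mul]
  have h1 : minpoly F0 α = f := (minpoly.eq_of_irreducible_of_monic hi hα hm).symm
  have e3 : f.natDegree ∣ Module.finrank F0 N := by
    rw [← h1]
    exact minpoly.degree_dvd (Algebra.IsIntegral.isIntegral α)
  rw [← Module.finrank_mul_finrank F0 M N, hfr] at e3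
  have e4 : f.natDegree ∣ u.natDegree := hc.dvd_of_dvd_mul_left e3
  have e5 : f.map (algebraMap F0 M) = u := by
    refine eq_of_monic_of_dvd_of_natDegree_le hum hfm hudvd ?_
    rw [hm.natDegree_map]
    exact Nat.le_of_dvd hu.natDegree_pos e4
  rw [e5]
  exact hu

open IntermediateField in
/-- irreducibility after substitution -/
lemma irreducible_comp {k : Type*} [Field k] (G : k[X][X]) (hm : G.Monic) (hi : Irreducible G)
    (t : k[X]) (ht : 0 < t.natDegree) (hc : G.natDegree.Coprime t.natDegree) :
    Irreducible (G.map (compRingHom t)) := by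
  let f : RatFunc k := algebraMap k[X] (RatFunc k) t
  have hf : ¬ ∃ c, f = RatFunc.C c := by
    rintro ⟨c, hc⟩
    rw [← RatFunc.algebraMap_C] at hc
    have := RatFunc.algebraMap_injective k hc
    rw [this] at ht; simp at ht
  have htr := f.transcendental_of_ne_C hf
  have hfr : Module.finrank k⟮f⟯ (RatFunc k) = t.natDegree := by
    rw [RatFunc.finrank_eq_max_natDegree]
    simp [f, RatFunc.num_algebraMap, RatFunc.denom_algebraMap]
  have : FiniteDimensional k⟮f⟯ (RatFunc k) := FiniteDimensional.of_finrank_pos (by omega)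
  have h1 : Irreducible (G.map (algebraMap k[X] (RatFunc k))) :=
    (hm.irreducible_iff_irreducible_map_fraction_map).1 hi
  let e := RatFunc.algEquivOfTranscendental f htr
  have h2 : Irreducible ((G.map (algebraMap k[X] (RatFunc k))).mapEquiv e.toRingEquiv) :=
    (MulEquiv.irreducible_iff _).2 h1
  have h3 := irreducible_map_of_coprime (M := RatFunc k) _ (by
    rw [mapEquiv_apply]; exact (hm.map _).map _) h2 (by
      rw [hfr, mapEquiv_apply, (hm.map _).natDegree_map, hm.natDegree_map]; exact hc)
  refine ((hm.map _).irreducible_iff_irreducible_map_fraction_map (K := RatFunc k)).2 ?_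
  convert h3 using 1
  rw [mapEquiv_apply, Polynomial.map_map, Polynomial.map_map, Polynomial.map_map]
  congr 1
  apply Polynomial.ringHom_ext
  · intro a
    have := congrArg (algebraMap k⟮f⟯ (RatFunc k)) (e.commutes a)
    simp only [RingHom.comp_apply, RatFunc.algebraMap_C, coe_compRingHom_apply, C_comp]
    exact this.symm
  · simp [e, f]
end

open Polynomial

section
variable {K kb : Type*} [Field K] [Fintype K] [Field kb] [IsAlgClosed kb] [Algebra K kb]

/-- extended character -/
noncomputable def chx (χ : AddChar K ℂ) : kb → ℂ := Function.extend (algebraMap K kb) χ 0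

lemma chx_alg (χ : AddChar K ℂ) (c : K) : chx (kb := kb) χ (algebraMap K kb c) = χ c :=
  (algebraMap K kb).injective.extend_apply _ _ _

variable (K) in
/-- the trace sum -/
noncomputable def trN (n : ℕ) (x : kb) : kb := ∑ i ∈ Finset.range n, x ^ (Fintype.card K ^ i)

variable (K kb) in
/-- the subfield with q^n elements as a finset -/
noncomputable def Kn (n : ℕ) : Finset kb := by
  classical exact (X ^ (Fintype.card K ^ n) - X : kb[X]).roots.toFinset

lemma qn_gt {n : ℕ} (hn : 0 < n) : 1 < Fintype.card K ^ n := Nat.one_lt_pow hn.ne' Fintype.one_lt_card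

lemma mem_Kn {n : ℕ} (hn : 0 < n) (x : kb) : x ∈ Kn K kb n ↔ x ^ (Fintype.card K ^ n) = x := by
  classical
  rw [Kn, Multiset.mem_toFinset, mem_roots (FiniteField.X_pow_card_sub_X_ne_zero kb (qn_gt hn))]
  simp [sub_eq_zero]

lemma frob_add (x y : kb) (n : ℕ) : (x + y) ^ (Fintype.card K ^ n) = x ^ (Fintype.card K ^ n) + y ^ (Fintype.card K ^ n) := by
  obtain ⟨p, hp⟩ := CharP.exists K
  obtain ⟨e, hpr, he⟩ := FiniteField.card K p
  have : Fact p.Prime := ⟨hpr⟩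
  have : CharP kb p := charP_of_injective_algebraMap (algebraMap K kb).injective p
  rw [he, ← pow_mul]
  exact add_pow_char_pow ..

lemma frob_sub (x y : kb) (n : ℕ) : (x - y) ^ (Fintype.card K ^ n) = x ^ (Fintype.card K ^ n) - y ^ (Fintype.card K ^ n) := by
  have := frob_add (K := K) (x - y) y n
  rw [sub_add_cancel] at this
  rw [this]; ring

lemma trN_as (z : kb) (n : ℕ) : trN K n (z ^ Fintype.card K - z) = z ^ (Fintype.card K ^ n) - z := by
  unfold trN
  induction n with
  | zero => simp
  | succ n ih =>
    rw [Finset.sum_range_succ, ih, frob_sub, ← pow_mul, pow_succ' _ n]; ring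

lemma mem_K_of (t : kb) (h : t ^ Fintype.card K = t) : ∃ c : K, algebraMap K kb c = t := by
  classical
  have h1 : Finset.univ.image (algebraMap K kb) = Kn K kb 1 := by
    apply Finset.eq_of_subset_of_card_le
    · intro x hx
      obtain ⟨c, -, rfl⟩ := Finset.mem_image.1 hx
      rw [mem_Kn one_pos, pow_one, ← map_pow, FiniteField.pow_card]
    · rw [Finset.card_image_of_injective _ (algebraMap K kb).injective, Finset.card_univ, Kn]
      refine (Multiset.toFinset_card_le _).trans ((card_roots' _).trans ?_)
      rw [pow_one, FiniteField.X_pow_card_sub_X_natDegree_eq kb Fintype.one_lt_card]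
  have h2 : t ∈ Kn K kb 1 := by rw [mem_Kn one_pos, pow_one]; exact h
  rw [← h1] at h2
  simpa using h2

lemma exists_frob_fix [Algebra.IsAlgebraic K kb] (a : kb) : ∃ n > 0, a ^ (Fintype.card K ^ n) = a := by
  have hint : IsIntegral K a := Algebra.IsIntegral.isIntegral a
  have : FiniteDimensional K (IntermediateField.adjoin K {a}) := IntermediateField.adjoin.finiteDimensional hint
  have : Finite (IntermediateField.adjoin K {a}) := Module.finite_of_finite K
  have := Fintype.ofFinite (IntermediateField.adjoin K {a})
  refine ⟨Module.finrank K (IntermediateField.adjoin K {a}), Module.finrank_pos, ?_⟩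
  have := congrArg (algebraMap (IntermediateField.adjoin K {a}) kb) (FiniteField.pow_card (IntermediateField.AdjoinSimple.gen K a))
  rw [Module.card_eq_pow_finrank (K := K)] at this
  simpa using this

lemma frob_iter {a : kb} {n : ℕ} (h : a ^ (Fintype.card K ^ n) = a) (m : ℕ) : a ^ (Fintype.card K ^ (n * m)) = a := by
  induction m with
  | zero => simp
  | succ m ih => rw [Nat.mul_succ, pow_add, pow_mul, ih, h]

lemma exists_frob_fix_finset [Algebra.IsAlgebraic K kb] (S : Finset kb) :
    ∃ n > 0, ∀ a ∈ S, a ^ (Fintype.card K ^ n) = a := by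
  classical
  induction S using Finset.induction_on with
  | empty => exact ⟨1, one_pos, by simp⟩
  | insert a S _ ih =>
    obtain ⟨n, hn, h⟩ := ih
    obtain ⟨m, hm, h'⟩ := exists_frob_fix (K := K) a
    refine ⟨n * m, Nat.mul_pos hn hm, fun b hb => ?_⟩
    rcases Finset.mem_insert.1 hb with rfl | hb
    · rw [mul_comm]; exact frob_iter h' n
    · exact frob_iter (h b hb) m

lemma exists_frob_fix_poly [Algebra.IsAlgebraic K kb] (G : kb[X][X]) :
    ∃ n > 0, ∀ i j, ((G.coeff i).coeff j) ^ (Fintype.card K ^ n) = (G.coeff i).coeff j := by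
  classical
  obtain ⟨n, hn, h⟩ := exists_frob_fix_finset (K := K) (G.support.biUnion fun i => (G.coeff i).support.image fun j => (G.coeff i).coeff j)
  refine ⟨n, hn, fun i j => ?_⟩
  by_cases h0 : (G.coeff i).coeff j = 0
  · rw [h0, zero_pow (by have := qn_gt (K := K) hn; omega)]
  · refine h _ (Finset.mem_biUnion.2 ⟨i, ?_, Finset.mem_image.2 ⟨j, mem_support_iff.2 h0, rfl⟩⟩)
    rw [mem_support_iff]; rintro h1; rw [h1] at h0; simp at h0

variable (K kb) in
noncomputable def frobHom (n : ℕ) : kb →+* kb where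
  toFun x := x ^ (Fintype.card K ^ n)
  map_one' := one_pow _
  map_mul' x y := mul_pow ..
  map_zero' := zero_pow (pow_ne_zero _ Fintype.card_ne_zero)
  map_add' x y := frob_add x y n

lemma ev2_frob (G : kb[X][X]) (n : ℕ) (h : ∀ i j, ((G.coeff i).coeff j) ^ (Fintype.card K ^ n) = (G.coeff i).coeff j)
    (a b : kb) : ev2 G (a ^ (Fintype.card K ^ n)) (b ^ (Fintype.card K ^ n)) = (ev2 G a b) ^ (Fintype.card K ^ n) := by
  have e : ∀ x, frobHom K kb n x = x ^ (Fintype.card K ^ n) := fun _ => rfl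
  have hG : G.map (mapRingHom (frobHom K kb n)) = G := by
    ext i j
    simp [e, h]
  rw [← e, ← e, ← e, ev2, ev2, ← coe_evalRingHom, ← coe_evalRingHom, coe_evalRingHom, coe_evalRingHom,
    ← eval₂_at_apply, ← eval_map, Polynomial.map_map]
  conv_lhs => rw [← hG]
  rw [Polynomial.map_map]
  congr 2
  apply Polynomial.ringHom_ext
  · intro r; simp
  · simp

lemma ev2_comp (G : kb[X][X]) (t : kb[X]) (a b : kb) : ev2 (G.map (compRingHom t)) a b = ev2 G (t.eval a) b := by
  rw [ev2, ev2, Polynomial.map_map]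
  congr 2
  apply Polynomial.ringHom_ext <;> simp

lemma pol_as (c : kb) {q : ℕ} (hq : 1 < q) : (X ^ q - X - C c : kb[X]).Monic ∧ (X ^ q - X - C c : kb[X]).natDegree = q := by
  have hpol : (X ^ q - X - C c : kb[X]) = X ^ q + (- X - C c) := by ring
  have hdeg : (- X - C c : kb[X]).natDegree ≤ 1 := by
    have : (- X - C c : kb[X]) = -(X + C c) := by ring
    rw [this, natDegree_neg, natDegree_X_add_C]
  rw [hpol]
  constructor
  · exact monic_X_pow_add (lt_of_le_of_lt (degree_le_of_natDegree_le hdeg) (by exact_mod_cast hq))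
  · rw [natDegree_add_eq_left_of_natDegree_lt, natDegree_X_pow]
    rw [natDegree_X_pow]; omega

lemma card_as (c : kb) {n : ℕ} (hn : 0 < n) : ∃ Z : Finset kb, Z.card = Fintype.card K ^ n ∧
    ∀ z, z ∈ Z ↔ z ^ (Fintype.card K ^ n) = z + c := by
  classical
  obtain ⟨h1, h2⟩ := pol_as c (qn_gt (K := K) hn)
  have hq0 : ((Fintype.card K ^ n : ℕ) : kb) = 0 := by
    have : ((Fintype.card K : ℕ) : kb) = 0 := by
      have := congrArg (algebraMap K kb) (FiniteField.cast_card_eq_zero K)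
      rwa [map_natCast, map_zero] at this
    rw [Nat.cast_pow, this, zero_pow hn.ne']
  refine ⟨(X ^ (Fintype.card K ^ n) - X - C c : kb[X]).roots.toFinset, ?_, ?_⟩
  · rw [Multiset.toFinset_card_of_nodup, ← (IsAlgClosed.splits _).natDegree_eq_card_roots, h2]
    refine nodup_roots ?_
    rw [separable_def]
    have : derivative (X ^ (Fintype.card K ^ n) - X - C c : kb[X]) = -1 := by
      rw [derivative_sub, derivative_sub, derivative_X_pow, hq0]; simp
    rw [this]
    exact isCoprime_one_right.neg_right
  · intro a
    simp only [Multiset.mem_toFinset, mem_roots h1.ne_zero, IsRoot.def, eval_sub, eval_pow, eval_X, eval_C]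
    rw [sub_sub, sub_eq_zero]
end

open Polynomial

section
variable {K kb : Type*} [Field K] [Fintype K] [Field kb] [IsAlgClosed kb] [Algebra K kb]

/-- character sum over points -/
noncomputable def sumN (χ : AddChar K ℂ) (n : ℕ) (G : kb[X][X]) : ℂ := by
  classical exact ∑ s ∈ (Kn K kb n ×ˢ Kn K kb n).filter (fun s => ev2 G s.1 s.2 = 0), chx χ (trN K n s.1)

lemma sum_irred [Algebra.IsAlgebraic K kb] (p : ℕ) [Fact p.Prime] [CharP kb p] (χ : AddChar K ℂ) (hχ : χ ≠ 0) (G : kb[X][X]) (hm : G.Monic)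
    (hi : Irreducible G) (hd : G.natDegree < p) :
    ∃ n0 > 0, ∃ C : ℝ, ∀ m > 0, ‖sumN χ (n0 * m) G‖ ≤ C * Real.sqrt ((Fintype.card K : ℝ) ^ (n0 * m)) := by
  classical
  have hd0 := natDegree_pos_of G hm hi
  have hpK : CharP K p := (algebraMap K kb).charP (algebraMap K kb).injective p
  obtain ⟨e, hpr, he⟩ := FiniteField.card K p
  set q := Fintype.card K with hq
  have hq1 : 1 < q := Fintype.one_lt_card
  let t : kb[X] := X ^ q - X
  have ht : t.natDegree = q := FiniteField.X_pow_card_sub_X_natDegree_eq kb hq1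
  set F := G.map (compRingHom t) with hF
  have hFm : F.Monic := hm.map _
  have hFd : F.natDegree = G.natDegree := hm.natDegree_map _
  have hFi : Irreducible F := by
    refine irreducible_comp G hm hi t (by omega) ?_
    rw [ht, he]
    refine Nat.Coprime.pow_right _ ?_
    exact ((Nat.Prime.coprime_iff_not_dvd hpr).2 (Nat.not_dvd_of_pos_of_lt hd0 hd)).symm
  have hF0 : derivative F ≠ 0 := by
    intro h
    have h1 := congrArg (fun u => u.coeff (G.natDegree - 1)) h
    simp only [coeff_derivative, coeff_zero] at h1
    have h2 : G.natDegree - 1 + 1 = F.natDegree := by omega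
    rw [h2, hFm.coeff_natDegree, one_mul] at h1
    have h3 : ((F.natDegree : ℕ) : kb[X]) = 0 := by
      rw [← h2]; push_cast; exact h1
    rw [CharP.cast_eq_zero_iff kb[X] p, hFd] at h3
    exact Nat.not_dvd_of_pos_of_lt hd0 hd h3
  obtain ⟨C1, r0, hcount⟩ := count_main p F hFm hFi hF0
  obtain ⟨n1, hn1, hfix⟩ := exists_frob_fix_poly (K := K) G
  refine ⟨2 * n1 * (r0 + 1), by positivity, C1, fun m hmpos => ?_⟩
  set n := 2 * n1 * (r0 + 1) * m with hn
  have hnpos : 0 < n := by positivity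
  let M := e * (n1 * (r0 + 1) * m)
  have hM : p ^ M = q ^ (n1 * (r0 + 1) * m) := by
    rw [he, ← pow_mul]
  have hQ : p ^ M * p ^ M = q ^ n := by
    rw [hM, ← pow_add]; congr 1; rw [hn]; ring
  have hMpos : 0 < M := by
    have := e.pos
    positivity
  have hr : r0 ≤ p ^ M := by
    rw [hM]
    have h1 : r0 ≤ n1 * (r0 + 1) * m := by
      calc r0 ≤ 1 * (r0 + 1) * 1 := by omega
        _ ≤ _ := by gcongr <;> omega
    exact h1.trans (Nat.lt_pow_self hq1).le
  have hfixn : ∀ i j, ((G.coeff i).coeff j) ^ (q ^ n) = (G.coeff i).coeff j := by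
    intro i j
    have := frob_iter (K := K) (hfix i j) (2 * (r0 + 1) * m)
    rwa [show n1 * (2 * (r0 + 1) * m) = n by rw [hn]; ring] at this
  have hevF : ∀ a b, ev2 F a b = ev2 G (a ^ q - a) b := by
    intro a b; rw [hF, ev2_comp]; simp [t]
  have hcq : ∀ c : K, (algebraMap K kb c) ^ q = algebraMap K kb c := by
    intro c; rw [← map_pow, FiniteField.pow_card]
  have hpowq : ∀ x : kb, (x ^ q) ^ (q ^ n) = (x ^ (q ^ n)) ^ q := by
    intro x; rw [← pow_mul, ← pow_mul, mul_comm]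
  have hfa : ∀ x y : kb, (x + y) ^ q = x ^ q + y ^ q := by
    intro x y; have := frob_add (K := K) x y 1; rwa [pow_one] at this
  have hxfix : ∀ (a : kb) (c : K), a ^ (q ^ n) = a + algebraMap K kb c → (a ^ q - a) ^ (q ^ n) = a ^ q - a := by
    intro a c h
    rw [frob_sub, hpowq, h, hfa, hcq]; ring
  -- the sets A_c
  choose Z hZc hZ using fun c : kb => card_as (K := K) c hnpos
  let A : K → Finset (kb × kb) := fun c => (Z (algebraMap K kb c) ×ˢ Kn K kb n).filter fun s => ev2 F s.1 s.2 = 0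
  have hA : ∀ c a b, (a, b) ∈ A c ↔ ev2 F a b = 0 ∧ a ^ (q ^ n) = a + algebraMap K kb c ∧ b ^ (q ^ n) = b := by
    intro c a b
    simp only [A, Finset.mem_filter, Finset.mem_product, hZ, mem_Kn hnpos]
    tauto
  have hAc : ∀ c, |((A c).card : ℝ) - (q : ℝ) ^ n| ≤ C1 * (p : ℝ) ^ M := by
    intro c
    have h := hcount M hMpos hr (algebraMap K kb c) (by
      intro a b h1 h2
      rw [hQ] at h1 ⊢
      rw [hevF] at h2 ⊢
      have h3 := ev2_frob (K := K) G n hfixn (a ^ q - a) b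
      rw [h2, hxfix a c h1, zero_pow (pow_ne_zero _ (by omega))] at h3
      exact h3) (A c) (by
      intro a b; rw [hQ]; exact hA c a b)
    rw [hQ] at h
    have h1 : ((A c).card : ℝ) ≤ (q : ℝ) ^ n + C1 * (p : ℝ) ^ M := by exact_mod_cast h.1
    have h2 : (q : ℝ) ^ n ≤ ((A c).card : ℝ) + C1 * (p : ℝ) ^ M := by exact_mod_cast h.2
    rw [abs_le]; constructor <;> linarith
  let pts := (Kn K kb n ×ˢ Kn K kb n).filter (fun s => ev2 G s.1 s.2 = 0)
  have hsum : sumN χ n G = ∑ s ∈ pts, chx χ (trN K n s.1) := rfl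
  let U : Finset (kb × kb) := Finset.univ.biUnion A
  let φ : kb × kb → kb × kb := fun s => (s.1 ^ q - s.1, s.2)
  have hmaps : ∀ s ∈ U, φ s ∈ pts := by
    rintro ⟨a, b⟩ hs
    obtain ⟨c, -, hs⟩ := Finset.mem_biUnion.1 hs
    obtain ⟨h1, h2, h3⟩ := (hA c a b).1 hs
    simp only [φ, pts, Finset.mem_filter, Finset.mem_product, mem_Kn hnpos]
    exact ⟨⟨hxfix a c h2, h3⟩, by rw [← hevF]; exact h1⟩
  have hfib : ∀ s ∈ pts, (U.filter fun t => φ t = s).card = q := by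
    rintro ⟨x, b⟩ hs
    simp only [pts, Finset.mem_filter, Finset.mem_product, mem_Kn hnpos] at hs
    obtain ⟨⟨hx, hb⟩, hG⟩ := hs
    obtain ⟨W, hW1, hW2⟩ := card_as (K := K) x one_pos
    rw [pow_one] at hW1 hW2
    rw [hq, ← hW1, ← Finset.card_image_of_injective W (f := fun z => (z, b)) (fun z z' h => congrArg Prod.fst h)]
    congr 1
    ext ⟨z, b'⟩
    simp only [Finset.mem_filter, Finset.mem_image, φ, Prod.mk.injEq, U, Finset.mem_biUnion, Finset.mem_univ, true_and]
    constructor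
    · rintro ⟨-, h1, h2⟩
      exact ⟨z, (hW2 z).2 (by rw [← h1]; ring), rfl, h2.symm⟩
    · rintro ⟨z', hz', rfl, rfl⟩
      have h1 := (hW2 z').1 hz'
      have h2 : z' ^ q - z' = x := by rw [h1]; ring
      refine ⟨?_, h2, rfl⟩
      obtain ⟨c, hc⟩ := mem_K_of (K := K) (z' ^ (q ^ n) - z') (by
        have e1 := frob_sub (K := K) (z' ^ (q ^ n)) z' 1
        rw [pow_one] at e1
        change _ ^ q = _ ^ q - z' ^ q at e1
        rw [e1, ← hpowq]
        have e2 := frob_sub (K := K) (z' ^ q) z' n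
        change _ ^ (q ^ n) = _ ^ (q ^ n) - z' ^ (q ^ n) at e2
        rw [h2, hx] at e2
        linear_combination -e2 - h2)
      refine ⟨c, (hA c z' b).2 ⟨?_, ?_, hb⟩⟩
      · rw [hevF, h2]; exact hG
      · rw [hc]; ring
  have hdisj : ∀ c ∈ (Finset.univ : Finset K), ∀ c' ∈ (Finset.univ : Finset K), c ≠ c' → Disjoint (A c) (A c') := by
    intro c _ c' _ hne
    rw [Finset.disjoint_left]
    rintro ⟨a, b⟩ h1 h2
    have h3 := ((hA c a b).1 h1).2.1
    rw [((hA c' a b).1 h2).2.1] at h3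
    exact hne ((algebraMap K kb).injective (add_left_cancel h3)).symm
  have key : (q : ℂ) * sumN χ n G = ∑ c : K, χ c * ((A c).card : ℂ) := by
    have e1 : ∑ s ∈ U, chx χ (trN K n (φ s).1) = (q : ℂ) * sumN χ n G := by
      rw [← Finset.sum_fiberwise_of_maps_to hmaps, hsum, Finset.mul_sum]
      refine Finset.sum_congr rfl fun s hs => ?_
      rw [Finset.sum_congr rfl (g := fun _ => chx χ (trN K n s.1)) (by
        intro u hu; rw [(Finset.mem_filter.1 hu).2]), Finset.sum_const, hfib s hs, nsmul_eq_mul]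
    rw [← e1, Finset.sum_biUnion hdisj]
    refine Finset.sum_congr rfl fun c _ => ?_
    rw [Finset.sum_congr rfl (g := fun _ => χ c), Finset.sum_const, nsmul_eq_mul, mul_comm]
    rintro ⟨a, b⟩ hs
    have := ((hA c a b).1 hs).2.1
    simp only [φ]
    rw [trN_as, this, add_sub_cancel_left, chx_alg]
  have hχ0 : ∑ c : K, χ c = 0 := by
    rw [AddChar.sum_eq_zero_iff_ne_zero]; exact hχ
  have key2 : (q : ℂ) * sumN χ n G = ∑ c : K, χ c * (((A c).card : ℝ) - (q : ℝ) ^ n : ℝ) := by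
    rw [key]
    push_cast
    simp_rw [mul_sub]
    rw [Finset.sum_sub_distrib, ← Finset.sum_mul, hχ0]; simp
  have h1 : (q : ℝ) * ‖sumN χ n G‖ ≤ q * (C1 * (p : ℝ) ^ M) := by
    have : ‖(q : ℂ) * sumN χ n G‖ = (q : ℝ) * ‖sumN χ n G‖ := by simp
    rw [← this, key2]
    refine (norm_sum_le _ _).trans ?_
    calc _ ≤ ∑ c : K, (C1 * (p : ℝ) ^ M) := by
          refine Finset.sum_le_sum fun c _ => ?_
          rw [norm_mul, AddChar.norm_apply, one_mul, Complex.norm_real]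
          exact hAc c
      _ = _ := by rw [Finset.sum_const, Finset.card_univ, nsmul_eq_mul]
  have h2 : Real.sqrt ((q : ℝ) ^ n) = (p : ℝ) ^ M := by
    have : (q : ℝ) ^ n = (p : ℝ) ^ M * (p : ℝ) ^ M := by exact_mod_cast hQ.symm
    rw [this, Real.sqrt_mul_self (by positivity)]
  rw [h2]
  exact le_of_mul_le_mul_left h1 (by exact_mod_cast (by omega : 0 < q))
end

open Polynomial

section
variable {K kb : Type*} [Field K] [Fintype K] [Field kb] [IsAlgClosed kb] [Algebra K kb]

lemma chx_norm (χ : AddChar K ℂ) (t : kb) : ‖chx χ t‖ ≤ 1 := by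
  by_cases h : ∃ c, algebraMap K kb c = t
  · obtain ⟨c, rfl⟩ := h
    rw [chx_alg, AddChar.norm_apply]
  · rw [chx, Function.extend_apply' _ _ _ h]; simp

variable (K) in
/-- good points -/
noncomputable def ptsD (n : ℕ) (D : kb[X]) (G : kb[X][X]) : Finset (kb × kb) := by
  classical exact (Kn K kb n ×ˢ Kn K kb n).filter (fun s => ev2 G s.1 s.2 = 0 ∧ D.eval s.1 ≠ 0)

/-- character sum over good points -/
noncomputable def sumD (χ : AddChar K ℂ) (n : ℕ) (D : kb[X]) (G : kb[X][X]) : ℂ :=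
  ∑ s ∈ ptsD K n D G, chx χ (trN K n s.1)

/-- simple roots away from D -/
def Good (D : kb[X]) (G : kb[X][X]) : Prop :=
  ∀ x b, D.eval x ≠ 0 → ev2 G x b = 0 → ev2 (derivative G) x b ≠ 0

lemma good_mul {D : kb[X]} {G1 G2 : kb[X][X]} (h : Good D (G1 * G2)) : Good D G1 ∧ Good D G2 ∧
    ∀ x b, D.eval x ≠ 0 → ev2 G1 x b = 0 → ev2 G2 x b = 0 → False := by
  have e : ∀ x b, ev2 (derivative (G1 * G2)) x b = ev2 (derivative G1) x b * ev2 G2 x b + ev2 G1 x b * ev2 (derivative G2) x b := by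
    intro x b; simp [ev2]
  refine ⟨fun x b hD h1 h2 => ?_, fun x b hD h1 h2 => ?_, fun x b hD h1 h2 => ?_⟩ <;>
  · apply h x b hD (by rw [ev2_mul]; simp [h1])
    rw [e]; simp [h1, h2]

lemma sumD_close (χ : AddChar K ℂ) (n : ℕ) (D : kb[X]) (hD : D ≠ 0) (G : kb[X][X]) (hm : G.Monic) :
    ‖sumN χ n G - sumD χ n D G‖ ≤ D.natDegree * G.natDegree := by
  classical
  let P := (Kn K kb n ×ˢ Kn K kb n).filter (fun s => ev2 G s.1 s.2 = 0)
  have h1 : sumD χ n D G = ∑ s ∈ P.filter (fun s => D.eval s.1 ≠ 0), chx χ (trN K n s.1) := by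
    rw [sumD, Finset.filter_filter]; congr 1
  have h2 : sumN χ n G = ∑ s ∈ P, chx χ (trN K n s.1) := rfl
  rw [h1, h2, ← Finset.sum_filter_add_sum_filter_not P (fun s => D.eval s.1 ≠ 0), add_sub_cancel_left]
  refine (norm_sum_le _ _).trans ((Finset.sum_le_sum (fun s _ => chx_norm χ _)).trans ?_)
  rw [Finset.sum_const, nsmul_eq_mul, mul_one]
  have : (P.filter (fun s => ¬ D.eval s.1 ≠ 0)).card ≤ D.natDegree * G.natDegree := by
    have hsub : P.filter (fun s => ¬ D.eval s.1 ≠ 0) ⊆ D.roots.toFinset.biUnion fun a => (G.map (evalRingHom a)).roots.toFinset.image fun b => (a, b) := by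
      rintro ⟨a, b⟩ hs
      simp only [P, Finset.mem_filter, not_not] at hs
      refine Finset.mem_biUnion.2 ⟨a, ?_, Finset.mem_image.2 ⟨b, ?_, rfl⟩⟩
      · rw [Multiset.mem_toFinset, mem_roots hD]; exact hs.2
      · rw [Multiset.mem_toFinset, mem_roots (hm.map _).ne_zero]; exact hs.1.2
    refine (Finset.card_le_card hsub).trans (Finset.card_biUnion_le.trans ?_)
    calc _ ≤ ∑ a ∈ D.roots.toFinset, G.natDegree := by
          refine Finset.sum_le_sum fun a _ => Finset.card_image_le.trans ?_
          refine (Multiset.toFinset_card_le _).trans ((card_roots' _).trans ?_)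
          rw [hm.natDegree_map]
      _ ≤ _ := by
          rw [Finset.sum_const, smul_eq_mul]
          gcongr
          exact (Multiset.toFinset_card_le _).trans (card_roots' _)
  exact_mod_cast this

lemma sum_all [Algebra.IsAlgebraic K kb] (p : ℕ) [Fact p.Prime] [CharP kb p] (χ : AddChar K ℂ) (hχ : χ ≠ 0)
    (D : kb[X]) (hD : D ≠ 0) : ∀ (d : ℕ) (G : kb[X][X]), G.natDegree = d → G.Monic → G.natDegree < p → Good D G →
    ∃ n0 > 0, ∃ C : ℝ, ∀ m > 0, ‖sumD χ (n0 * m) D G‖ ≤ C * Real.sqrt ((Fintype.card K : ℝ) ^ (n0 * m)) := by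
  classical
  intro d
  induction d using Nat.strong_induction_on with
  | _ d ih =>
  intro G hGd hm hd hgood
  by_cases h1 : G = 1
  · refine ⟨1, one_pos, 0, fun m hm => ?_⟩
    have : ptsD K (1 * m) D G = ∅ := by
      rw [ptsD, Finset.filter_eq_empty_iff]
      rintro s - ⟨h, -⟩
      rw [h1] at h; simp [ev2] at h
    rw [sumD, this]; simp
  by_cases hi : Irreducible G
  · obtain ⟨n0, hn0, C, h⟩ := sum_irred p χ hχ G hm hi hd
    refine ⟨n0, hn0, C + D.natDegree * G.natDegree, fun m hmp => ?_⟩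
    have e1 := h m hmp
    have e2 := sumD_close χ (n0 * m) D hD G hm
    have e3 : (1 : ℝ) ≤ Real.sqrt ((Fintype.card K : ℝ) ^ (n0 * m)) := by
      rw [Real.one_le_sqrt]
      exact one_le_pow₀ (by exact_mod_cast Fintype.card_pos)
    have e4 : ‖sumD χ (n0 * m) D G‖ ≤ ‖sumN χ (n0 * m) G‖ + ‖sumN χ (n0 * m) G - sumD χ (n0 * m) D G‖ := by
      have := norm_sub_le (sumN χ (n0 * m) G) (sumN χ (n0 * m) G - sumD χ (n0 * m) D G)
      rwa [sub_sub_cancel] at this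
    have e5 : (D.natDegree * G.natDegree : ℝ) ≤ (D.natDegree * G.natDegree : ℝ) * Real.sqrt ((Fintype.card K : ℝ) ^ (n0 * m)) :=
      le_mul_of_one_le_right (by positivity) e3
    rw [add_mul]
    linarith
  · rw [hm.irreducible_iff_natDegree] at hi
    push Not at hi
    obtain ⟨G1, G2, hm1, hm2, rfl, h1, h2⟩ := hi h1
    rw [hm1.natDegree_mul hm2] at hGd hd
    obtain ⟨g1, g2, g3⟩ := good_mul hgood
    obtain ⟨a, ha, C1, hC1⟩ := ih G1.natDegree (by omega) G1 rfl hm1 (by omega) g1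
    obtain ⟨b, hb, C2, hC2⟩ := ih G2.natDegree (by omega) G2 rfl hm2 (by omega) g2
    refine ⟨a * b, Nat.mul_pos ha hb, C1 + C2, fun m hmp => ?_⟩
    have e1 := hC1 (b * m) (Nat.mul_pos hb hmp)
    have e2 := hC2 (a * m) (Nat.mul_pos ha hmp)
    rw [← mul_assoc] at e1
    rw [← mul_assoc, mul_comm b a] at e2
    have e3 : sumD χ (a * b * m) D (G1 * G2) = sumD χ (a * b * m) D G1 + sumD χ (a * b * m) D G2 := by
      rw [sumD, sumD, sumD, ← Finset.sum_union]
      · congr 1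
        ext s
        simp only [ptsD, Finset.mem_filter, Finset.mem_union, ev2_mul, mul_eq_zero]
        tauto
      · rw [Finset.disjoint_left]
        intro s h1 h2
        simp only [ptsD, Finset.mem_filter] at h1 h2
        exact g3 s.1 s.2 h1.2.2 h1.2.1 h2.2.1
    rw [e3, add_mul]
    exact (norm_add_le _ _).trans (add_le_add e1 e2)
end

open Polynomial

section
lemma pow_sums_bdd (α : Multiset ℂ) (C0 : ℝ) (h : ∀ m > 0, ‖(α.map (· ^ m)).sum‖ ≤ C0) :
    ∀ β ∈ α, ‖β‖ ≤ 1 := by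
  classical
  intro β hβ
  by_contra! hb
  let H : ℂ[X] := ∏ γ ∈ α.toFinset.erase β, (X - C γ)
  have hH0 : H.eval β ≠ 0 := by
    rw [eval_prod, Finset.prod_ne_zero_iff]
    intro γ hγ
    simp only [eval_sub, eval_X, eval_C, sub_ne_zero]
    exact (Finset.ne_of_mem_erase hγ).symm
  have hHz : ∀ γ ∈ α, γ ≠ β → H.eval γ = 0 := by
    intro γ hγ hne
    rw [eval_prod]
    exact Finset.prod_eq_zero (Finset.mem_erase.2 ⟨hne, Multiset.mem_toFinset.2 hγ⟩) (by simp)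
  have key : ∀ m > 0, (α.count β : ℂ) * (β ^ m * H.eval β) = ∑ k ∈ Finset.range (H.natDegree + 1), H.coeff k * (α.map (· ^ (m + k))).sum := by
    intro m hm
    have e1 : (α.map (fun γ => γ ^ m * H.eval γ)).sum = (α.count β : ℂ) * (β ^ m * H.eval β) := by
      rw [Finset.sum_multiset_map_count, Finset.sum_eq_single β]
      · rw [nsmul_eq_mul]
      · intro γ hγ hne
        rw [hHz γ (Multiset.mem_toFinset.1 hγ) hne]; simp
      · intro h; exact absurd (Multiset.mem_toFinset.2 hβ) h
    rw [← e1]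
    simp_rw [← Multiset.sum_map_mul_left]
    rw [← Multiset.sum_map_sum]
    congr 1
    refine Multiset.map_congr rfl fun γ _ => ?_
    rw [eval_eq_sum_range, Finset.mul_sum]
    refine Finset.sum_congr rfl fun k _ => ?_
    rw [pow_add]; ring
  set B := ∑ k ∈ Finset.range (H.natDegree + 1), ‖H.coeff k‖ * C0 with hB
  set c := (α.count β : ℝ) * ‖H.eval β‖ with hc
  have hcpos : 0 < c := by
    have : 0 < α.count β := Multiset.count_pos.2 hβ
    have := norm_pos_iff.2 hH0
    positivity
  have bd : ∀ m > 0, c * ‖β‖ ^ m ≤ B := by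
    intro m hm
    have e1 : ‖(α.count β : ℂ) * (β ^ m * H.eval β)‖ = c * ‖β‖ ^ m := by
      rw [norm_mul, norm_mul, norm_pow, hc]; simp; ring
    rw [← e1, key m hm]
    refine (norm_sum_le _ _).trans (Finset.sum_le_sum fun k _ => ?_)
    rw [norm_mul]
    exact mul_le_mul_of_nonneg_left (h _ (by omega)) (norm_nonneg _)
  obtain ⟨m, hm⟩ := pow_unbounded_of_one_lt (B / c) hb
  have h1 := bd (m + 1) (by omega)
  have h2 : ‖β‖ ^ m ≤ ‖β‖ ^ (m + 1) := pow_le_pow_right₀ hb.le (by omega)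
  rw [div_lt_iff₀ hcpos] at hm
  nlinarith

lemma exists_factor (A : ℂ[X]) (h0 : A.coeff 0 = 1) :
    ∃ ω : Multiset ℂ, ω.card = A.natDegree ∧ A = (ω.map fun w => 1 - C w * X).prod := by
  have hA : A ≠ 0 := by rintro rfl; simp at h0
  refine ⟨A.roots.map (·⁻¹), ?_, ?_⟩
  · rw [Multiset.card_map, (IsAlgClosed.splits A).natDegree_eq_card_roots]
  have h1 := (IsAlgClosed.splits A).eq_prod_roots
  have hne : ∀ ρ ∈ A.roots, ρ ≠ 0 := by
    rintro ρ hρ rfl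
    rw [mem_roots hA, IsRoot.def, ← coeff_zero_eq_eval_zero, h0] at hρ
    exact one_ne_zero hρ
  have h2 : (A.roots.map fun a => X - C a).prod = C ((A.roots.map fun a => -a).prod) * ((A.roots.map (·⁻¹)).map fun w => 1 - C w * X).prod := by
    rw [Multiset.map_map, map_multiset_prod, Multiset.map_map, ← Multiset.prod_map_mul]
    congr 1
    refine Multiset.map_congr rfl fun ρ hρ => ?_
    have := hne ρ hρ
    simp only [Function.comp_apply, map_neg]
    have e : (C ρ : ℂ[X]) * C ρ⁻¹ = 1 := by rw [← C_mul, mul_inv_cancel₀ this, C_1]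
    linear_combination (-X) * e
  have h3 : A = C (A.leadingCoeff * (A.roots.map fun a => -a).prod) * ((A.roots.map (·⁻¹)).map fun w => 1 - C w * X).prod := by
    conv_lhs => rw [h1, h2]
    rw [C_mul]; ring
  have h4 : A.leadingCoeff * (A.roots.map fun a => -a).prod = 1 := by
    have := congrArg (eval 0) h3
    rw [← coeff_zero_eq_eval_zero, h0, eval_mul, eval_C, eval_multiset_prod, Multiset.map_map] at this
    rw [this]
    symm
    convert mul_one _
    apply Multiset.prod_eq_one
    intro x hx
    obtain ⟨y, -, rfl⟩ := Multiset.mem_map.1 hx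
    simp
  conv_lhs => rw [h3, h4, C_1, one_mul]

/-- Newton-type identity -/
lemma newton_ps (ω : Multiset ℂ) :
    (PowerSeries.X : PowerSeries ℂ) * PowerSeries.derivative ℂ ((ω.map fun w => (1 - C w * X : ℂ[X])).prod : ℂ[X]) =
      - (((ω.map fun w => (1 - C w * X : ℂ[X])).prod : ℂ[X]) : PowerSeries ℂ) *
        PowerSeries.mk fun r => if r = 0 then 0 else (ω.map (· ^ r)).sum := by
  induction ω using Multiset.induction_on with
  | empty =>
    have : (PowerSeries.mk fun r => if r = 0 then (0 : ℂ) else ((0 : Multiset ℂ).map (· ^ r)).sum) = 0 := by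
      ext n; simp
    rw [this]
    simp
  | cons w ω ih =>
    set A := (ω.map fun w => (1 - C w * X : ℂ[X])).prod
    rw [Multiset.map_cons, Multiset.prod_cons]
    have e1 : (PowerSeries.mk fun r => if r = 0 then (0 : ℂ) else ((w ::ₘ ω).map (· ^ r)).sum) =
        (PowerSeries.mk fun r => if r = 0 then (0 : ℂ) else (ω.map (· ^ r)).sum) + (PowerSeries.mk fun r => if r = 0 then (0 : ℂ) else w ^ r) := by
      ext n
      simp only [PowerSeries.coeff_mk, map_add, Multiset.map_cons, Multiset.sum_cons]
      split_ifs <;> ring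
    have e2 : ((1 : PowerSeries ℂ) - PowerSeries.C w * PowerSeries.X) * (PowerSeries.mk fun r => if r = 0 then (0 : ℂ) else w ^ r) = PowerSeries.C w * PowerSeries.X := by
      rw [sub_mul, one_mul, mul_assoc]
      ext n
      rcases n with - | - | n
      · simp
      · simp [PowerSeries.coeff_succ_X_mul, PowerSeries.coeff_X]
      · simp [PowerSeries.coeff_succ_X_mul, PowerSeries.coeff_X]; ring
    have e3 : (((1 - C w * X : ℂ[X]) : ℂ[X]) : PowerSeries ℂ) = 1 - PowerSeries.C w * PowerSeries.X := by simp
    have e4 : PowerSeries.derivative ℂ (1 - PowerSeries.C w * PowerSeries.X : PowerSeries ℂ) = - PowerSeries.C w := by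
      ext n
      simp [PowerSeries.coeff_derivative, PowerSeries.coeff_X, PowerSeries.coeff_one, PowerSeries.coeff_C]
    rw [e1, Polynomial.coe_mul, e3, Derivation.leibniz, e4, smul_eq_mul, smul_eq_mul]
    linear_combination (1 - PowerSeries.C w * PowerSeries.X) * ih + (A : PowerSeries ℂ) * e2

/-- the L-function argument -/
theorem lfun_bound (D : ℕ) (a s : ℕ → ℂ) (ha0 : a 0 = 1) (haD : ∀ n > D, a n = 0)
    (hrec : ∀ n : ℕ, (n : ℂ) * a n = ∑ x ∈ Finset.HasAntidiagonal.antidiagonal n, a x.1 * (if x.2 = 0 then 0 else s x.2))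
    (q : ℝ) (hq : 1 ≤ q) (n0 : ℕ) (hn0 : 0 < n0) (C0 : ℝ)
    (hs : ∀ m > 0, ‖s (n0 * m)‖ ≤ C0 * Real.sqrt (q ^ (n0 * m))) : ‖s 1‖ ≤ D * Real.sqrt q := by
  let A : ℂ[X] := ∑ n ∈ Finset.range (D + 1), C (a n) * X ^ n
  have hAc : ∀ n, A.coeff n = a n := by
    intro n
    simp only [A, finset_sum_coeff, coeff_C_mul_X_pow]
    rw [Finset.sum_ite_eq]
    split_ifs with h
    · rfl
    · rw [haD n (by simpa using h)]
  have hAd : A.natDegree ≤ D := by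
    rw [natDegree_le_iff_coeff_eq_zero]
    intro n hn; rw [hAc, haD n hn]
  obtain ⟨ω, hω, hA⟩ := exists_factor A (by rw [hAc, ha0])
  have hN := newton_ps ω
  rw [← hA] at hN
  have hA0 : (A : PowerSeries ℂ) ≠ 0 := by
    intro h
    have := congrArg (PowerSeries.coeff 0) h
    rw [Polynomial.coeff_coe, hAc, ha0] at this; simp at this
  have hN2 : (PowerSeries.X : PowerSeries ℂ) * PowerSeries.derivative ℂ (A : PowerSeries ℂ) = A * PowerSeries.mk fun r => if r = 0 then 0 else s r := by
    ext n
    rw [PowerSeries.coeff_mul n (A : PowerSeries ℂ)]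
    simp only [Polynomial.coeff_coe, PowerSeries.coeff_mk, hAc]
    rw [← hrec]
    rcases n with - | n
    · simp
    · rw [PowerSeries.coeff_succ_X_mul, PowerSeries.coeff_derivative, Polynomial.coeff_coe, hAc]
      push_cast; ring
  have hsp : ∀ r > 0, s r = - (ω.map (· ^ r)).sum := by
    intro r hr
    rw [hN, neg_mul, ← mul_neg] at hN2
    have h1 := mul_left_cancel₀ hA0 hN2
    have h2 := congrArg (fun u => PowerSeries.coeff r u) h1
    rw [map_neg, PowerSeries.coeff_mk, PowerSeries.coeff_mk, if_neg hr.ne', if_neg hr.ne'] at h2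
    exact h2.symm
  have hw : ∀ w ∈ ω, ‖w‖ ≤ Real.sqrt q := by
    intro w hw
    let c : ℝ := Real.sqrt q ^ n0
    have hc : 0 < c := by positivity
    have := pow_sums_bdd (ω.map fun w => w ^ n0 / (c : ℂ)) C0 (by
      intro m hm
      have e1 : ((ω.map fun w => w ^ n0 / (c : ℂ)).map (· ^ m)).sum = (ω.map (· ^ (n0 * m))).sum * ((c : ℂ) ^ m)⁻¹ := by
        rw [Multiset.map_map, ← Multiset.sum_map_mul_right]
        congr 1
        refine Multiset.map_congr rfl fun w _ => ?_
        simp only [Function.comp_apply]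
        rw [div_pow, pow_mul, div_eq_mul_inv]
      have e2 := hs m hm
      rw [hsp _ (Nat.mul_pos hn0 hm), norm_neg] at e2
      have e3 : Real.sqrt (q ^ (n0 * m)) = c ^ m := by
        rw [← pow_mul, Real.sqrt_eq_rpow, Real.sqrt_eq_rpow, ← Real.rpow_natCast_mul (by positivity), ← Real.rpow_mul_natCast (by positivity), mul_comm]
      rw [e3] at e2
      rw [e1, norm_mul, norm_inv, norm_pow, Complex.norm_real, Real.norm_of_nonneg hc.le, ← div_eq_mul_inv, div_le_iff₀ (by positivity)]
      exact e2) (w ^ n0 / c) (Multiset.mem_map_of_mem _ hw)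
    rw [norm_div, norm_pow, Complex.norm_real, Real.norm_of_nonneg hc.le, div_le_one hc] at this
    exact (pow_le_pow_iff_left₀ (norm_nonneg _) (Real.sqrt_nonneg _) hn0.ne').1 this
  rw [hsp 1 one_pos, norm_neg]
  have hid : (ω.map fun w => w ^ 1) = ω := by simp
  rw [hid]
  have h1 : ‖ω.sum‖ ≤ (ω.map (fun w => ‖w‖)).sum := norm_multiset_sum_le _
  have h2 : (ω.map (fun w => ‖w‖)).sum ≤ ω.card • Real.sqrt q := by
    have := Multiset.sum_le_card_nsmul (ω.map (fun w => ‖w‖)) (Real.sqrt q) (by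
      intro x hx
      obtain ⟨w, hw', rfl⟩ := Multiset.mem_map.1 hx
      exact hw w hw')
    rwa [Multiset.card_map] at this
  rw [nsmul_eq_mul] at h2
  have h3 : (ω.card : ℝ) ≤ D := by rw [hω]; exact_mod_cast hAd
  nlinarith [Real.sqrt_nonneg q]
end

open Polynomial

section
variable {K : Type*} [Field K]

/-- the uniformiser power -/
noncomputable abbrev Tp (K : Type*) [Field K] (N : ℤ) : LaurentSeries K := HahnSeries.single N 1

noncomputable abbrev psl (s : PowerSeries K) : LaurentSeries K := HahnSeries.ofPowerSeries ℤ K s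

lemma Tp_mul (a b : ℤ) : Tp K a * Tp K b = Tp K (a + b) := by
  simp [Tp, HahnSeries.single_mul_single]

lemma Tp_zero : Tp K 0 = 1 := rfl

lemma psl_X_pow (n : ℕ) : psl (PowerSeries.X ^ n : PowerSeries K) = Tp K n := by
  rw [psl, HahnSeries.ofPowerSeries_X_pow]

lemma psl_inj {s t : PowerSeries K} (h : psl s = psl t) : s = t :=
  HahnSeries.ofPowerSeries_injective h

lemma psl_coeff (s : PowerSeries K) (n : ℕ) : (psl s).coeff n = PowerSeries.coeff n s :=
  HahnSeries.ofPowerSeries_apply_coeff s n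

lemma coeff_Tp_mul (m : ℤ) (z : LaurentSeries K) : (Tp K m * z).coeff m = z.coeff 0 := by
  have := HahnSeries.coeff_single_mul_add (r := (1:K)) (x := z) (a := 0) (b := m)
  rw [zero_add, one_mul] at this
  exact this

/-- order at least N -/
def LO (N : ℤ) (z : LaurentSeries K) : Prop := ∃ s : PowerSeries K, z = Tp K N * psl s

lemma LO.add {N : ℤ} {z w : LaurentSeries K} (h1 : LO N z) (h2 : LO N w) : LO N (z + w) := by
  obtain ⟨s, rfl⟩ := h1
  obtain ⟨t, rfl⟩ := h2
  exact ⟨s + t, by simp [psl, mul_add]⟩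

lemma LO.zero {N : ℤ} : LO N (0 : LaurentSeries K) := ⟨0, by simp [psl]⟩

lemma LO.mul {N M : ℤ} {z w : LaurentSeries K} (h1 : LO N z) (h2 : LO M w) : LO (N + M) (z * w) := by
  obtain ⟨s, rfl⟩ := h1
  obtain ⟨t, rfl⟩ := h2
  refine ⟨s * t, ?_⟩
  rw [← Tp_mul, psl, psl, psl, map_mul]; ring

lemma LO.mono {N M : ℤ} {z : LaurentSeries K} (h1 : LO N z) (h : M ≤ N) : LO M z := by
  obtain ⟨s, rfl⟩ := h1
  obtain ⟨n, hn⟩ := Int.le.dest h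
  refine ⟨PowerSeries.X ^ n * s, ?_⟩
  rw [psl, psl, map_mul, ← hn, ← Tp_mul, ← psl_X_pow, mul_assoc]

lemma LO.coeff {N : ℤ} {z : LaurentSeries K} (h1 : LO N z) {m : ℤ} (h : m < N) : z.coeff m = 0 := by
  obtain ⟨n, hn⟩ := Int.le.dest (show m + 1 ≤ N by omega)
  obtain ⟨s, rfl⟩ := h1
  have : Tp K N * psl s = Tp K m * psl (PowerSeries.X ^ (n + 1) * s) := by
    rw [psl, psl, map_mul]
    have e : HahnSeries.ofPowerSeries ℤ K (PowerSeries.X ^ (n + 1)) = Tp K (n + 1 : ℕ) := psl_X_pow (n + 1)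
    rw [e, ← mul_assoc, Tp_mul]
    congr 2; push_cast; omega
  rw [this, coeff_Tp_mul]
  have := psl_coeff (PowerSeries.X ^ (n + 1) * s) 0
  rw [Nat.cast_zero] at this
  rw [this, PowerSeries.coeff_X_pow_mul', if_neg (by omega)]

/-- polynomials to Laurent series in 1/x -/
noncomputable def iotP (K : Type*) [Field K] : K[X] →+* LaurentSeries K := eval₂RingHom HahnSeries.C (Tp K (-1))

lemma Tp_pow (a : ℤ) (n : ℕ) : Tp K a ^ n = Tp K (n * a) := by
  induction n with
  | zero => simp
  | succ n ih => rw [pow_succ, ih, Tp_mul]; congr 1; push_cast; ring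

lemma iotP_eq (f : K[X]) (n : ℕ) (h : f.natDegree ≤ n) : iotP K f = Tp K (-n) * psl (reflect n f : K[X]) := by
  rw [iotP, coe_eval₂RingHom, eval₂_eq_sum_range' _ (n := n + 1) (by omega), psl,
    (reflect n f).as_sum_range' (n + 1) (by
      have : (reflect n f).natDegree ≤ n := by
        refine (natDegree_reflect_le).trans ?_
        simp [h]
      omega), ← Polynomial.coeToPowerSeries.ringHom_apply, map_sum, map_sum, Finset.mul_sum,
      ← Finset.sum_range_reflect]
  refine Finset.sum_congr rfl fun i hi => ?_
  rw [Finset.mem_range] at hi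
  rw [Polynomial.coeToPowerSeries.ringHom_apply, ← C_mul_X_pow_eq_monomial, Polynomial.coe_mul, Polynomial.coe_C, Polynomial.coe_pow, Polynomial.coe_X, map_mul]
  have e : HahnSeries.ofPowerSeries ℤ K (PowerSeries.X ^ i) = Tp K i := psl_X_pow i
  rw [e, HahnSeries.ofPowerSeries_C, coeff_reflect, revAt_le (by omega), Tp_pow]
  have e2 : n + 1 - 1 - i = n - i := by omega
  rw [e2, mul_left_comm, Tp_mul]
  congr 2
  push_cast [Nat.cast_sub (show i ≤ n by omega)]; ring

lemma iotP_LO (f : K[X]) (n : ℕ) (h : f.natDegree ≤ n) : LO (-n) (iotP K f) := ⟨_, iotP_eq f n h⟩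

lemma iotP_monic (f : K[X]) (hf : f.Monic) : ∃ s : PowerSeries K, PowerSeries.constantCoeff s = 1 ∧ PowerSeries.coeff 1 s = f.nextCoeff ∧
    iotP K f = Tp K (-f.natDegree) * psl s := by
  refine ⟨(reflect f.natDegree f : K[X]), ?_, ?_, iotP_eq f _ le_rfl⟩
  · rw [← PowerSeries.coeff_zero_eq_constantCoeff_apply, Polynomial.coeff_coe, coeff_reflect, revAt_le (Nat.zero_le _), Nat.sub_zero]
    exact hf
  · rw [Polynomial.coeff_coe, coeff_reflect, nextCoeff]
    split_ifs with h
    · rw [h, revAt_eq_self_of_lt (by omega)]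
      exact coeff_eq_zero_of_natDegree_lt (by omega)
    · rw [revAt_le (by omega)]

lemma iotP_inj : Function.Injective (iotP K) := by
  rw [injective_iff_map_eq_zero]
  intro f hf
  by_contra h
  rw [iotP_eq f _ le_rfl] at hf
  rcases mul_eq_zero.1 hf with h1 | h1
  · exact HahnSeries.single_ne_zero one_ne_zero h1
  · have h2 : (psl ((reflect f.natDegree f : K[X]) : PowerSeries K)) = psl 0 := by rw [h1]; simp [psl]
    have h3 := psl_inj h2
    rw [Polynomial.coe_eq_zero_iff, reflect_eq_zero_iff] at h3
    exact h h3

/-- unit lemma: two normalized expressions -/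
lemma normal_unique {m n : ℤ} {s t : PowerSeries K} (hs : PowerSeries.constantCoeff s ≠ 0) (ht : PowerSeries.constantCoeff t ≠ 0)
    (h : Tp K m * psl s = Tp K n * psl t) : m = n ∧ s = t := by
  have key : ∀ (m n : ℤ) (s t : PowerSeries K), PowerSeries.constantCoeff s ≠ 0 → Tp K m * psl s = Tp K n * psl t → n ≤ m := by
    intro m n s t hs h
    by_contra! hlt
    have h1 : (Tp K n * psl t).coeff m = 0 := LO.coeff ⟨t, rfl⟩ hlt
    rw [← h, coeff_Tp_mul] at h1
    have := psl_coeff s 0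
    rw [Nat.cast_zero] at this
    rw [this, PowerSeries.coeff_zero_eq_constantCoeff_apply] at h1
    exact hs h1
  have e : m = n := le_antisymm (key n m t s ht h.symm) (key m n s t hs h)
  subst e
  exact ⟨rfl, psl_inj (mul_left_cancel₀ (HahnSeries.single_ne_zero one_ne_zero) h)⟩

lemma natDegree_le_of_LO (f : K[X]) (n : ℕ) (h : LO (-n) (iotP K f)) : f.natDegree ≤ n := by
  by_contra! hlt
  have h0 : f ≠ 0 := by rintro rfl; simp at hlt
  have h1 := h.coeff (m := -f.natDegree) (by omega)
  rw [iotP_eq f _ le_rfl, coeff_Tp_mul] at h1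
  have := psl_coeff ((reflect f.natDegree f : K[X]) : PowerSeries K) 0
  rw [Nat.cast_zero] at this
  rw [this, Polynomial.coeff_coe, coeff_reflect, revAt_le (Nat.zero_le _), Nat.sub_zero] at h1
  exact h0 (leadingCoeff_eq_zero.1 h1)

variable {F0 : Type*} [Field F0] [Algebra K[X] F0] [IsFractionRing K[X] F0]

variable (K F0) in
/-- embedding of the rational function field -/
noncomputable def iot : F0 →+* LaurentSeries K := IsFractionRing.lift (A := K[X]) (K := F0) (g := iotP K) iotP_inj

lemma iot_alg (f : K[X]) : iot K F0 (algebraMap K[X] F0 f) = iotP K f := IsFractionRing.lift_algebraMap ..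

/-- polynomial part -/
lemma exists_polypart (e : F0) : ∃ f : K[X], LO 1 (iot K F0 (e - algebraMap K[X] F0 f)) := by
  obtain ⟨a, b, hb, rfl⟩ := IsFractionRing.div_surjective (A := K[X]) e
  have hb0 : b ≠ 0 := nonZeroDivisors.ne_zero hb
  have hb' : algebraMap K[X] F0 b ≠ 0 := by simpa using hb0
  refine ⟨a / b, ?_⟩
  have e1 : algebraMap K[X] F0 a / algebraMap K[X] F0 b - algebraMap K[X] F0 (a / b) = algebraMap K[X] F0 (a % b) / algebraMap K[X] F0 b := by
    rw [eq_div_iff hb', sub_mul, div_mul_cancel₀ _ hb', ← map_mul, ← map_sub]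
    congr 1
    have := EuclideanDomain.div_add_mod a b
    linear_combination -this
  rw [e1, map_div₀, iot_alg, iot_alg]
  have hC : iotP K b = Tp K (-b.natDegree) * psl ((reflect b.natDegree b : K[X]) : PowerSeries K) := iotP_eq b _ le_rfl
  set s : PowerSeries K := ((reflect b.natDegree b : K[X]) : PowerSeries K) with hs
  have hs0 : PowerSeries.constantCoeff s ≠ 0 := by
    rw [hs, ← PowerSeries.coeff_zero_eq_constantCoeff_apply, Polynomial.coeff_coe, coeff_reflect, revAt_le (Nat.zero_le _), Nat.sub_zero]
    exact leadingCoeff_ne_zero.2 hb0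
  by_cases h0 : a % b = 0
  · rw [h0, map_zero, zero_div]; exact LO.zero
  have hlt : (a % b).degree < b.degree := EuclideanDomain.mod_lt a hb0
  have hlt' : (a % b).natDegree < b.natDegree := natDegree_lt_natDegree h0 hlt
  obtain ⟨t, ht⟩ := iotP_LO (a % b) (b.natDegree - 1) (by omega)
  refine ⟨t * s⁻¹, ?_⟩
  have hss : psl s * psl s⁻¹ = 1 := by
    rw [psl, psl, ← map_mul, PowerSeries.mul_inv_cancel s hs0, map_one]
  have hne : iotP K b ≠ 0 := by
    intro h; exact hb0 (iotP_inj (by rw [h, map_zero]))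
  rw [div_eq_iff hne, ht, hC, psl, psl, map_mul]
  have e3 : Tp K (-((b.natDegree - 1 : ℕ) : ℤ)) = Tp K 1 * Tp K (-b.natDegree) := by
    rw [Tp_mul]; congr 1; push_cast [Nat.cast_sub (show 1 ≤ b.natDegree by omega)]; ring
  rw [e3]
  linear_combination (-(Tp K 1 * Tp K (-b.natDegree)) * psl t) * hss
end

open Polynomial

section
variable {K : Type*} [Field K] {F0 : Type*} [Field F0] [Algebra K[X] F0] [IsFractionRing K[X] F0]
  {L : Type*} [Field L] [Algebra F0 L] {ι : Type*} [Fintype ι] [DecidableEq ι] (b : Module.Basis ι F0 L)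

lemma LO.sum {K : Type*} [Field K] {N : ℤ} {α : Type*} (s : Finset α) (f : α → LaurentSeries K) (h : ∀ i ∈ s, LO N (f i)) : LO N (∑ i ∈ s, f i) := by
  classical
  induction s using Finset.induction_on with
  | empty => simpa using LO.zero
  | insert a s ha ih =>
    rw [Finset.sum_insert ha]
    exact (h a (by simp)).add (ih fun i hi => h i (by simp [hi]))

lemma LO.neg {K : Type*} [Field K] {N : ℤ} {z : LaurentSeries K} (h : LO N z) : LO N (-z) := by
  obtain ⟨s, rfl⟩ := h
  exact ⟨-s, by simp [psl]⟩

lemma LO.one {K : Type*} [Field K] : LO 0 (1 : LaurentSeries K) := ⟨1, by simp [psl, Tp_zero]⟩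

lemma LO.prod {K : Type*} [Field K] {N : ℤ} {α : Type*} (s : Finset α) (f : α → LaurentSeries K) (h : ∀ i ∈ s, LO N (f i)) : LO (s.card * N) (∏ i ∈ s, f i) := by
  classical
  induction s using Finset.induction_on with
  | empty => simpa using LO.one
  | insert a s ha ih =>
    rw [Finset.prod_insert ha, Finset.card_insert_of_notMem ha]
    have := (h a (by simp)).mul (ih fun i hi => h i (by simp [hi]))
    convert this using 1
    push_cast; ring

variable (K) in
/-- multiplication matrix has entries of order at least N at infinity -/
def MF (N : ℤ) (w : L) : Prop := ∀ i j, LO N (iot K F0 (Algebra.leftMulMatrix b w i j))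

variable {b}
lemma MF.add {N : ℤ} {z w : L} (h1 : MF K b N z) (h2 : MF K b N w) : MF K b N (z + w) := by
  intro i j
  rw [map_add, Matrix.add_apply, map_add]
  exact (h1 i j).add (h2 i j)

lemma MF.zero {N : ℤ} : MF K b N (0 : L) := by
  intro i j
  rw [map_zero, Matrix.zero_apply, map_zero]
  exact LO.zero

lemma MF.neg {N : ℤ} {z : L} (h1 : MF K b N z) : MF K b N (-z) := by
  intro i j
  rw [map_neg, Matrix.neg_apply, map_neg]
  exact (h1 i j).neg

lemma MF.sub {N : ℤ} {z w : L} (h1 : MF K b N z) (h2 : MF K b N w) : MF K b N (z - w) := by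
  rw [sub_eq_add_neg]; exact h1.add h2.neg

lemma MF.mul {N M : ℤ} {z w : L} (h1 : MF K b N z) (h2 : MF K b M w) : MF K b (N + M) (z * w) := by
  intro i j
  rw [map_mul, Matrix.mul_apply, map_sum]
  refine LO.sum _ _ fun l _ => ?_
  rw [map_mul]
  exact (h1 i l).mul (h2 l j)

lemma MF.mono {N M : ℤ} {z : L} (h1 : MF K b N z) (h : M ≤ N) : MF K b M z := fun i j => (h1 i j).mono h

lemma MF.alg {N : ℤ} {e : F0} (h : LO N (iot K F0 e)) : MF K b N (algebraMap F0 L e) := by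
  intro i j
  rw [AlgHom.commutes, Matrix.algebraMap_matrix_apply]
  split_ifs
  · exact h
  · rw [map_zero]; exact LO.zero

lemma MF.one : MF K b 0 (1 : L) := by
  have := MF.alg (K := K) (b := b) (e := (1 : F0)) (N := 0) (by rw [map_one]; exact LO.one)
  rwa [map_one] at this

lemma MF.pow {N : ℤ} {z : L} (h1 : MF K b N z) (n : ℕ) : MF K b (n * N) (z ^ n) := by
  induction n with
  | zero => simpa using MF.one
  | succ n ih =>
    rw [pow_succ]
    convert ih.mul h1 using 1
    push_cast; ring

lemma MF.sum {N : ℤ} {α : Type*} (s : Finset α) (f : α → L) (h : ∀ i ∈ s, MF K b N (f i)) : MF K b N (∑ i ∈ s, f i) := by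
  intro i j
  rw [map_sum, Matrix.sum_apply, map_sum]
  exact LO.sum _ _ fun l hl => h l hl i j

lemma MF.norm {N : ℤ} {z : L} (h : MF K b N z) : LO (Fintype.card ι * N) (iot K F0 (Algebra.norm F0 z)) := by
  rw [Algebra.norm_eq_matrix_det b, Matrix.det_apply, map_sum]
  refine LO.sum _ _ fun σ _ => ?_
  have h2 : LO (Fintype.card ι * N) (∏ i, iot K F0 (Algebra.leftMulMatrix b z (σ i) i)) := by
    have := LO.prod Finset.univ (fun i => iot K F0 (Algebra.leftMulMatrix b z (σ i) i)) (fun i _ => h _ _)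
    rwa [Finset.card_univ] at this
  rcases Int.units_eq_one_or (Equiv.Perm.sign σ) with h3 | h3
  · rw [h3, one_smul, map_prod]; exact h2
  · rw [h3, Units.neg_smul, one_smul, map_neg, map_prod]; exact h2.neg

lemma MF.trace {N : ℤ} {z : L} (h : MF K b N z) : LO N (iot K F0 (Algebra.trace F0 L z)) := by
  rw [Algebra.trace_eq_matrix_trace b, Matrix.trace, map_sum]
  exact LO.sum _ _ fun i _ => h i i

/-- the structure of 1-units -/
lemma MF.unit {w : L} (h : MF K b 1 w) : (∃ s : PowerSeries K, PowerSeries.constantCoeff s = 1 ∧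
    PowerSeries.coeff 1 s = (iot K F0 (Algebra.trace F0 L w)).coeff 1 ∧ iot K F0 (Algebra.norm F0 (1 + w)) = psl s) ∧
    MF K b 0 (1 + w)⁻¹ := by
  choose M hM using h
  set MM : Matrix ι ι (PowerSeries K) := Matrix.of M with hMM
  have hw : (iot K F0).mapMatrix (Algebra.leftMulMatrix b w) = (HahnSeries.ofPowerSeries ℤ K).mapMatrix ((PowerSeries.X : PowerSeries K) • MM) := by
    ext1 i j
    have := hM i j
    rw [RingHom.mapMatrix_apply, RingHom.mapMatrix_apply, Matrix.map_apply, Matrix.map_apply, this, Matrix.smul_apply, smul_eq_mul, map_mul,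
      HahnSeries.ofPowerSeries_X]
    rfl
  have hu : (iot K F0).mapMatrix (Algebra.leftMulMatrix b (1 + w)) = (HahnSeries.ofPowerSeries ℤ K).mapMatrix (1 + (PowerSeries.X : PowerSeries K) • MM) := by
    rw [map_add, map_add, map_add, hw, map_one, map_one, map_one]
  obtain ⟨p, hp⟩ : ∃ p, (1 + (PowerSeries.X : PowerSeries K) • MM).det = 1 + Matrix.trace MM * PowerSeries.X + p * PowerSeries.X ^ 2 :=
    ⟨_, Matrix.det_one_add_smul PowerSeries.X MM⟩
  have hnorm : iot K F0 (Algebra.norm F0 (1 + w)) = psl (1 + (PowerSeries.X : PowerSeries K) • MM).det := by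
    rw [Algebra.norm_eq_matrix_det b, RingHom.map_det, hu, ← RingHom.map_det]
  have htr : (iot K F0 (Algebra.trace F0 L w)) = psl (PowerSeries.X * Matrix.trace MM) := by
    rw [Algebra.trace_eq_matrix_trace b, Matrix.trace, map_sum]
    have : ∀ i, (iot K F0) ((Algebra.leftMulMatrix b w).diag i) = psl (PowerSeries.X * MM i i) := by
      intro i
      have := congrFun (congrFun hw i) i
      rw [RingHom.mapMatrix_apply, RingHom.mapMatrix_apply, Matrix.map_apply, Matrix.map_apply] at this
      exact this
    rw [Finset.sum_congr rfl fun i _ => this i, Matrix.trace, Finset.mul_sum, psl, map_sum]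
    rfl
  have hc : PowerSeries.constantCoeff (1 + (PowerSeries.X : PowerSeries K) • MM).det = 1 := by
    rw [hp]; simp
  refine ⟨⟨_, hc, ?_, hnorm⟩, ?_⟩
  · rw [htr]
    have := psl_coeff (PowerSeries.X * Matrix.trace MM) 1
    rw [Nat.cast_one] at this
    rw [this, hp, mul_comm, map_add, map_add]
    rw [show p * PowerSeries.X ^ 2 = (p * PowerSeries.X) * PowerSeries.X by ring]
    have e1 : ∀ q : PowerSeries K, PowerSeries.coeff 1 (q * PowerSeries.X) = PowerSeries.coeff 0 q := fun q => PowerSeries.coeff_succ_mul_X 0 q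
    rw [e1, mul_comm p, PowerSeries.coeff_zero_X_mul, PowerSeries.coeff_one]
    simp
  · set U := (1 + (PowerSeries.X : PowerSeries K) • MM) with hU
    have hdet : IsUnit U.det := by
      rw [PowerSeries.isUnit_iff_constantCoeff, hc]; exact isUnit_one
    have h0 : 1 + w ≠ 0 := by
      intro h0
      rw [h0] at hnorm
      have hne : Nonempty ι := b.index_nonempty
      have : Nontrivial L := inferInstance
      have : FiniteDimensional F0 L := Module.Finite.of_basis b
      rw [Algebra.norm_zero, map_zero] at hnorm
      have := psl_inj (show psl 0 = psl U.det by rw [← hnorm]; simp [psl])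
      rw [← this] at hc
      simp at hc
    have hinv : (iot K F0).mapMatrix (Algebra.leftMulMatrix b (1 + w)⁻¹) = (HahnSeries.ofPowerSeries ℤ K).mapMatrix U⁻¹ := by
      have e1 : (iot K F0).mapMatrix (Algebra.leftMulMatrix b (1 + w)⁻¹) * (iot K F0).mapMatrix (Algebra.leftMulMatrix b (1 + w)) = 1 := by
        rw [← map_mul, ← map_mul, inv_mul_cancel₀ h0, map_one, map_one]
      have e2 : (HahnSeries.ofPowerSeries ℤ K).mapMatrix U * (HahnSeries.ofPowerSeries ℤ K).mapMatrix U⁻¹ = 1 := by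
        rw [← map_mul, Matrix.mul_nonsing_inv U hdet, map_one]
      rw [hu] at e1
      exact left_inv_eq_right_inv e1 e2
    intro i j
    have := congrFun (congrFun hinv i) j
    rw [RingHom.mapMatrix_apply, RingHom.mapMatrix_apply, Matrix.map_apply, Matrix.map_apply] at this
    exact ⟨U⁻¹ i j, by rw [this, Tp_zero, one_mul]⟩

lemma MF.ne {w : L} (h : MF K b 1 w) : 1 + w ≠ 0 := by
  intro h0
  obtain ⟨⟨s, h1, h2, h3⟩, -⟩ := h.unit
  have : FiniteDimensional F0 L := Module.Finite.of_basis b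
  have hne : Nonempty ι := b.index_nonempty
  rw [h0, Algebra.norm_zero, map_zero] at h3
  have := psl_inj (show psl 0 = psl s by rw [← h3]; simp [psl])
  rw [← this] at h1
  simp at h1

lemma MF.inv_sub {w : L} (h : MF K b 1 w) : MF K b 1 ((1 + w)⁻¹ - 1) := by
  have h0 := h.ne
  have : (1 + w)⁻¹ - 1 = -(w * (1 + w)⁻¹) := by field_simp; ring
  rw [this]
  have := (h.mul h.unit.2).neg
  rwa [add_zero] at this
end

open Polynomial

section
variable {K : Type*} [Field K]
  {O : Type*} [CommRing O] [IsDedekindDomain O] [Algebra K[X] O] [Module.Finite K[X] O] [Module.IsTorsionFree K[X] O]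

variable (K) in
/-- monic generator of the relative norm -/
noncomputable def nf (I : Ideal O) : K[X] :=
  Submodule.IsPrincipal.generator (Ideal.relNorm K[X] I) * C (Submodule.IsPrincipal.generator (Ideal.relNorm K[X] I)).leadingCoeff⁻¹

lemma nf_span (I : Ideal O) : Ideal.relNorm K[X] I = Ideal.span {nf K I} := by
  rw [nf]
  set g := Submodule.IsPrincipal.generator (Ideal.relNorm K[X] I) with hg
  have h1 : Ideal.relNorm K[X] I = Ideal.span {g} := (Ideal.span_singleton_generator _).symm
  rw [h1]
  by_cases h : g = 0
  · simp [h]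
  · have hu : IsUnit (C g.leadingCoeff⁻¹) := isUnit_C.2 (by simpa using h)
    exact (Ideal.span_singleton_mul_right_unit hu g).symm

lemma nf_ne {I : Ideal O} (h : I ≠ ⊥) : nf K I ≠ 0 := by
  intro h0
  have := nf_span (K := K) I
  rw [h0, Ideal.span_singleton_eq_bot.2 rfl, Ideal.relNorm_eq_bot_iff] at this
  exact h this

lemma nf_monic {I : Ideal O} (h : I ≠ ⊥) : (nf K I).Monic := by
  have := nf_ne (K := K) h
  rw [nf] at this ⊢
  exact monic_mul_leadingCoeff_inv (left_ne_zero_of_mul this)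

lemma nf_eq {I : Ideal O} (h : I ≠ ⊥) {f : K[X]} (hf : f.Monic) (he : Ideal.relNorm K[X] I = Ideal.span {f}) : nf K I = f := by
  rw [nf_span, Ideal.span_singleton_eq_span_singleton] at he
  exact eq_of_monic_of_associated (nf_monic h) hf he

lemma nf_mul {I J : Ideal O} (hI : I ≠ ⊥) (hJ : J ≠ ⊥) : nf K (I * J) = nf K I * nf K J := by
  refine nf_eq (mul_ne_zero hI hJ) ((nf_monic hI).mul (nf_monic hJ)) ?_
  rw [map_mul, nf_span, nf_span, Ideal.span_singleton_mul_span_singleton]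

lemma nf_mem (I : Ideal O) : algebraMap K[X] O (nf K I) ∈ I := by
  have := Ideal.relNorm_le_comap (R := K[X]) I
  rw [nf_span, Ideal.span_singleton_le_iff_mem] at this
  exact this

lemma nf_top : nf K (⊤ : Ideal O) = 1 := by
  refine nf_eq top_ne_bot monic_one ?_
  rw [Ideal.relNorm_top, Ideal.span_singleton_one]

lemma nf_pow {I : Ideal O} (hI : I ≠ ⊥) (n : ℕ) : nf K (I ^ n) = nf K I ^ n := by
  induction n with
  | zero => rw [pow_zero, pow_zero, Ideal.one_eq_top, nf_top]
  | succ n ih => rw [pow_succ, pow_succ, nf_mul (pow_ne_zero _ hI) hI, ih]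

variable {F0 : Type*} [Field F0] [Algebra K[X] F0] [IsFractionRing K[X] F0]
  {L : Type*} [Field L] [Algebra F0 L] {ι : Type*} [Fintype ι] [DecidableEq ι] {b : Module.Basis ι F0 L}
  [Algebra O L] [IsFractionRing O L] [Algebra K[X] L] [IsScalarTower K[X] F0 L] [IsScalarTower K[X] O L]

/-- J = u I -/
def IsTw (L : Type*) [Field L] [Algebra O L] (u : L) (I J : Ideal O) : Prop := ∀ o : O, o ∈ J ↔ ∃ i ∈ I, algebraMap O L o = u * algebraMap O L i

lemma tw_key {u : L} {I J : Ideal O} (hI : I ≠ ⊥) (hJ : J ≠ ⊥) (hu0 : u ≠ 0) (h : IsTw L u I J) (h1 : ∀ i ∈ I, ∃ o : O, algebraMap O L o = u * algebraMap O L i) :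
    ∃ c : K, c ≠ 0 ∧ iot K F0 (Algebra.norm F0 u) * iotP K (nf K I) = HahnSeries.C c * iotP K (nf K J) := by
  obtain ⟨a, d, hd, rfl⟩ := IsFractionRing.div_surjective (A := O) u
  have hd0 : d ≠ 0 := nonZeroDivisors.ne_zero hd
  have hd' : algebraMap O L d ≠ 0 := by simpa using hd0
  have ha0 : a ≠ 0 := by rintro rfl; simp at hu0
  have e1 : Ideal.span {d} * J = Ideal.span {a} * I := by
    ext z
    rw [Ideal.mem_span_singleton_mul, Ideal.mem_span_singleton_mul]
    constructor
    · rintro ⟨o, ho, rfl⟩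
      obtain ⟨i, hi, he⟩ := (h o).1 ho
      refine ⟨i, hi, IsFractionRing.injective O L ?_⟩
      rw [map_mul, map_mul, he]; field_simp
    · rintro ⟨i, hi, rfl⟩
      obtain ⟨o, ho⟩ := h1 i hi
      refine ⟨o, (h o).2 ⟨i, hi, ho⟩, IsFractionRing.injective O L ?_⟩
      rw [map_mul, map_mul, ho]; field_simp
  have e2 := congrArg (Ideal.relNorm K[X]) e1
  rw [map_mul, map_mul, Ideal.relNorm_singleton, Ideal.relNorm_singleton, nf_span, nf_span,
    Ideal.span_singleton_mul_span_singleton, Ideal.span_singleton_mul_span_singleton, Ideal.span_singleton_eq_span_singleton] at e2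
  obtain ⟨c, hc⟩ := e2
  obtain ⟨c', hc', hcc⟩ := Polynomial.isUnit_iff.1 c.isUnit
  rw [← hcc] at hc
  refine ⟨c', hc'.ne_zero, ?_⟩
  have hIC : IsIntegralClosure O K[X] L := IsIntegralClosure.of_isIntegrallyClosed O K[X] L
  have : FiniteDimensional F0 L := by
    exact Module.Finite.of_isLocalization K[X] O (nonZeroDivisors K[X]) (Rₚ := F0) (Sₚ := L)
  have hn : ∀ z : O, algebraMap K[X] F0 (Algebra.intNorm K[X] O z) = Algebra.norm F0 (algebraMap O L z) := fun z => Algebra.algebraMap_intNorm (A := K[X]) (K := F0) (L := L) (B := O) z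
  have hN0 : Algebra.norm F0 (algebraMap O L d) ≠ 0 := by
    rw [Ne, Algebra.norm_eq_zero_iff]; exact hd'
  have e3 := congrArg (fun z => iot K F0 (algebraMap K[X] F0 z)) hc
  simp only [map_mul] at e3
  rw [hn, hn, iot_alg, iot_alg, iot_alg] at e3
  have e4 : iotP K (C c') = HahnSeries.C c' := by rw [iotP, coe_eval₂RingHom, eval₂_C]
  rw [e4] at e3
  have e5 : Algebra.norm F0 (algebraMap O L a / algebraMap O L d) * Algebra.norm F0 (algebraMap O L d) = Algebra.norm F0 (algebraMap O L a) := by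
    rw [← map_mul, div_mul_cancel₀ _ hd']
  rw [← e5, map_mul] at e3
  have hN1 : iot K F0 (Algebra.norm F0 (algebraMap O L d)) ≠ 0 := by
    rwa [Ne, map_eq_zero]
  refine mul_left_cancel₀ hN1 ?_
  linear_combination -e3

lemma tw_nf {w : L} (hw : MF K b 1 w) {I J : Ideal O} (hI : I ≠ ⊥) (hJ : J ≠ ⊥) (h : IsTw L (1 + w) I J) (h1 : ∀ i ∈ I, ∃ o : O, algebraMap O L o = (1 + w) * algebraMap O L i) :
    (nf K J).natDegree = (nf K I).natDegree ∧ (nf K J).nextCoeff = (nf K I).nextCoeff + (iot K F0 (Algebra.trace F0 L w)).coeff 1 := by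
  obtain ⟨c, hc0, hc⟩ := tw_key (K := K) (F0 := F0) hI hJ hw.ne h h1
  obtain ⟨⟨s, hs0, hs1, hs⟩, -⟩ := hw.unit
  obtain ⟨sI, hsI0, hsI1, hsI⟩ := iotP_monic _ (nf_monic (K := K) hI)
  obtain ⟨sJ, hsJ0, hsJ1, hsJ⟩ := iotP_monic _ (nf_monic (K := K) hJ)
  rw [hs, hsI, hsJ, ← HahnSeries.ofPowerSeries_C] at hc
  have e : Tp K (-(nf K I).natDegree) * psl (s * sI) = Tp K (-(nf K J).natDegree) * psl (PowerSeries.C c * sJ) := by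
    rw [psl, psl, map_mul, map_mul]
    linear_combination hc
  obtain ⟨e1, e2⟩ := normal_unique (by simp [hs0, hsI0]) (by simp [hsJ0, hc0]) e
  have e3 := congrArg PowerSeries.constantCoeff e2
  simp only [map_mul, hs0, hsI0, hsJ0, PowerSeries.constantCoeff_C, mul_one] at e3
  have e4 := congrArg (PowerSeries.coeff 1) e2
  rw [← e3, map_one, one_mul, PowerSeries.coeff_mul, Finset.Nat.antidiagonal_succ] at e4
  simp [hs0, hsI0, hsI1, hs1, hsJ1] at e4
  refine ⟨by omega, ?_⟩
  rw [← e4]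
end

open Polynomial

section
variable {K : Type*} [Field K]
  {O : Type*} [CommRing O] [IsDedekindDomain O] [Algebra K[X] O] [Module.Finite K[X] O] [Module.IsTorsionFree K[X] O]
  {F0 : Type*} [Field F0] [Algebra K[X] F0] [IsFractionRing K[X] F0]
  {L : Type*} [Field L] [Algebra F0 L] {ι : Type*} [Fintype ι] [DecidableEq ι] (b : Module.Basis ι F0 L)
  [Algebra O L] [IsFractionRing O L] [Algebra K[X] L] [IsScalarTower K[X] F0 L] [IsScalarTower K[X] O L]

/-- the twisted ideal -/
def twI (u : L) (I : Ideal O) : Ideal O where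
  carrier := {o | ∃ i ∈ I, algebraMap O L o = u * algebraMap O L i}
  add_mem' := by
    rintro x y ⟨i, hi, h⟩ ⟨j, hj, h'⟩
    exact ⟨i + j, I.add_mem hi hj, by rw [map_add, map_add, h, h', mul_add]⟩
  zero_mem' := ⟨0, I.zero_mem, by simp⟩
  smul_mem' := by
    rintro c x ⟨i, hi, h⟩
    exact ⟨c * i, I.mul_mem_left c hi, by rw [smul_eq_mul, map_mul, map_mul, h]; ring⟩

variable (K) in
/-- the space of admissible perturbations -/
def WI (δ : O) (I : Ideal O) : Set L := {w | MF K b 1 w ∧ ∀ i ∈ I, ∃ o : O, w * algebraMap O L i = algebraMap O L (δ * o)}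

variable {b} {δ : O} {I : Ideal O} {w : L}

lemma WI.int (hw : w ∈ WI K b δ I) : ∀ i ∈ I, ∃ o : O, algebraMap O L o = (1 + w) * algebraMap O L i := by
  intro i hi
  obtain ⟨o, ho⟩ := hw.2 i hi
  exact ⟨i + δ * o, by rw [map_add, ← ho]; ring⟩

lemma WI.ne_bot (hw : w ∈ WI K b δ I) (hI : I ≠ ⊥) : twI (1 + w) I ≠ ⊥ := by
  obtain ⟨i, hi, hi0⟩ := Submodule.exists_mem_ne_zero_of_ne_bot hI
  obtain ⟨o, ho⟩ := WI.int hw i hi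
  have : o ∈ twI (1 + w) I := ⟨i, hi, ho⟩
  intro h
  rw [h, Ideal.mem_bot] at this
  rw [this, map_zero] at ho
  rcases mul_eq_zero.1 ho.symm with h1 | h1
  · exact hw.1.ne h1
  · exact hi0 (by simpa using h1)

lemma WI.coprime (hw : w ∈ WI K b δ I) (hI : I ⊔ Ideal.span {δ} = ⊤) : twI (1 + w) I ⊔ Ideal.span {δ} = ⊤ := by
  rw [Ideal.eq_top_iff_one] at hI ⊢
  obtain ⟨i, hi, z, hz, h1⟩ := Submodule.mem_sup.1 hI
  obtain ⟨o, ho⟩ := hw.2 i hi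
  rw [← h1]
  have e : i + z = (i + δ * o) + (z - δ * o) := by ring
  rw [e]
  refine Submodule.add_mem_sup ⟨i, hi, by rw [map_add, ← ho]; ring⟩ (Ideal.sub_mem _ hz (Ideal.mul_mem_right _ _ (Ideal.mem_span_singleton_self δ)))

lemma WI.inv (hw : w ∈ WI K b δ I) : (1 + w)⁻¹ - 1 ∈ WI K b δ (twI (1 + w) I) := by
  refine ⟨hw.1.inv_sub, ?_⟩
  rintro j ⟨i, hi, hj⟩
  obtain ⟨o, ho⟩ := hw.2 i hi
  refine ⟨-o, ?_⟩
  have := hw.1.ne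
  rw [hj, mul_neg, map_neg, ← ho]
  field_simp; ring

lemma WI.twtw (hw : w ∈ WI K b δ I) : twI (1 + w)⁻¹ (twI (1 + w) I) = I := by
  have h0 := hw.1.ne
  ext o
  constructor
  · rintro ⟨j, ⟨i, hi, hj⟩, ho⟩
    rw [hj, inv_mul_cancel_left₀ h0] at ho
    rwa [IsFractionRing.injective O L ho]
  · intro hi
    obtain ⟨o', ho'⟩ := WI.int hw o hi
    exact ⟨o', ⟨o, hi, ho'⟩, by rw [ho', inv_mul_cancel_left₀ h0]⟩

lemma WI.shift (hw : w ∈ WI K b δ I) {w' : L} (hw' : w' ∈ WI K b δ (twI (1 + w) I)) : (1 + w) * w' ∈ WI K b δ I := by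
  refine ⟨?_, fun i hi => ?_⟩
  · have h1 : MF K b 0 (1 + w) := MF.one.add (hw.1.mono (by omega))
    have := h1.mul hw'.1
    rwa [zero_add] at this
  · obtain ⟨j, hj⟩ := WI.int hw i hi
    obtain ⟨o, ho⟩ := hw'.2 j ⟨i, hi, hj⟩
    exact ⟨o, by rw [← ho, hj]; ring⟩

lemma WI.card (hfin : ∀ I : Ideal O, I ≠ ⊥ → (WI K b δ I).Finite) (hI : I ≠ ⊥) (hw : w ∈ WI K b δ I) : (WI K b δ (twI (1 + w) I)).ncard = (WI K b δ I).ncard := by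
  have key : ∀ (I : Ideal O) (w : L), I ≠ ⊥ → w ∈ WI K b δ I → (WI K b δ (twI (1 + w) I)).ncard ≤ (WI K b δ I).ncard := by
    intro I w hI hw
    refine Set.ncard_le_ncard_of_injOn (fun w' => (1 + w) * w') (fun w' hw' => WI.shift hw hw') ?_ (hfin I hI)
    intro x _ y _ h
    exact mul_left_cancel₀ hw.1.ne h
  refine le_antisymm (key I w hI hw) ?_
  have := key _ _ (WI.ne_bot hw hI) (WI.inv hw)
  rwa [add_sub_cancel, WI.twtw hw] at this

lemma WI.add (hw : w ∈ WI K b δ I) {w' : L} (hw' : w' ∈ WI K b δ I) : w + w' ∈ WI K b δ I := by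
  refine ⟨hw.1.add hw'.1, fun i hi => ?_⟩
  obtain ⟨o, ho⟩ := hw.2 i hi
  obtain ⟨o', ho'⟩ := hw'.2 i hi
  exact ⟨o + o', by rw [add_mul, ho, ho', mul_add, map_add]⟩

lemma WI.neg (hw : w ∈ WI K b δ I) : -w ∈ WI K b δ I := by
  refine ⟨hw.1.neg, fun i hi => ?_⟩
  obtain ⟨o, ho⟩ := hw.2 i hi
  exact ⟨-o, by rw [neg_mul, ho, mul_neg, map_neg]⟩

/-- the residue functional -/
noncomputable def tau (K F0 : Type*) [Field K] [Field F0] [Algebra K[X] F0] [IsFractionRing K[X] F0] {L : Type*} [Field L] [Algebra F0 L] (w : L) : K := (iot K F0 (Algebra.trace F0 L w)).coeff 1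

lemma tau_add (w w' : L) : tau K F0 (w + w') = tau K F0 w + tau K F0 w' := by
  simp [tau, map_add]

/-- ideals coprime to δ of degree n -/
def Sn (K : Type*) [Field K] [Algebra K[X] O] [Module.Finite K[X] O] [Module.IsTorsionFree K[X] O] (δ : O) (n : ℕ) : Set (Ideal O) := {I | I ≠ ⊥ ∧ I ⊔ Ideal.span {δ} = ⊤ ∧ (nf K I).natDegree = n}

lemma Sn_finite [Finite K] (n : ℕ) : (Sn K δ n).Finite := by
  have h1 : Set.Finite {f : K[X] | f.natDegree ≤ n} := by
    have : {f : K[X] | f.natDegree ≤ n} ⊆ (Polynomial.degreeLT K (n + 1) : Set K[X]) := by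
      intro f hf
      rw [SetLike.mem_coe, Polynomial.mem_degreeLT]
      refine lt_of_le_of_lt (Polynomial.degree_le_natDegree) ?_
      exact_mod_cast Nat.lt_succ_of_le hf
    refine Set.Finite.subset ?_ this
    have : Finite (Polynomial.degreeLT K (n + 1)) := Finite.of_equiv _ (Polynomial.degreeLTEquiv K (n + 1)).symm.toEquiv
    exact Set.toFinite _
  have h2 : ∀ f : K[X], f ≠ 0 → Set.Finite {I : Ideal O | algebraMap K[X] O f ∈ I} := by
    intro f hf
    have hs : Ideal.span {algebraMap K[X] O f} ≠ (0 : Ideal O) := by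
      rw [Ne, Ideal.zero_eq_bot, Ideal.span_singleton_eq_bot]
      rwa [FaithfulSMul.algebraMap_eq_zero_iff]
    have := UniqueFactorizationMonoid.fintypeSubtypeDvd _ hs
    have h3 : Set.Finite {x : Ideal O | x ∣ Ideal.span {algebraMap K[X] O f}} := @Set.toFinite _ _ (@Finite.of_fintype _ this)
    refine h3.subset ?_
    intro I hI
    exact Ideal.dvd_span_singleton.2 hI
  refine ((h1.subset (t := {f : K[X] | f.natDegree ≤ n ∧ f ≠ 0}) (fun f hf => hf.1)).biUnion (t := fun f => {I : Ideal O | algebraMap K[X] O f ∈ I}) (fun f hf => h2 f hf.2)).subset ?_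
  intro I hI
  simp only [Set.mem_iUnion]
  exact ⟨nf K I, ⟨hI.2.2.le, nf_ne hI.1⟩, nf_mem I⟩

/-- the vanishing -/
lemma sum_zero [Finite K] (χ : AddChar K ℂ) (n : ℕ) (hfin : ∀ I : Ideal O, I ≠ ⊥ → (WI K b δ I).Finite)
    (hex : ∀ I ∈ Sn K δ n, ∃ w ∈ WI K b δ I, χ (-tau K F0 w) ≠ 1) :
    ∑ I ∈ (Sn_finite (K := K) (δ := δ) n).toFinset, χ (-(nf K I).nextCoeff) = 0 := by
  classical
  set S := (Sn_finite (K := K) (δ := δ) n).toFinset with hS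
  have hmS : ∀ I, I ∈ S ↔ I ∈ Sn K δ n := fun I => by rw [hS, Set.Finite.mem_toFinset]
  set W : Ideal O → Finset L := fun I => if h : I = ⊥ then ∅ else (hfin I h).toFinset with hW
  have hmW : ∀ I, I ∈ S → ∀ w, w ∈ W I ↔ w ∈ WI K b δ I := by
    intro I hI w
    simp only [hW]
    rw [dif_neg ((hmS I).1 hI).1, Set.Finite.mem_toFinset]
  have hcard : ∀ I ∈ S, (W I).card = (WI K b δ I).ncard := by
    intro I hI
    simp only [hW]
    rw [dif_neg ((hmS I).1 hI).1, Set.ncard_eq_toFinset_card _ (hfin I ((hmS I).1 hI).1)]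
  have hpos : ∀ I ∈ S, ((W I).card : ℂ) ≠ 0 := by
    intro I hI
    obtain ⟨w, hw, -⟩ := hex I ((hmS I).1 hI)
    have : w ∈ W I := (hmW I hI w).2 hw
    exact_mod_cast (Finset.card_pos.2 ⟨w, this⟩).ne'
  have hmem : ∀ I ∈ S, ∀ w ∈ W I, twI (1 + w) I ∈ S ∧ (nf K (twI (1 + w) I)).nextCoeff = (nf K I).nextCoeff + tau K F0 w := by
    intro I hI w hw
    have hI' := (hmS I).1 hI
    have hw' := (hmW I hI w).1 hw
    have hb := WI.ne_bot hw' hI'.1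
    have := tw_nf hw'.1 hI'.1 hb (fun o => Iff.rfl) (WI.int hw')
    exact ⟨(hmS _).2 ⟨hb, WI.coprime hw' hI'.2.1, by rw [this.1, hI'.2.2]⟩, this.2⟩
  have step1 : ∑ I ∈ S, χ (-(nf K I).nextCoeff) = ∑ x ∈ S.sigma W, χ (-(nf K x.1).nextCoeff) / (W x.1).card := by
    rw [Finset.sum_sigma]
    refine Finset.sum_congr rfl fun I hI => ?_
    simp only
    rw [Finset.sum_const, nsmul_eq_mul, mul_div_cancel₀ _ (hpos I hI)]
  have step2 : ∑ x ∈ S.sigma W, χ (-(nf K x.1).nextCoeff) / (W x.1).card =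
      ∑ x ∈ S.sigma W, χ (-(nf K x.1).nextCoeff) * χ (-tau K F0 x.2) / (W x.1).card := by
    have hmap : ∀ x ∈ S.sigma W, (⟨twI (1 + x.2) x.1, (1 + x.2)⁻¹ - 1⟩ : (_ : Ideal O) × L) ∈ S.sigma W := by
      rintro ⟨I, w⟩ hx
      obtain ⟨hI, hw⟩ := Finset.mem_sigma.1 hx
      have h1 := (hmem I hI w hw).1
      exact Finset.mem_sigma.2 ⟨h1, (hmW _ h1 _).2 (WI.inv ((hmW I hI w).1 hw))⟩
    have hinv : ∀ x ∈ S.sigma W, (⟨twI (1 + ((1 + x.2)⁻¹ - 1)) (twI (1 + x.2) x.1), (1 + ((1 + x.2)⁻¹ - 1))⁻¹ - 1⟩ : (_ : Ideal O) × L) = x := by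
      rintro ⟨I, w⟩ hx
      obtain ⟨hI, hw⟩ := Finset.mem_sigma.1 hx
      simp only [add_sub_cancel, inv_inv, add_sub_cancel_left]
      rw [WI.twtw ((hmW I hI w).1 hw)]
    symm
    refine Finset.sum_bij' (fun x _ => (⟨twI (1 + x.2) x.1, (1 + x.2)⁻¹ - 1⟩ : (_ : Ideal O) × L)) (fun x _ => (⟨twI (1 + x.2) x.1, (1 + x.2)⁻¹ - 1⟩ : (_ : Ideal O) × L)) hmap hmap hinv hinv ?_
    rintro ⟨I, w⟩ hx
    obtain ⟨hI, hw⟩ := Finset.mem_sigma.1 hx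
    have h1 := hmem I hI w hw
    simp only
    rw [h1.2, neg_add, AddChar.map_add_eq_mul, hcard _ hI, hcard _ h1.1, WI.card hfin ((hmS I).1 hI).1 ((hmW I hI w).1 hw)]
  rw [step1, step2, Finset.sum_sigma]
  refine Finset.sum_eq_zero fun I hI => ?_
  have : ∑ w ∈ W I, χ (-tau K F0 w) = 0 := by
    obtain ⟨w0, hw0, hne⟩ := hex I ((hmS I).1 hI)
    have e : ∑ w ∈ W I, χ (-tau K F0 w) = ∑ w ∈ W I, χ (-tau K F0 w0) * χ (-tau K F0 w) := by
      symm
      refine Finset.sum_bij' (fun w _ => w0 + w) (fun w _ => -w0 + w) ?_ ?_ ?_ ?_ ?_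
      · intro w hw
        rw [hmW I hI] at hw ⊢
        exact WI.add hw0 hw
      · intro w hw
        rw [hmW I hI] at hw ⊢
        exact WI.add (WI.neg hw0) hw
      · intro w _; simp
      · intro w _; simp
      · intro w _
        rw [tau_add, neg_add, AddChar.map_add_eq_mul]
    rw [← Finset.mul_sum] at e
    have e2 : (1 - χ (-tau K F0 w0)) * ∑ w ∈ W I, χ (-tau K F0 w) = 0 := by linear_combination e
    rcases mul_eq_zero.1 e2 with h | h
    · exact absurd (sub_eq_zero.1 h).symm hne
    · exact h
  simp only
  rw [← Finset.sum_div, ← Finset.mul_sum, this, mul_zero, zero_div]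
end

open Polynomial

section NC
variable (R S : Type*) [CommRing R] [CommRing S] [IsDomain R] [IsDomain S]
  [Algebra R S] [Module.IsTorsionFree R S]

noncomputable local instance instLA : Algebra (FractionRing R) (FractionRing S) := FractionRing.liftAlgebra _ _

local notation "Kc" => FractionRing R
local notation "Lc" => FractionRing S
local notation "Ec" => IntermediateField.normalClosure (FractionRing R) (FractionRing S)
    (AlgebraicClosure (FractionRing S))
local notation "Tc" => Ring.NormalClosure R S

noncomputable local instance : Algebra S Ec := ((algebraMap Lc Ec).comp (algebraMap S Lc)).toAlgebra

local instance : IsScalarTower S Lc Ec := IsScalarTower.of_algebraMap_eq' rfl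

noncomputable local instance : Algebra Tc Ec := inferInstanceAs (Algebra (integralClosure S Ec) Ec)
local instance : IsScalarTower S Tc Ec :=
  inferInstanceAs (IsScalarTower S (integralClosure S Ec) Ec)
local instance : IsIntegralClosure Tc S Ec := integralClosure.isIntegralClosure S Ec
local instance : IsScalarTower R Lc Ec := IsScalarTower.to₁₃₄ R Kc Lc Ec
local instance : IsScalarTower R S Ec := IsScalarTower.to₁₂₄ R S Lc Ec
local instance : IsScalarTower R Tc Ec := IsScalarTower.to₁₃₄ R S Tc Ec
local instance : FaithfulSMul S Ec := (faithfulSMul_iff_algebraMap_injective S Ec).mpr <|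
      (FaithfulSMul.algebraMap_injective Lc Ec).comp (FaithfulSMul.algebraMap_injective S Lc)

variable [Module.Finite R S]
local instance : FiniteDimensional Lc Ec := Module.Finite.right Kc Lc Ec
local instance : IsFractionRing Tc Ec :=
  integralClosure.isFractionRing_of_finite_extension Lc Ec

variable [Algebra.IsSeparable (FractionRing R) (FractionRing S)]
local instance : IsGalois Kc Ec where
  to_isSeparable := by
    refine (le_separableClosure_iff _ _ _).1 ?_
    rw [normalClosure_le_iff]
    intro f
    rw [le_separableClosure_iff]
    exact AlgEquiv.Algebra.isSeparable (AlgEquiv.ofInjectiveField f)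
  to_normal := inferInstance

local instance : Algebra.IsSeparable Lc Ec :=
  Algebra.isSeparable_tower_top_of_isSeparable Kc Lc Ec

local instance : IsGalois Kc (FractionRing Tc) := by
  refine IsGalois.of_equiv_equiv (F := Kc) (E := Ec)
    (f := (FractionRing.algEquiv R Kc).symm.toRingEquiv)
    (g := (FractionRing.algEquiv Tc Ec).symm.toRingEquiv) ?_
  ext
  simpa using! IsFractionRing.algEquiv_commutes (FractionRing.algEquiv R Kc).symm
    (FractionRing.algEquiv Tc Ec).symm _

variable [IsDedekindDomain S]
local instance : Module.Finite S Tc := IsIntegralClosure.finite S Lc Ec Tc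
local instance : Module.Finite R Tc := Module.Finite.trans S Tc
local instance : IsDedekindDomain Tc := integralClosure.isDedekindDomain S Lc Ec

variable {R S}
open Ideal in
theorem relNorm_prime_pow [IsDedekindDomain R] (P : Ideal S) (p : Ideal R) [hPp : P.LiesOver p] [P.IsMaximal] [p.IsMaximal] :
    relNorm R P = p ^ P.inertiaDeg R := by
  let T := Ring.NormalClosure R S
  obtain ⟨Q, hQ₁, hQ₂⟩ : ∃ Q : Ideal T, Q.IsMaximal ∧ Q.LiesOver P :=
    exists_maximal_ideal_liesOver_of_isIntegral P
  have : Q.LiesOver p := LiesOver.trans Q P p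
  have h := relNorm_eq_pow_of_isPrime_isGalois Q p
  have : IsGalois (FractionRing S) (FractionRing T) :=
    IsGalois.tower_top_of_isGalois (FractionRing R) (FractionRing S) (FractionRing T)
  rwa [← relNorm_relNorm R S, relNorm_eq_pow_of_isPrime_isGalois Q P, map_pow,
    inertiaDeg_tower (R := R) P Q, pow_mul, pow_left_inj (inertiaDeg_pos Q S).ne'] at h
end NC

open Polynomial

lemma quot_step {O : Type*} [CommRing O] [IsDedekindDomain O] (P J : Ideal O) (hP : P.IsMaximal) (hJ : J ≠ ⊥) 
    (h1 : Finite (O ⧸ P)) (h2 : Finite (O ⧸ J)) : Finite (O ⧸ (P * J)) ∧ Nat.card (O ⧸ (P * J)) ≤ Nat.card (O ⧸ P) * Nat.card (O ⧸ J) := by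
  by_cases hP0 : P = ⊥
  · have hf : IsField O := by rw [hP0] at hP; exact (Ring.isField_iff_maximal_bot).2 hP
    letI := hf.toField
    have : J = ⊤ := by
      rcases Ideal.eq_bot_or_top J with h | h
      · exact absurd h hJ
      · exact h
    subst this
    rw [Ideal.mul_top]
    refine ⟨h1, ?_⟩
    have : 0 < Nat.card (O ⧸ (⊤ : Ideal O)) := Nat.card_pos
    nlinarith
  have hlt : P * J < J := by
    refine lt_of_le_of_ne Ideal.mul_le_right ?_
    intro h
    have h3 : P * J = 1 * J := by rw [h, one_mul]
    have := mul_right_cancel₀ (b := J) hJ h3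
    rw [Ideal.one_eq_top] at this
    exact hP.ne_top this
  obtain ⟨a, haJ, haP⟩ := SetLike.exists_of_lt hlt
  have hsup : Ideal.span {a} ⊔ P * J = J := by
    have hle : Ideal.span {a} ⊔ P * J ≤ J := sup_le ((Ideal.span_singleton_le_iff_mem _).2 haJ) hlt.le
    obtain ⟨Q, hQ⟩ := Ideal.dvd_iff_le.2 hle
    have hPQ : P ≤ Q := by
      have h4 : P * J ≤ J * Q := by rw [← hQ]; exact le_sup_right
      have h5 : J * Q ∣ J * P := by rw [mul_comm J P]; exact Ideal.dvd_iff_le.2 h4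
      exact Ideal.dvd_iff_le.1 ((mul_dvd_mul_iff_left (a := J) hJ).1 h5)
    by_cases h : P = Q
    · exfalso; apply haP
      have : a ∈ Ideal.span {a} ⊔ P * J := Ideal.mem_sup_left (Ideal.mem_span_singleton_self a)
      rwa [hQ, ← h, mul_comm] at this
    · rw [hQ, hP.1.2 _ (lt_of_le_of_ne hPQ h), Ideal.mul_top]
  let f : (O ⧸ P) × (O ⧸ J) → O ⧸ (P * J) := fun x => Ideal.Quotient.mk _ (Quotient.out x.2 + a * Quotient.out x.1)
  have hf : Function.Surjective f := by
    intro z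
    obtain ⟨z, rfl⟩ := Ideal.Quotient.mk_surjective z
    have hz : z - Quotient.out (Ideal.Quotient.mk J z) ∈ J := by
      rw [← Ideal.Quotient.eq]; exact (Quotient.out_eq (Ideal.Quotient.mk J z)).symm
    obtain ⟨y, hy, w, hw, hyw⟩ := Submodule.mem_sup.1 (hsup.ge hz)
    obtain ⟨o, rfl⟩ := Ideal.mem_span_singleton'.1 hy
    have ho : o - Quotient.out (Ideal.Quotient.mk P o) ∈ P := by
      rw [← Ideal.Quotient.eq]; exact (Quotient.out_eq (Ideal.Quotient.mk P o)).symm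
    refine ⟨(Ideal.Quotient.mk P o, Ideal.Quotient.mk J z), ?_⟩
    simp only [f]
    rw [eq_comm, Ideal.Quotient.eq]
    have := Ideal.add_mem _ (Ideal.mul_mem_mul ho haJ) hw
    convert this using 1
    linear_combination -hyw
  refine ⟨Finite.of_surjective f hf, ?_⟩
  rw [← Nat.card_prod]
  exact Nat.card_le_card_of_surjective f hf

section
attribute [local instance] FractionRing.liftAlgebra
variable {K : Type*} [Field K]
  {O : Type*} [CommRing O] [IsDedekindDomain O] [Algebra K[X] O] [Module.Finite K[X] O] [Module.IsTorsionFree K[X] O]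
  [Algebra.IsSeparable (FractionRing K[X]) (FractionRing O)]

lemma nf_prime (P : Ideal O) (hP : P.IsMaximal) (hP0 : P ≠ ⊥) : ∃ π : K[X], π.Monic ∧ Irreducible π ∧ P.under K[X] = Ideal.span {π} ∧
    nf K P = π ^ P.inertiaDeg K[X] := by
  have hm : (P.under K[X]).IsMaximal := Ideal.IsMaximal.under K[X] P
  have hpn : P.under K[X] ≠ ⊥ := mt Ideal.eq_bot_of_comap_eq_bot hP0
  obtain ⟨g, hg⟩ : ∃ g, P.under K[X] = Ideal.span {g} := ⟨_, (Ideal.span_singleton_generator _).symm⟩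
  have hg0 : g ≠ 0 := by rintro rfl; simp [hpn] at hg
  have hgi : Irreducible g := by
    rw [hg] at hm
    exact ((Ideal.span_singleton_prime hg0).1 hm.isPrime).irreducible
  have hu : IsUnit (C g.leadingCoeff⁻¹) := isUnit_C.2 (by simpa using hg0)
  have hs : P.under K[X] = Ideal.span {g * C g.leadingCoeff⁻¹} := by rw [hg, Ideal.span_singleton_mul_right_unit hu g]
  have hmon := monic_mul_leadingCoeff_inv hg0
  refine ⟨g * C g.leadingCoeff⁻¹, hmon, (irreducible_mul_isUnit hu).2 hgi, hs, nf_eq hP0 (hmon.pow _) ?_⟩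
  have hl : P.LiesOver (P.under K[X]) := Ideal.over_under P
  rw [relNorm_prime_pow P (P.under K[X]), ← Ideal.span_singleton_pow, ← hs]

lemma card_prime [Finite K] (P : Ideal O) (hP : P.IsMaximal) (hP0 : P ≠ ⊥) : Nat.card (O ⧸ P) = Nat.card K ^ (nf K P).natDegree := by
  obtain ⟨π, hm, hi, hs, hn⟩ := nf_prime (K := K) P hP hP0
  have hmx : (P.under K[X]).IsMaximal := Ideal.IsMaximal.under K[X] P
  have hl : P.LiesOver (P.under K[X]) := Ideal.over_under P
  have h1 := Ideal.cardQuot_pow_inertiaDeg (P.under K[X]) P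
  have h2 : (P.under K[X]).cardQuot = Nat.card K ^ π.natDegree := by
    rw [hs]
    change Nat.card (K[X] ⧸ Ideal.span {π}) = _
    have : Module.Finite K (K[X] ⧸ Ideal.span {π}) := (AdjoinRoot.powerBasis hm.ne_zero).finite
    rw [Module.natCard_eq_pow_finrank (K := K), finrank_quotient_span_eq_natDegree]
  rw [hn, hm.natDegree_pow]
  change P.cardQuot = _
  rw [← h1, h2, ← pow_mul, mul_comm]

lemma card_le [Finite K] (J : Ideal O) (hJ : J ≠ ⊥) : Finite (O ⧸ J) ∧ Nat.card (O ⧸ J) ≤ Nat.card K ^ (nf K J).natDegree := by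
  induction J using UniqueFactorizationMonoid.induction_on_prime with
  | h₁ => exact absurd rfl hJ
  | h₂ x hx =>
    rw [Ideal.isUnit_iff] at hx
    subst hx
    rw [nf_top]
    exact ⟨inferInstance, by simp⟩
  | h₃ a p ha hp ih =>
    have hp0 : p ≠ ⊥ := hp.ne_zero
    have hpm : p.IsMaximal := (Ideal.isPrime_of_prime hp).isMaximal hp0
    have h1 := card_prime (K := K) p hpm hp0
    have h2 := ih ha
    have hf : Finite (O ⧸ p) := Nat.finite_of_card_ne_zero (by rw [h1]; exact pow_ne_zero _ Nat.card_pos.ne')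
    obtain ⟨h3, h4⟩ := quot_step p a hpm ha hf h2.1
    refine ⟨h3, h4.trans ?_⟩
    rw [nf_mul hp0 ha, (nf_monic hp0).natDegree_mul (nf_monic ha), pow_add, h1]
    exact Nat.mul_le_mul_left _ h2.2

lemma nf_alg (g : K[X]) (hg : g ≠ 0) : (nf K (Ideal.span {algebraMap K[X] O g})).natDegree = Module.finrank K[X] O * g.natDegree := by
  have h0 : Ideal.span {algebraMap K[X] O g} ≠ ⊥ := by
    rw [Ne, Ideal.span_singleton_eq_bot]
    rwa [FaithfulSMul.algebraMap_eq_zero_iff]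
  have hu : IsUnit (C g.leadingCoeff⁻¹) := isUnit_C.2 (by simpa using hg)
  have hmon := monic_mul_leadingCoeff_inv hg
  rw [nf_eq (f := (g * C g.leadingCoeff⁻¹) ^ Module.finrank K[X] O) h0 (hmon.pow _), hmon.natDegree_pow]
  · rw [natDegree_mul_C (by simpa using hg)]
  · have := Ideal.relNorm_algebraMap (R := K[X]) (S := O) (Ideal.span {g})
    rw [Ideal.map_span, Set.image_singleton] at this
    rw [this, ← Ideal.span_singleton_pow, Ideal.span_singleton_mul_right_unit hu g]
end

open Polynomial

lemma finite_natDegree_le {K : Type*} [Field K] [Finite K] (n : ℕ) : Set.Finite {f : K[X] | f.natDegree ≤ n} := by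
  have : {f : K[X] | f.natDegree ≤ n} ⊆ (Polynomial.degreeLT K (n + 1) : Set K[X]) := by
    intro f hf
    rw [SetLike.mem_coe, Polynomial.mem_degreeLT]
    refine lt_of_le_of_lt (Polynomial.degree_le_natDegree) ?_
    exact_mod_cast Nat.lt_succ_of_le hf
  refine Set.Finite.subset ?_ this
  have : Finite (Polynomial.degreeLT K (n + 1)) := Finite.of_equiv _ (Polynomial.degreeLTEquiv K (n + 1)).symm.toEquiv
  exact Set.toFinite _

section
attribute [local instance] FractionRing.liftAlgebra
variable {K : Type*} [Field K]
  {O : Type*} [CommRing O] [IsDedekindDomain O] [Algebra K[X] O] [Module.Finite K[X] O] [Module.IsTorsionFree K[X] O]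
  {F0 : Type*} [Field F0] [Algebra K[X] F0] [IsFractionRing K[X] F0]
  {L : Type*} [Field L] [Algebra F0 L] {ι : Type*} [Fintype ι] [DecidableEq ι] {b : Module.Basis ι F0 L}
  [Algebra O L] [IsFractionRing O L] [Algebra K[X] L] [IsScalarTower K[X] F0 L] [IsScalarTower K[X] O L]

lemma WI_finite [Finite K] (Δ : K[X]) (hcoord : ∀ (o : O) (j : ι), ∃ c : K[X], b.repr (algebraMap O L (algebraMap K[X] O Δ * o)) j = algebraMap K[X] F0 c)
    (hone : ∃ i, b i = 1) (I : Ideal O) (hI : I ≠ ⊥) : (WI K b (algebraMap K[X] O Δ) I).Finite := by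
  obtain ⟨i0, hi0⟩ := hone
  set f := nf K I with hf
  have hf0 : algebraMap K[X] L f ≠ 0 := by
    rw [IsScalarTower.algebraMap_apply K[X] F0 L]
    simpa using nf_ne (K := K) hI
  refine ((Set.Finite.pi' (fun _ : ι => finite_natDegree_le (K := K) f.natDegree)).image (fun c => (∑ j, algebraMap K[X] F0 (c j) • b j) / algebraMap K[X] L f)).subset ?_
  intro w hw
  obtain ⟨o, ho⟩ := hw.2 _ (nf_mem (K := K) I)
  choose c hc using hcoord o
  rw [← IsScalarTower.algebraMap_apply K[X] O L] at ho
  refine ⟨c, ?_, ?_⟩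
  · intro j
    apply natDegree_le_of_LO
    rw [← iot_alg (F0 := F0), ← hc, ← ho]
    have h1 : MF K b (-f.natDegree) (algebraMap K[X] L f) := by
      rw [IsScalarTower.algebraMap_apply K[X] F0 L]
      apply MF.alg
      rw [iot_alg]
      exact iotP_LO f _ le_rfl
    have h2 := (hw.1.mul h1) j i0
    rw [Algebra.leftMulMatrix_eq_repr_mul, hi0, mul_one] at h2
    exact h2.mono (by omega)
  · simp only
    rw [div_eq_iff hf0, ho, ← b.sum_repr (algebraMap O L _)]
    refine Finset.sum_congr rfl fun j _ => ?_
    rw [hc]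

lemma inv_LO (f : K[X]) (hf : f.Monic) : LO f.natDegree (iotP K f)⁻¹ := by
  obtain ⟨s, hs, -, h⟩ := iotP_monic f hf
  refine ⟨PowerSeries.invOfUnit s 1, ?_⟩
  rw [inv_eq_iff_eq_inv, eq_comm]
  apply inv_eq_of_mul_eq_one_right
  rw [h]
  have : psl s * psl (PowerSeries.invOfUnit s 1) = 1 := by
    rw [psl, psl, ← map_mul, PowerSeries.mul_invOfUnit s 1 (by simpa using hs), map_one]
  have h2 := Tp_mul (K := K) f.natDegree (-f.natDegree)
  rw [add_neg_cancel, Tp_zero] at h2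
  linear_combination (Tp K f.natDegree * Tp K (-f.natDegree)) * this + h2

/-- pigeonhole -/
lemma exists_small [Finite K] [Algebra.IsSeparable (FractionRing K[X]) (FractionRing O)] (β : ι → O) (hβ : ∀ j, algebraMap O L (β j) = b j) (J : Ideal O) (hJ : J ≠ ⊥) (M : ℕ)
    (hM : (nf K J).natDegree < Fintype.card ι * M) :
    ∃ c : ι → K[X], (∀ j, (c j).degree < M) ∧ (∑ j, algebraMap K[X] O (c j) * β j) ∈ J ∧ (∑ j, algebraMap K[X] O (c j) * β j) ≠ 0 := by
  classical
  obtain ⟨hfin, hcard⟩ := card_le (K := K) J hJ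
  have : Finite (degreeLT K M) := Finite.of_equiv _ (Polynomial.degreeLTEquiv K M).symm.toEquiv
  let φ : (ι → degreeLT K M) → O ⧸ J := fun c => Ideal.Quotient.mk J (∑ j, algebraMap K[X] O (c j) * β j)
  have hcd : Nat.card (ι → degreeLT K M) = Nat.card K ^ (Fintype.card ι * M) := by
    rw [Nat.card_fun, Nat.card_congr (Polynomial.degreeLTEquiv K M).toEquiv, Nat.card_fun, Nat.card_fin, Nat.card_eq_fintype_card (α := ι), ← pow_mul, mul_comm]
  have hni : ¬ Function.Injective φ := by
    intro hi
    have h1 := Nat.card_le_card_of_injective φ hi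
    rw [hcd] at h1
    have h2 : Nat.card K ^ (nf K J).natDegree < Nat.card K ^ (Fintype.card ι * M) := Nat.pow_lt_pow_right Finite.one_lt_card hM
    omega
  rw [Function.Injective] at hni
  push Not at hni
  obtain ⟨c, c', he, hne⟩ := hni
  have hs : (∑ j, algebraMap K[X] O ((c j : K[X]) - c' j) * β j) = (∑ j, algebraMap K[X] O (c j) * β j) - ∑ j, algebraMap K[X] O (c' j) * β j := by
    rw [← Finset.sum_sub_distrib]
    exact Finset.sum_congr rfl fun j _ => by rw [map_sub, sub_mul]
  refine ⟨fun j => (c j : K[X]) - c' j, fun j => ?_, ?_, ?_⟩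
  · exact Polynomial.mem_degreeLT.1 ((degreeLT K M).sub_mem (c j).2 (c' j).2)
  · rw [hs]; exact Ideal.Quotient.eq.1 he
  · intro h0
    apply hne
    have h1 : ∑ j, algebraMap K[X] F0 ((c j : K[X]) - c' j) • b j = 0 := by
      have := congrArg (algebraMap O L) h0
      rw [map_zero, map_sum] at this
      rw [← this]
      refine Finset.sum_congr rfl fun j _ => ?_
      rw [map_mul, hβ, ← IsScalarTower.algebraMap_apply K[X] O L, IsScalarTower.algebraMap_apply K[X] F0 L, Algebra.smul_def]
    have h2 := Fintype.linearIndependent_iff.1 b.linearIndependent _ h1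
    ext1 j
    have h3 := h2 j
    rw [map_eq_zero_iff _ (IsFractionRing.injective K[X] F0), sub_eq_zero] at h3
    exact Subtype.ext h3

lemma exists_W [Finite K] [Algebra.IsSeparable (FractionRing K[X]) (FractionRing O)] (Δ : K[X]) (hΔ : Δ ≠ 0) (hint : ∀ j, ∃ o : O, algebraMap O L o = b j) (B : ℕ)
    (hMF : ∀ j, MF K b (-B) (b j)) (I : Ideal O) (hI : I ≠ ⊥) (hn : Fintype.card ι * (2 * B + Δ.natDegree) < (nf K I).natDegree) (a : K) :
    ∃ w ∈ WI K b (algebraMap K[X] O Δ) I, tau K F0 w = Fintype.card ι * a := by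
  have : Module.Finite F0 L := Module.Finite.of_basis b
  have hfr : Module.finrank F0 L = Fintype.card ι := Module.finrank_eq_card_basis b
  have hfr' : Module.finrank K[X] O = Fintype.card ι := by
    rw [← hfr]; exact (IsFractionRing.finrank_eq K[X] F0 O L).symm
  have hd : 0 < Fintype.card ι := by rw [← hfr]; exact Module.finrank_pos
  set f := nf K I with hf
  have hf0 : f ≠ 0 := nf_ne hI
  have hfF : algebraMap K[X] F0 f ≠ 0 := by simpa using hf0
  have hfL : algebraMap K[X] L f ≠ 0 := by
    rw [IsScalarTower.algebraMap_apply K[X] F0 L]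
    simpa using hf0
  choose β hβ using hint
  have hle : Ideal.span {algebraMap K[X] O (f * Δ)} ≤ I := by
    rw [Ideal.span_singleton_le_iff_mem, map_mul]
    exact I.mul_mem_right _ (nf_mem I)
  obtain ⟨J, hJ⟩ := Ideal.dvd_iff_le.2 hle
  have hs0 : Ideal.span {algebraMap K[X] O (f * Δ)} ≠ ⊥ := by
    rw [Ne, Ideal.span_singleton_eq_bot]
    rw [FaithfulSMul.algebraMap_eq_zero_iff]
    exact mul_ne_zero hf0 hΔ
  have hJ0 : J ≠ ⊥ := by rintro rfl; rw [Ideal.mul_bot] at hJ; exact hs0 hJ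
  have hdeg : f.natDegree + (nf K J).natDegree = Fintype.card ι * (f.natDegree + Δ.natDegree) := by
    have h1 := nf_alg (O := O) (f * Δ) (mul_ne_zero hf0 hΔ)
    rw [hJ, nf_mul hI hJ0, (nf_monic hI).natDegree_mul (nf_monic hJ0), natDegree_mul hf0 hΔ, hfr'] at h1
    exact h1
  obtain ⟨M, hM⟩ : ∃ M, f.natDegree = 2 * B + M + 1 := by
    refine ⟨f.natDegree - 2 * B - 1, ?_⟩
    have : 1 * (2 * B + Δ.natDegree) ≤ Fintype.card ι * (2 * B + Δ.natDegree) := Nat.mul_le_mul_right _ hd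
    omega
  have hlt : (nf K J).natDegree < Fintype.card ι * (M + 1) := by
    rw [show f.natDegree + Δ.natDegree = (M + 1) + (2 * B + Δ.natDegree) by omega, mul_add] at hdeg
    omega
  obtain ⟨c, hc, hcJ, hc0⟩ := exists_small (K := K) (b := b) β hβ J hJ0 (M + 1) hlt
  set v := ∑ j, algebraMap K[X] O (c j) * β j with hv
  have hvL : algebraMap O L v = ∑ j, algebraMap F0 L (algebraMap K[X] F0 (c j)) * b j := by
    rw [hv, map_sum]
    refine Finset.sum_congr rfl fun j _ => ?_
    rw [map_mul, hβ, ← IsScalarTower.algebraMap_apply K[X] O L, IsScalarTower.algebraMap_apply K[X] F0 L]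
  have hvMF : MF K b (-M - B) (algebraMap O L v) := by
    rw [hvL]
    refine MF.sum _ _ fun j _ => ?_
    refine ((MF.alg (N := -M) ?_).mul (hMF j)).mono (by omega)
    rw [iot_alg]
    refine iotP_LO _ _ ?_
    by_cases h : c j = 0
    · simp [h]
    · exact Nat.lt_succ_iff.1 ((natDegree_lt_iff_degree_lt h).2 (hc j))
  have hfMF : MF K b f.natDegree (algebraMap K[X] L f)⁻¹ := by
    rw [IsScalarTower.algebraMap_apply K[X] F0 L, ← map_inv₀]
    apply MF.alg
    rw [map_inv₀, iot_alg]
    exact inv_LO f (nf_monic hI)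
  set w0 := algebraMap O L v * (algebraMap K[X] L f)⁻¹ with hw0
  have hw00 : w0 ≠ 0 := mul_ne_zero (by simpa using hc0) (inv_ne_zero hfL)
  have hw0MF : MF K b (B + 1) w0 := (hvMF.mul hfMF).mono (by omega)
  have hw0I : ∀ i ∈ I, ∃ o : O, w0 * algebraMap O L i = algebraMap O L (algebraMap K[X] O Δ * o) := by
    intro i hi
    have h1 : i * v ∈ I * J := Ideal.mul_mem_mul hi hcJ
    rw [← hJ, Ideal.mem_span_singleton'] at h1
    obtain ⟨o, ho⟩ := h1
    refine ⟨o, ?_⟩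
    have h2 := congrArg (algebraMap O L) ho
    simp only [map_mul, ← IsScalarTower.algebraMap_apply K[X] O L] at h2 ⊢
    rw [hw0]
    field_simp
    linear_combination -h2
  set t : F0 := algebraMap K[X] F0 (C a) * (algebraMap K[X] F0 X)⁻¹ with ht
  have hti : iot K F0 t = HahnSeries.C a * Tp K 1 := by
    rw [ht, map_mul, map_inv₀, iot_alg, iot_alg]
    have h1 : iotP K X = Tp K (-1) := by simp [iotP]
    have h2 : (iotP K (X : K[X]))⁻¹ = Tp K 1 := by
      rw [h1]; exact inv_eq_of_mul_eq_one_right (by rw [Tp_mul]; exact Tp_zero)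
    rw [h2]; simp [iotP]
  have htLO : LO 1 (iot K F0 t) := ⟨PowerSeries.C a, by rw [hti, psl, HahnSeries.ofPowerSeries_C, mul_comm]⟩
  have hpp := fun j => exists_polypart (K := K) (b.repr (algebraMap F0 L t * w0⁻¹) j)
  choose ρ hρ using hpp
  set r := ∑ j, algebraMap F0 L (b.repr (algebraMap F0 L t * w0⁻¹) j - algebraMap K[X] F0 (ρ j)) * b j with hr
  have hrMF : MF K b (1 + -B) r := MF.sum _ _ fun j _ => (MF.alg (hρ j)).mul (hMF j)
  set w := w0 * algebraMap O L (∑ j, algebraMap K[X] O (ρ j) * β j) with hw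
  have hρL : algebraMap O L (∑ j, algebraMap K[X] O (ρ j) * β j) = ∑ j, algebraMap F0 L (algebraMap K[X] F0 (ρ j)) * b j := by
    rw [map_sum]
    refine Finset.sum_congr rfl fun j _ => ?_
    rw [map_mul, hβ, ← IsScalarTower.algebraMap_apply K[X] O L, IsScalarTower.algebraMap_apply K[X] F0 L]
  have hsum : r + algebraMap O L (∑ j, algebraMap K[X] O (ρ j) * β j) = algebraMap F0 L t * w0⁻¹ := by
    rw [hρL, hr, ← Finset.sum_add_distrib]
    conv_rhs => rw [← b.sum_repr (algebraMap F0 L t * w0⁻¹)]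
    refine Finset.sum_congr rfl fun j _ => ?_
    rw [Algebra.smul_def, ← add_mul, ← map_add, sub_add_cancel]
  have hwt : w = algebraMap F0 L t - w0 * r := by
    rw [hw, eq_sub_iff_add_eq, ← mul_add, add_comm, hsum]
    field_simp
  have h2 : MF K b 2 (w0 * r) := (hw0MF.mul hrMF).mono (by omega)
  refine ⟨w, ⟨?_, ?_⟩, ?_⟩
  · rw [hwt]; exact (MF.alg htLO).sub (h2.mono (by omega))
  · intro i hi
    obtain ⟨o, ho⟩ := hw0I i hi
    refine ⟨o * ∑ j, algebraMap K[X] O (ρ j) * β j, ?_⟩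
    rw [hw, ← mul_assoc, map_mul _ (_ * o), ← ho]
    ring
  · rw [tau, hwt, map_sub, map_sub, HahnSeries.coeff_sub, h2.trace.coeff (by norm_num), sub_zero, Algebra.trace_algebraMap, map_nsmul, hti, hfr, HahnSeries.coeff_nsmul]
    simp [Tp, HahnSeries.C_mul_eq_smul]
end

open Polynomial

section
variable {K : Type*} [Field K]
  {O : Type*} [CommRing O] [IsDedekindDomain O] [Algebra K[X] O] [Module.Finite K[X] O] [Module.IsTorsionFree K[X] O]

/-- degree of an ideal -/
noncomputable def dg (K : Type*) [Field K] [Algebra K[X] O] [Module.Finite K[X] O] [Module.IsTorsionFree K[X] O] (I : Ideal O) : ℕ := (nf K I).natDegree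

/-- character of an ideal -/
noncomputable def ps [Algebra K[X] O] [Module.Finite K[X] O] [Module.IsTorsionFree K[X] O] (χ : AddChar K ℂ) (I : Ideal O) : ℂ := χ (-(nf K I).nextCoeff)

lemma dg_mul {I J : Ideal O} (hI : I ≠ ⊥) (hJ : J ≠ ⊥) : dg K (I * J) = dg K I + dg K J := by
  rw [dg, nf_mul hI hJ, (nf_monic hI).natDegree_mul (nf_monic hJ)]; rfl

lemma dg_pow {I : Ideal O} (hI : I ≠ ⊥) (n : ℕ) : dg K (I ^ n) = n * dg K I := by
  rw [dg, nf_pow hI, (nf_monic hI).natDegree_pow]; rfl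

lemma ps_mul (χ : AddChar K ℂ) {I J : Ideal O} (hI : I ≠ ⊥) (hJ : J ≠ ⊥) : ps χ (I * J) = ps χ I * ps χ J := by
  rw [ps, nf_mul hI hJ, (nf_monic hI).nextCoeff_mul (nf_monic hJ), neg_add, AddChar.map_add_eq_mul]; rfl

lemma ps_top (χ : AddChar K ℂ) : ps χ (⊤ : Ideal O) = 1 := by
  rw [ps, nf_top, ← C_1, nextCoeff_C_eq_zero, neg_zero, AddChar.map_zero_eq_one]

lemma ps_pow (χ : AddChar K ℂ) {I : Ideal O} (hI : I ≠ ⊥) (n : ℕ) : ps χ (I ^ n) = ps χ I ^ n := by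
  induction n with
  | zero => rw [pow_zero, pow_zero, Ideal.one_eq_top, ps_top]
  | succ n ih => rw [pow_succ, pow_succ, ps_mul χ (pow_ne_zero n hI) hI, ih]

lemma dg_zero {I : Ideal O} (hI : I ≠ ⊥) (h : dg K I = 0) : I = ⊤ := by
  have := eq_one_of_monic_natDegree_zero (nf_monic (K := K) hI) h
  have h2 := nf_mem (K := K) I
  rw [this, map_one] at h2
  exact (Ideal.eq_top_iff_one _).2 h2

lemma dg_le {I J : Ideal O} (hJ : J ≠ ⊥) (h : I ∣ J) : dg K I ≤ dg K J := by
  obtain ⟨A, rfl⟩ := h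
  have h1 : I ≠ ⊥ := by rintro rfl; simp at hJ
  have h2 : A ≠ ⊥ := by rintro rfl; simp at hJ
  rw [dg_mul h1 h2]; omega

/-- primes coprime to δ of degree at most N -/
def PrS (K : Type*) [Field K] [Algebra K[X] O] [Module.Finite K[X] O] [Module.IsTorsionFree K[X] O] (δ : O) (N : ℕ) : Set (Ideal O) :=
  {P | P.IsMaximal ∧ P ≠ ⊥ ∧ P ⊔ Ideal.span {δ} = ⊤ ∧ dg K P ≤ N}

lemma PrS_finite [Finite K] (δ : O) (N : ℕ) : (PrS K δ N).Finite := by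
  refine ((Set.finite_Iic N).biUnion (t := fun n => Sn K δ n) (fun n _ => Sn_finite n)).subset ?_
  intro P hP
  simp only [Set.mem_iUnion]
  exact ⟨dg K P, hP.2.2.2, hP.2.1, hP.2.2.1, rfl⟩

/-- finset of primes -/
noncomputable def PrF (K : Type*) [Field K] [Algebra K[X] O] [Module.Finite K[X] O] [Module.IsTorsionFree K[X] O] [Finite K] (δ : O) (N : ℕ) : Finset (Ideal O) := (PrS_finite (K := K) δ N).toFinset

/-- finset of ideals -/
noncomputable def SnF (K : Type*) [Field K] [Algebra K[X] O] [Module.Finite K[X] O] [Module.IsTorsionFree K[X] O] [Finite K] (δ : O) (N : ℕ) : Finset (Ideal O) := (Sn_finite (K := K) (δ := δ) N).toFinset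

lemma mem_PrF [Finite K] {δ : O} {N : ℕ} {P : Ideal O} : P ∈ PrF K δ N ↔ P.IsMaximal ∧ P ≠ ⊥ ∧ P ⊔ Ideal.span {δ} = ⊤ ∧ dg K P ≤ N := by
  rw [PrF, Set.Finite.mem_toFinset]; rfl

lemma mem_SnF [Finite K] {δ : O} {N : ℕ} {P : Ideal O} : P ∈ SnF K δ N ↔ P ≠ ⊥ ∧ P ⊔ Ideal.span {δ} = ⊤ ∧ dg K P = N := by
  rw [SnF, Set.Finite.mem_toFinset]; rfl

lemma dg_pos {P : Ideal O} (hP : P.IsMaximal) (h0 : P ≠ ⊥) : 0 < dg K P := by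
  rcases Nat.eq_zero_or_pos (dg K P) with h | h
  · exact absurd (dg_zero h0 h) hP.ne_top
  · exact h

open UniqueFactorizationMonoid in
open Classical in
lemma dg_eq [Finite K] {δ : O} {N : ℕ} {I : Ideal O} (hI : I ∈ SnF K δ N) :
    dg K I = ∑ P ∈ PrF K δ N, ∑ j ∈ Finset.Icc 1 N, if P ^ j ∣ I then dg K P else 0 := by
  rw [mem_SnF] at hI
  obtain ⟨hI0, hc, hN⟩ := hI
  have h1 : ∀ P ∈ PrF K δ N, ∑ j ∈ Finset.Icc 1 N, (if P ^ j ∣ I then dg K P else 0) = (normalizedFactors I).count P * dg K P := by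
    intro P hP
    rw [mem_PrF] at hP
    have hPp : Prime P := Ideal.prime_of_isPrime hP.2.1 hP.1.isPrime
    have hiff : ∀ j, P ^ j ∣ I ↔ j ≤ (normalizedFactors I).count P := by
      intro j
      have := emultiplicity_eq_count_normalizedFactors hPp.irreducible hI0
      rw [normalize_eq] at this
      rw [pow_dvd_iff_le_emultiplicity, this]
      norm_cast
    have hle : (normalizedFactors I).count P ≤ N := by
      have := dg_le (K := K) hI0 ((hiff _).2 le_rfl)
      rw [dg_pow hP.2.1, hN] at this
      have := dg_pos (K := K) hP.1 hP.2.1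
      nlinarith
    rw [← Finset.sum_filter, Finset.sum_const, smul_eq_mul]
    congr 1
    have : (Finset.Icc 1 N).filter (fun j => P ^ j ∣ I) = Finset.Icc 1 ((normalizedFactors I).count P) := by
      ext j
      simp only [Finset.mem_filter, Finset.mem_Icc, hiff]
      omega
    rw [this]; simp
  rw [Finset.sum_congr rfl h1]
  have h2 : ∀ s : Multiset (Ideal O), (∀ P ∈ s, P ≠ ⊥) → s.prod ≠ ⊥ ∧ dg K s.prod = (s.map (dg K)).sum := by
    intro s
    induction s using Multiset.induction_on with
    | empty => intro _; simp only [Multiset.prod_zero, Ideal.one_eq_top]; exact ⟨top_ne_bot, by simp [dg, nf_top]⟩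
    | cons a s ih =>
      intro h
      have := ih (fun P hP => h P (Multiset.mem_cons_of_mem hP))
      rw [Multiset.prod_cons, Multiset.map_cons, Multiset.sum_cons, ← this.2]
      have ha := h a (Multiset.mem_cons_self a s)
      exact ⟨mul_ne_zero ha this.1, dg_mul ha this.1⟩
  have h3 := (h2 (normalizedFactors I) (fun P hP => (prime_of_normalized_factor P hP).ne_zero)).2
  rw [prod_normalizedFactors_eq_self hI0] at h3
  rw [h3, Finset.sum_multiset_map_count]
  simp only [smul_eq_mul]
  refine Finset.sum_subset ?_ ?_
  · intro P hP
    rw [Multiset.mem_toFinset] at hP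
    have hPp := prime_of_normalized_factor P hP
    have hd := dvd_of_mem_normalizedFactors hP
    rw [mem_PrF]
    refine ⟨(Ideal.isPrime_of_prime hPp).isMaximal hPp.ne_zero, hPp.ne_zero, ?_, (dg_le hI0 hd).trans hN.le⟩
    rw [eq_top_iff, ← hc]
    exact sup_le_sup_right (Ideal.dvd_iff_le.1 hd) _
  · intro P _ hP
    rw [Multiset.mem_toFinset] at hP
    rw [Multiset.count_eq_zero.2 hP, zero_mul]

/-- power sums -/
noncomputable def sR [Finite K] (χ : AddChar K ℂ) (δ : O) (r : ℕ) : ℂ := ∑ P ∈ (PrF K δ r).filter (fun P => dg K P ∣ r), (dg K P : ℂ) * ps χ P ^ (r / dg K P)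

/-- coefficients -/
noncomputable def aN [Finite K] (χ : AddChar K ℂ) (δ : O) (n : ℕ) : ℂ := ∑ I ∈ SnF K δ n, ps χ I

lemma aN_zero [Finite K] (χ : AddChar K ℂ) (δ : O) : aN χ δ 0 = 1 := by
  have : SnF K δ 0 = {⊤} := by
    ext I
    rw [mem_SnF, Finset.mem_singleton]
    constructor
    · rintro ⟨h, -, h2⟩; exact dg_zero h h2
    · rintro rfl; exact ⟨top_ne_bot, by simp, by simp [dg, nf_top]⟩
  rw [aN, this, Finset.sum_singleton, ps_top]

lemma cop_mul {A B D : Ideal O} : A * B ⊔ D = ⊤ ↔ A ⊔ D = ⊤ ∧ B ⊔ D = ⊤ := by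
  constructor
  · intro h
    constructor
    · rw [eq_top_iff, ← h]; exact sup_le_sup_right Ideal.mul_le_left _
    · rw [eq_top_iff, ← h]; exact sup_le_sup_right Ideal.mul_le_right _
  · rintro ⟨h1, h2⟩
    rw [← Ideal.isCoprime_iff_sup_eq] at *
    exact IsCoprime.mul_left h1 h2

lemma cop_pow {A D : Ideal O} (n : ℕ) (h : A ⊔ D = ⊤) : A ^ n ⊔ D = ⊤ := by
  rw [← Ideal.isCoprime_iff_sup_eq] at *
  exact IsCoprime.pow_left h

open Classical in
lemma recur [Finite K] (χ : AddChar K ℂ) (δ : O) (n : ℕ) : 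
    (n : ℂ) * aN χ δ n = ∑ x ∈ Finset.HasAntidiagonal.antidiagonal n, aN χ δ x.1 * (if x.2 = 0 then 0 else sR χ δ x.2) := by
  have hL : (n : ℂ) * aN χ δ n = ∑ t ∈ (SnF K δ n ×ˢ (PrF K δ n ×ˢ Finset.Icc 1 n)).filter (fun t => t.2.1 ^ t.2.2 ∣ t.1), ps χ t.1 * dg K t.2.1 := by
    rw [aN, Finset.mul_sum, Finset.sum_filter, Finset.sum_product]
    refine Finset.sum_congr rfl fun I hI => ?_
    have h1 := dg_eq hI
    rw [(mem_SnF.1 hI).2.2] at h1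
    rw [Finset.sum_product]
    conv_lhs => rw [h1]
    push_cast
    rw [Finset.sum_mul]
    refine Finset.sum_congr rfl fun P _ => ?_
    rw [Finset.sum_mul]
    refine Finset.sum_congr rfl fun j _ => ?_
    split_ifs <;> simp [mul_comm]
  have hR : ∑ x ∈ Finset.HasAntidiagonal.antidiagonal n, aN χ δ x.1 * (if x.2 = 0 then 0 else sR χ δ x.2) =
      ∑ t ∈ (Finset.HasAntidiagonal.antidiagonal n).sigma (fun x => SnF K δ x.1 ×ˢ ((PrF K δ x.2).filter (fun P => x.2 ≠ 0 ∧ dg K P ∣ x.2))),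
        ps χ t.2.1 * ((dg K t.2.2 : ℂ) * ps χ t.2.2 ^ (t.1.2 / dg K t.2.2)) := by
    rw [Finset.sum_sigma]
    refine Finset.sum_congr rfl fun x _ => ?_
    rw [Finset.sum_product, aN, Finset.sum_mul]
    refine Finset.sum_congr rfl fun I _ => ?_
    simp only
    rw [← Finset.mul_sum]
    congr 1
    split_ifs with h
    · simp [h]
    · simp [h, sR]
  rw [hL, hR]
  symm
  let qd : Ideal O → Ideal O → Ideal O := fun I J => if h : J ∣ I then Classical.choose h else ⊥
  have hqd : ∀ J A : Ideal O, J ≠ ⊥ → qd (J * A) J = A := by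
    intro J A hJ
    simp only [qd]
    rw [dif_pos (dvd_mul_right J A)]
    exact (mul_left_cancel₀ hJ (Classical.choose_spec (dvd_mul_right J A))).symm
  refine Finset.sum_bij' (fun t _ => (t.2.1 * t.2.2 ^ (t.1.2 / dg K t.2.2), t.2.2, t.1.2 / dg K t.2.2))
    (fun t ht => ⟨(n - t.2.2 * dg K t.2.1, t.2.2 * dg K t.2.1), qd t.1 (t.2.1 ^ t.2.2), t.2.1⟩) ?_ ?_ ?_ ?_ ?_
  · rintro ⟨⟨i, r⟩, I, P⟩ ht
    simp only [Finset.mem_sigma, Finset.HasAntidiagonal.mem_antidiagonal, Finset.mem_product, Finset.mem_filter, mem_SnF, mem_PrF, Finset.mem_Icc] at ht ⊢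
    obtain ⟨hir, ⟨hI0, hIc, rfl⟩, ⟨hPm, hP0, hPc, hPr⟩, hr0, j, rfl⟩ := ht
    have hp := dg_pos (K := K) hPm hP0
    rw [Nat.mul_div_cancel_left _ hp]
    have hj : 0 < j := by rcases Nat.eq_zero_or_pos j with rfl | h; simp at hr0; exact h
    refine ⟨⟨⟨mul_ne_zero hI0 (pow_ne_zero _ hP0), cop_mul.2 ⟨hIc, cop_pow _ hPc⟩, ?_⟩, ⟨hPm, hP0, hPc, by omega⟩, hj, by nlinarith⟩, dvd_mul_left _ _⟩
    rw [dg_mul hI0 (pow_ne_zero _ hP0), dg_pow hP0, ← hir, mul_comm]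
  · rintro ⟨I, P, j⟩ ht
    simp only [Finset.mem_sigma, Finset.HasAntidiagonal.mem_antidiagonal, Finset.mem_product, Finset.mem_filter, mem_SnF, mem_PrF, Finset.mem_Icc] at ht ⊢
    obtain ⟨⟨⟨hI0, hIc, hIn⟩, ⟨hPm, hP0, hPc, hPr⟩, hj, hjn⟩, A, rfl⟩ := ht
    have hp := dg_pos (K := K) hPm hP0
    have hA0 : A ≠ ⊥ := right_ne_zero_of_mul hI0
    rw [dg_mul (pow_ne_zero _ hP0) hA0, dg_pow hP0] at hIn
    rw [hqd _ _ (pow_ne_zero _ hP0)]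
    refine ⟨by omega, ⟨hA0, (cop_mul.1 hIc).2, by omega⟩, ⟨hPm, hP0, hPc, by nlinarith⟩, by positivity, dvd_mul_left _ _⟩
  · rintro ⟨⟨i, r⟩, I, P⟩ ht
    simp only [Finset.mem_sigma, Finset.HasAntidiagonal.mem_antidiagonal, Finset.mem_product, Finset.mem_filter, mem_SnF, mem_PrF, Finset.mem_Icc] at ht
    obtain ⟨hir, ⟨hI0, hIc, rfl⟩, ⟨hPm, hP0, hPc, hPr⟩, hr0, j, rfl⟩ := ht
    have hp := dg_pos (K := K) hPm hP0
    simp only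
    rw [Nat.mul_div_cancel_left _ hp, mul_comm j, mul_comm I, hqd _ _ (pow_ne_zero _ hP0)]
    have : n - dg K P * j = dg K I := by omega
    rw [this]
  · rintro ⟨I, P, j⟩ ht
    simp only [Finset.mem_product, Finset.mem_filter, mem_SnF, mem_PrF, Finset.mem_Icc] at ht
    obtain ⟨⟨⟨hI0, hIc, hIn⟩, ⟨hPm, hP0, hPc, hPr⟩, hj, hjn⟩, A, rfl⟩ := ht
    have hp := dg_pos (K := K) hPm hP0
    simp only
    rw [Nat.mul_div_cancel _ hp, mul_comm, hqd _ _ (pow_ne_zero _ hP0)]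
  · rintro ⟨⟨i, r⟩, I, P⟩ ht
    simp only [Finset.mem_sigma, Finset.HasAntidiagonal.mem_antidiagonal, Finset.mem_product, Finset.mem_filter, mem_SnF, mem_PrF] at ht ⊢
    obtain ⟨hir, ⟨hI0, hIc, rfl⟩, ⟨hPm, hP0, hPc, hPr⟩, hr0, j, rfl⟩ := ht
    rw [ps_mul χ hI0 (pow_ne_zero _ hP0), ps_pow χ hP0]
    ring
end

open Polynomial

section
variable {K : Type*} [Field K] [Fintype K] {kb : Type*} [Field kb] [IsAlgClosed kb] [Algebra K kb]
variable {F : Type*} [Field F] [Finite F] [Algebra K F]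

lemma field_dvd (r : ℕ) (h : ∀ z : F, z ^ (Fintype.card K ^ r) = z) : Module.finrank K F ∣ r := by
  rw [← FiniteField.orderOf_frobeniusAlgHom K F]
  apply orderOf_dvd_of_pow_eq_one
  ext z
  rw [AlgHom.coe_pow, FiniteField.coe_frobeniusAlgHom, pow_iterate]
  exact h z

lemma field_fix (z : F) : z ^ (Fintype.card K ^ Module.finrank K F) = z := by
  have := Fintype.ofFinite F
  rw [← Module.card_eq_pow_finrank (K := K) (V := F)]
  exact FiniteField.pow_card z

lemma field_tr (τ : F →ₐ[K] kb) (m : ℕ) (x : F) : trN K (Module.finrank K F * m) (τ x) = algebraMap K kb (m * Algebra.trace K F x) := by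
  have h1 : trN K (Module.finrank K F) (τ x) = algebraMap K kb (Algebra.trace K F x) := by
    rw [← τ.commutes, FiniteField.algebraMap_trace_eq_sum_pow, map_sum, trN]
    refine Finset.sum_congr rfl fun i _ => ?_
    rw [map_pow, Nat.card_eq_fintype_card]
  induction m with
  | zero => simp [trN]
  | succ m ih =>
    rw [Nat.mul_succ, trN, Finset.sum_range_add, ← trN, ih]
    have : ∑ i ∈ Finset.range (Module.finrank K F), (τ x) ^ (Fintype.card K ^ (Module.finrank K F * m + i)) = trN K (Module.finrank K F) (τ x) := by
      rw [trN]
      refine Finset.sum_congr rfl fun i _ => ?_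
      have h2 := frob_iter (K := K) (a := τ x) (n := Module.finrank K F) (by rw [← map_pow, field_fix]) m
      rw [pow_add, pow_mul, h2]
    rw [this, h1, ← map_add]
    push_cast; ring_nf
end

open Polynomial
section
attribute [local instance] FractionRing.liftAlgebra
variable {K : Type*} [Field K] [Fintype K]
  {O : Type*} [CommRing O] [IsDedekindDomain O] [Algebra K[X] O] [Module.Finite K[X] O] [Module.IsTorsionFree K[X] O]
  [Algebra K O] [IsScalarTower K K[X] O]
  [Algebra.IsSeparable (FractionRing K[X]) (FractionRing O)]

lemma quot_finrank (P : Ideal O) (hP : P.IsMaximal) (hP0 : P ≠ ⊥) : Module.finrank K (O ⧸ P) = dg K P := by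
  have h1 := card_prime (K := K) P hP hP0
  have := (card_le (K := K) P hP0).1
  have : Module.Finite K (O ⧸ P) := Module.Finite.of_finite
  rw [Module.natCard_eq_pow_finrank (K := K)] at h1
  exact Nat.pow_right_injective (Finite.one_lt_card (α := K)) h1

lemma ps_eq (χ : AddChar K ℂ) (P : Ideal O) (hP : P.IsMaximal) (hP0 : P ≠ ⊥) : ps χ P = χ (Algebra.trace K (O ⧸ P) (Ideal.Quotient.mk P (algebraMap K[X] O X))) := by
  letI := Ideal.Quotient.field P
  have h2 := quot_finrank (K := K) P hP hP0
  have hf := (card_le (K := K) P hP0).1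
  have : Module.Finite K (O ⧸ P) := Module.Finite.of_finite
  obtain ⟨π, hm, hi, hs, hn⟩ := nf_prime (K := K) P hP hP0
  set x := Ideal.Quotient.mk P (algebraMap K[X] O X) with hx
  have hmin : minpoly K x = π := by
    symm
    refine minpoly.eq_of_irreducible_of_monic hi ?_ hm
    have h3 : algebraMap K[X] O π ∈ P := by
      have : π ∈ P.under K[X] := by rw [hs]; exact Ideal.mem_span_singleton_self π
      exact this
    have h4 : aeval x π = Ideal.Quotient.mk P (algebraMap K[X] O π) := by
      have h5 : (Ideal.Quotient.mkₐ K P).comp (IsScalarTower.toAlgHom K K[X] O) = aeval x := by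
        ext; simp [hx]
      rw [← h5]; rfl
    rw [h4, Ideal.Quotient.eq_zero_iff_mem]; exact h3
  rw [ps, trace_eq_finrank_mul_minpoly_nextCoeff, hmin, hn, hm.nextCoeff_pow]
  have h6 : Module.finrank (IntermediateField.adjoin K {x}) (O ⧸ P) = P.inertiaDeg K[X] := by
    have h7 := Module.finrank_mul_finrank K (IntermediateField.adjoin K {x}) (O ⧸ P)
    rw [IntermediateField.adjoin.finrank (Algebra.IsIntegral.isIntegral x), hmin, h2, dg, hn, hm.natDegree_pow, mul_comm] at h7
    exact Nat.eq_of_mul_eq_mul_right hi.natDegree_pos h7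
  rw [h6]
  congr 1
  simp

variable {kb : Type*} [Field kb] [IsAlgClosed kb] [Algebra K kb]

/-- evaluation at a point -/
noncomputable def evh (K : Type*) [Field K] {kb : Type*} [Field kb] [Algebra K kb] (a b : kb) : K[X][X] →+* kb := eval₂RingHom (eval₂RingHom (algebraMap K kb) a) b

lemma evh_ev2 (a b : kb) (h : K[X][X]) : ev2 (h.map (mapRingHom (algebraMap K kb))) a b = evh K a b h := by
  have : ((evalRingHom b).comp (mapRingHom (evalRingHom a))).comp (mapRingHom (mapRingHom (algebraMap K kb))) = evh K a b := by
    ext <;> simp [evh]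
  rw [← this]; simp [ev2]

lemma Phi_evh {O : Type*} [CommRing O] [Algebra K[X] O] [Algebra K O] [IsScalarTower K K[X] O] (y : O) (Φ : O →ₐ[K] kb) (h : K[X][X]) : Φ (aeval y h) = evh K (Φ (algebraMap K[X] O X)) (Φ y) h := by
  have : (Φ : O →+* kb).comp (aeval y : K[X][X] →ₐ[K[X]] O).toRingHom = evh K (Φ (algebraMap K[X] O X)) (Φ y) := by
    ext u
    · simp only [evh, RingHom.comp_apply, AlgHom.toRingHom_eq_coe, RingHom.coe_coe, aeval_C, coe_eval₂RingHom, eval₂_C]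
      rw [← Polynomial.algebraMap_eq, ← IsScalarTower.algebraMap_apply K K[X] O, AlgHom.commutes]
    · simp [evh]
    · simp [evh]
  rw [← this]; rfl

lemma Phi_alg {O : Type*} [CommRing O] [Algebra K[X] O] [Algebra K O] [IsScalarTower K K[X] O] (Φ : O →ₐ[K] kb) (h : K[X]) : Φ (algebraMap K[X] O h) = eval₂ (algebraMap K kb) (Φ (algebraMap K[X] O X)) h := by
  have := Phi_evh (0 : O) Φ (C h)
  simpa [evh] using this

lemma exists_Phi {O : Type*} [CommRing O] [Algebra K[X] O] [Algebra K O] [IsScalarTower K K[X] O] {g : K[X][X]} {y : O} {Δ : K[X]} (hker : ∀ h, aeval y h = 0 → g ∣ h)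
    (hΔ : ∀ o : O, ∃ h : K[X][X], aeval y h = algebraMap K[X] O Δ * o) (a b : kb) (hg : evh K a b g = 0) (hd : eval₂ (algebraMap K kb) a Δ ≠ 0) :
    ∃ Φ : O →ₐ[K] kb, Φ (algebraMap K[X] O X) = a ∧ Φ y = b := by
  choose h hh using hΔ
  have hk : ∀ u, aeval y u = 0 → evh K a b u = 0 := by
    intro u hu
    obtain ⟨v, rfl⟩ := hker u hu
    rw [map_mul, hg, zero_mul]
  have hk2 : ∀ u v, aeval y u = aeval y v → evh K a b u = evh K a b v := by
    intro u v huv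
    have := hk (u - v) (by rw [map_sub, huv, sub_self])
    rwa [map_sub, sub_eq_zero] at this
  have hdC : evh K a b (C Δ) = eval₂ (algebraMap K kb) a Δ := by simp [evh]
  have hval : ∀ u (o : O), aeval y u = o → evh K a b (h o) / eval₂ (algebraMap K kb) a Δ = evh K a b u := by
    intro u o huo
    rw [div_eq_iff hd, ← hdC, ← map_mul]
    apply hk2
    rw [hh, map_mul, aeval_C, huo, mul_comm]
  let Φ : O →+* kb :=
    { toFun := fun o => evh K a b (h o) / eval₂ (algebraMap K kb) a Δ
      map_one' := by rw [hval 1 1 (by simp), map_one]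
      map_zero' := by rw [hval 0 0 (by simp), map_zero]
      map_add' := by
        intro o o'
        rw [← add_div, ← map_add]
        congr 1
        apply hk2
        rw [hh, map_add, hh, hh, mul_add]
      map_mul' := by
        intro o o'
        have : evh K a b (h (o * o')) * evh K a b (C Δ) = evh K a b (h o) * evh K a b (h o') := by
          rw [← map_mul, ← map_mul]
          apply hk2
          rw [map_mul, map_mul, hh, hh, hh, aeval_C]; ring
        rw [hdC] at this
        field_simp
        linear_combination this }
  refine ⟨{ Φ with commutes' := ?_ }, ?_, ?_⟩
  · intro c
    refine (hval (C (C c)) _ ?_).trans ?_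
    · rw [aeval_C, ← Polynomial.algebraMap_eq, ← IsScalarTower.algebraMap_apply K K[X] O]
    · simp [evh]
  · refine (hval (C X) _ (by simp)).trans (by simp [evh])
  · refine (hval X _ (by simp)).trans (by simp [evh])

lemma Phi_ext {O : Type*} [CommRing O] [Algebra K[X] O] [Algebra K O] [IsScalarTower K K[X] O] {y : O} {Δ : K[X]} 
    (hΔ : ∀ o : O, ∃ h : K[X][X], aeval y h = algebraMap K[X] O Δ * o) (Φ Ψ : O →ₐ[K] kb) (hd : Φ (algebraMap K[X] O Δ) ≠ 0)
    (h1 : Φ (algebraMap K[X] O X) = Ψ (algebraMap K[X] O X)) (h2 : Φ y = Ψ y) : Φ = Ψ := by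
  ext o
  obtain ⟨h, hh⟩ := hΔ o
  have e1 := Phi_evh y Φ h
  have e2 := Phi_evh y Ψ h
  have e3 : Φ (algebraMap K[X] O Δ) = Ψ (algebraMap K[X] O Δ) := by rw [Phi_alg Φ Δ, Phi_alg Ψ Δ, h1]
  rw [← h1, ← h2, ← e1, hh, map_mul, map_mul, ← e3] at e2
  exact (mul_left_cancel₀ hd e2).symm
end

open Polynomial
section
attribute [local instance] FractionRing.liftAlgebra
variable {K : Type*} [Field K] [Fintype K]
  {O : Type*} [CommRing O] [IsDedekindDomain O] [Algebra K[X] O] [Module.Finite K[X] O] [Module.IsTorsionFree K[X] O]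
  [Algebra K O] [IsScalarTower K K[X] O]
  [Algebra.IsSeparable (FractionRing K[X]) (FractionRing O)]
variable {kb : Type*} [Field kb] [IsAlgClosed kb] [Algebra K kb]

lemma Phi_fix {y : O} {Δ : K[X]} 
    (hΔ : ∀ o : O, ∃ h : K[X][X], aeval y h = algebraMap K[X] O Δ * o) (Φ : O →ₐ[K] kb) (hd : Φ (algebraMap K[X] O Δ) ≠ 0) (r : ℕ)
    (h1 : Φ (algebraMap K[X] O X) ^ (Fintype.card K ^ r) = Φ (algebraMap K[X] O X)) (h2 : Φ y ^ (Fintype.card K ^ r) = Φ y) (o : O) :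
    Φ o ^ (Fintype.card K ^ r) = Φ o := by
  let Ψ : O →ₐ[K] kb := { (frobHom K kb r).comp (Φ : O →+* kb) with
    commutes' := by
      intro c
      change Φ (algebraMap K O c) ^ (Fintype.card K ^ r) = _
      rw [AlgHom.commutes, ← map_pow, FiniteField.pow_card_pow] }
  have : Φ = Ψ := Phi_ext hΔ Φ Ψ hd h1.symm h2.symm
  exact (DFunLike.congr_fun this o).symm

lemma mem_ptsD {n : ℕ} (hn : 0 < n) (D : kb[X]) (G : kb[X][X]) (s : kb × kb) : s ∈ ptsD K n D G ↔ (s.1 ^ (Fintype.card K ^ n) = s.1 ∧ s.2 ^ (Fintype.card K ^ n) = s.2) ∧ ev2 G s.1 s.2 = 0 ∧ D.eval s.1 ≠ 0 := by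
  unfold ptsD; simp only [Finset.mem_filter, Finset.mem_product, mem_Kn hn]

open Classical in
theorem sR_eq (χ : AddChar K ℂ) {g : K[X][X]} {y : O} {Δ : K[X]} (hgy : aeval y g = 0) (hker : ∀ h, aeval y h = 0 → g ∣ h)
    (hΔ : ∀ o : O, ∃ h : K[X][X], aeval y h = algebraMap K[X] O Δ * o) (r : ℕ) (hr : 0 < r) :
    sR χ (algebraMap K[X] O Δ) r = sumD (kb := kb) χ r (Δ.map (algebraMap K kb)) (g.map (mapRingHom (algebraMap K kb))) := by
  set δ := algebraMap K[X] O Δ with hδ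
  set Pts := ptsD (kb := kb) K r (Δ.map (algebraMap K kb)) (g.map (mapRingHom (algebraMap K kb))) with hPts
  have hmem : ∀ s, s ∈ Pts ↔ (s.1 ^ (Fintype.card K ^ r) = s.1 ∧ s.2 ^ (Fintype.card K ^ r) = s.2) ∧ evh K s.1 s.2 g = 0 ∧ eval₂ (algebraMap K kb) s.1 Δ ≠ 0 := by
    intro s
    rw [hPts, mem_ptsD hr, evh_ev2, eval_map]
  let kr : kb × kb → Ideal O := fun s => if h : ∃ Φ : O →ₐ[K] kb, Φ (algebraMap K[X] O X) = s.1 ∧ Φ y = s.2 then RingHom.ker (Classical.choose h) else ⊥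
  have hkr : ∀ (Φ : O →ₐ[K] kb) (s : kb × kb), Φ δ ≠ 0 → Φ (algebraMap K[X] O X) = s.1 → Φ y = s.2 → kr s = RingHom.ker Φ := by
    intro Φ s hd h1 h2
    have hex : ∃ Φ : O →ₐ[K] kb, Φ (algebraMap K[X] O X) = s.1 ∧ Φ y = s.2 := ⟨Φ, h1, h2⟩
    simp only [kr]
    rw [dif_pos hex]
    have hsp := Classical.choose_spec hex
    rw [Phi_ext hΔ Φ (Classical.choose hex) hd (h1.trans hsp.1.symm) (h2.trans hsp.2.symm)]
  have hPhi : ∀ s ∈ Pts, ∃ Φ : O →ₐ[K] kb, Φ δ ≠ 0 ∧ Φ (algebraMap K[X] O X) = s.1 ∧ Φ y = s.2 := by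
    intro s hs
    rw [hmem] at hs
    obtain ⟨Φ, h1, h2⟩ := exists_Phi hker hΔ s.1 s.2 hs.2.1 hs.2.2
    refine ⟨Φ, ?_, h1, h2⟩
    rw [hδ, Phi_alg, h1]; exact hs.2.2
  have hmaps : ∀ s ∈ Pts, kr s ∈ (PrF K δ r).filter (fun P => dg K P ∣ r) := by
    intro s hs
    obtain ⟨Φ, hd, h1, h2⟩ := hPhi s hs
    rw [hkr Φ s hd h1 h2]
    rw [hmem] at hs
    have hfix := Phi_fix hΔ Φ hd r (by rw [h1]; exact hs.1.1) (by rw [h2]; exact hs.1.2)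
    have hpr : (RingHom.ker Φ).IsPrime := RingHom.ker_isPrime Φ
    have hne : RingHom.ker Φ ≠ ⊥ := by
      intro h
      have h3 : algebraMap K[X] O (X ^ (Fintype.card K ^ r) - X) ∈ RingHom.ker Φ := by
        rw [RingHom.mem_ker, map_sub, map_pow, map_sub, map_pow, hfix, sub_self]
      rw [h, Ideal.mem_bot, FaithfulSMul.algebraMap_eq_zero_iff] at h3
      exact FiniteField.X_pow_card_sub_X_ne_zero K (qn_gt hr) h3
    have hmx := hpr.isMaximal hne
    have hdv : dg K (RingHom.ker Φ) ∣ r := by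
      rw [← quot_finrank (K := K) _ hmx hne]
      letI := Ideal.Quotient.field (RingHom.ker Φ)
      have := (card_le (K := K) _ hne).1
      apply field_dvd
      intro z
      obtain ⟨z, rfl⟩ := Ideal.Quotient.mk_surjective z
      rw [← map_pow, Ideal.Quotient.eq, RingHom.mem_ker, map_sub, map_pow, hfix, sub_self]
    rw [Finset.mem_filter, mem_PrF]
    refine ⟨⟨hmx, hne, ?_, Nat.le_of_dvd hr hdv⟩, hdv⟩
    refine hmx.1.2 _ (lt_of_le_of_ne le_sup_left ?_)
    intro h
    apply hd
    rw [← RingHom.mem_ker, h]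
    exact Ideal.mem_sup_right (Ideal.mem_span_singleton_self δ)
  rw [sR, sumD, ← hPts, ← Finset.sum_fiberwise_of_maps_to hmaps]
  refine Finset.sum_congr rfl fun P hP => ?_
  rw [Finset.mem_filter, mem_PrF] at hP
  obtain ⟨⟨hmx, hne, hcop, -⟩, m, hm⟩ := hP
  letI := Ideal.Quotient.field P
  have hfin := (card_le (K := K) P hne).1
  have : Module.Finite K (O ⧸ P) := Module.Finite.of_finite
  have hfr := quot_finrank (K := K) P hmx hne
  have hdP : δ ∉ P := by
    intro h
    have : P ⊔ Ideal.span {δ} = P := sup_eq_left.2 ((Ideal.span_singleton_le_iff_mem _).2 h)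
    rw [this] at hcop
    exact hmx.ne_top hcop
  set x := Ideal.Quotient.mk P (algebraMap K[X] O X) with hx
  have key : ∑ τ : (O ⧸ P) →ₐ[K] kb, chx χ (trN K r (τ x)) = ∑ s ∈ Pts.filter (fun s => kr s = P), chx χ (trN K r s.1) := by
    refine Finset.sum_bij (fun τ _ => (τ x, τ (Ideal.Quotient.mk P y))) ?_ ?_ ?_ ?_
    · intro τ _
      have hd : (τ.comp (Ideal.Quotient.mkₐ K P)) δ ≠ 0 := by
        simp only [AlgHom.comp_apply, Ideal.Quotient.mkₐ_eq_mk]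
        rw [Ne, map_eq_zero, Ideal.Quotient.eq_zero_iff_mem]
        exact hdP
      have hfx : ∀ z, (τ z) ^ (Fintype.card K ^ r) = τ z := by
        intro z
        rw [hm, ← hfr]
        exact frob_iter (by rw [← map_pow, field_fix]) m
      have e1 := Phi_evh y (τ.comp (Ideal.Quotient.mkₐ K P)) g
      rw [hgy, map_zero] at e1
      have e2 := Phi_alg (τ.comp (Ideal.Quotient.mkₐ K P)) Δ
      rw [Finset.mem_filter, hmem]
      refine ⟨⟨⟨hfx _, hfx _⟩, e1.symm, ?_⟩, ?_⟩
      · rw [e2] at hd; exact hd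
      · rw [hkr (τ.comp (Ideal.Quotient.mkₐ K P)) _ hd rfl rfl]
        ext o
        rw [RingHom.mem_ker]
        simp only [AlgHom.comp_apply, Ideal.Quotient.mkₐ_eq_mk]
        rw [map_eq_zero, Ideal.Quotient.eq_zero_iff_mem]
    · intro τ _ τ' _ h
      rw [Prod.mk.injEq] at h
      have hd : (τ.comp (Ideal.Quotient.mkₐ K P)) δ ≠ 0 := by
        simp only [AlgHom.comp_apply, Ideal.Quotient.mkₐ_eq_mk]
        rw [Ne, map_eq_zero, Ideal.Quotient.eq_zero_iff_mem]
        exact hdP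
      exact Ideal.Quotient.algHom_ext _ (Phi_ext hΔ _ _ hd h.1 h.2)
    · intro s hs
      rw [Finset.mem_filter] at hs
      obtain ⟨Φ, hd, h1, h2⟩ := hPhi s hs.1
      have hk := hkr Φ s hd h1 h2
      rw [hs.2] at hk
      refine ⟨Ideal.Quotient.liftₐ P Φ (fun a ha => by rw [hk] at ha; exact ha), Finset.mem_univ _, ?_⟩
      exact Prod.ext h1 h2
    · intro τ _; rfl
  rw [← key, ps_eq χ P hmx hne, hm, Nat.mul_div_cancel_left _ (dg_pos hmx hne)]
  have hterm : ∀ τ : (O ⧸ P) →ₐ[K] kb, chx χ (trN K (dg K P * m) (τ x)) = χ (Algebra.trace K (O ⧸ P) x) ^ m := by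
    intro τ
    rw [← hfr, field_tr, chx_alg, ← nsmul_eq_mul, AddChar.map_nsmul_eq_pow]
  rw [Finset.sum_congr rfl (fun τ _ => hterm τ), Finset.sum_const, nsmul_eq_mul, Finset.card_univ, AlgHom.card, hfr]
end

open Polynomial
section
attribute [local instance] FractionRing.liftAlgebra

section
variable {K : Type*} [Field K] {F0 : Type*} [Field F0] [Algebra K[X] F0] [IsFractionRing K[X] F0]
  {L : Type*} [Field L] [Algebra F0 L] [Algebra K[X] L] [IsScalarTower K[X] F0 L] {g : K[X][X]} {η : L}
  {b : Module.Basis (Fin g.natDegree) F0 L}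

lemma repr_aeval (hm : g.Monic) (hg : aeval η g = 0) (hb : ∀ i, b i = η ^ (i : ℕ)) (h : K[X][X]) (j : Fin g.natDegree) :
    b.repr (aeval η h) j = algebraMap K[X] F0 ((h %ₘ g).coeff j) := by
  have h1 : aeval η h = aeval η (h %ₘ g) := by
    conv_lhs => rw [← modByMonic_add_div h g]
    rw [map_add, map_mul, hg, zero_mul, add_zero]
  have hd : 0 < g.natDegree := j.pos
  have h2 : (h %ₘ g).natDegree < g.natDegree := natDegree_modByMonic_lt _ hm (by rintro rfl; simp at hd)
  have h3 : aeval η (h %ₘ g) = ∑ i : Fin g.natDegree, algebraMap K[X] F0 ((h %ₘ g).coeff i) • b i := by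
    rw [aeval_eq_sum_range' h2, Finset.sum_range]
    refine Finset.sum_congr rfl fun i _ => ?_
    rw [hb, algebraMap_smul]
  rw [h1, h3, b.repr_sum_self]

lemma MF_gen (hm : g.Monic) (hg : aeval η g = 0) (hb : ∀ i, b i = η ^ (i : ℕ)) (B : ℕ) (hB : ∀ i, (g.coeff i).natDegree ≤ B) :
    MF K b (-B) η := by
  intro i j
  rw [Algebra.leftMulMatrix_eq_repr_mul, hb, ← pow_succ']
  have : η ^ ((j : ℕ) + 1) = aeval η (X ^ ((j : ℕ) + 1) : K[X][X]) := by simp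
  rw [this, repr_aeval hm hg hb, iot_alg]
  refine iotP_LO _ _ ?_
  by_cases hj : (j : ℕ) + 1 < g.natDegree
  · rw [(modByMonic_eq_self_iff hm).2]
    · rw [coeff_X_pow]; split_ifs <;> simp
    · rw [degree_X_pow, degree_eq_natDegree hm.ne_zero]; exact_mod_cast hj
  · have hj : (j : ℕ) + 1 = g.natDegree := by have := j.2; omega
    rw [hj]
    have : (X ^ g.natDegree : K[X][X]) %ₘ g = X ^ g.natDegree - g := by
      have h1 := div_modByMonic_unique (f := (X ^ g.natDegree : K[X][X])) (g := g) 1 (X ^ g.natDegree - g) hm ⟨by ring, ?_⟩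
      · exact h1.2
      · have := degree_sub_lt (p := (X ^ g.natDegree : K[X][X])) (q := g) (by rw [degree_X_pow, degree_eq_natDegree hm.ne_zero]) (by simp) (by rw [hm.leadingCoeff, (monic_X_pow _).leadingCoeff])
        rwa [degree_X_pow, ← degree_eq_natDegree hm.ne_zero] at this
    rw [this, coeff_sub, coeff_X_pow, if_neg (by have := i.2; omega), zero_sub, natDegree_neg]
    exact hB _

lemma MF_aeval (hm : g.Monic) (hg : aeval η g = 0) (hb : ∀ i, b i = η ^ (i : ℕ)) (B : ℕ) (hB : ∀ i, (g.coeff i).natDegree ≤ B)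
    (h : K[X][X]) (M : ℕ) (hd : h.natDegree ≤ M) (hh : ∀ i, (h.coeff i).natDegree ≤ B) : MF K b (-(B * (M + 1) : ℕ)) (aeval η h) := by
  rw [aeval_eq_sum_range]
  refine MF.sum _ _ fun i hi => ?_
  rw [Algebra.smul_def, IsScalarTower.algebraMap_apply K[X] F0 L]
  refine ((MF.alg (e := algebraMap K[X] F0 (h.coeff i)) (N := -B) ?_).mul ((MF_gen hm hg hb B hB).pow i)).mono ?_
  · rw [iot_alg]; exact iotP_LO _ _ (hh i)
  · have : i ≤ M := by have := Finset.mem_range.1 hi; omega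
    push_cast
    nlinarith [(by exact_mod_cast this : (i:ℤ) ≤ M), (by positivity : (0:ℤ) ≤ B)]
end

section
variable {K : Type*} [Field K] [Fintype K]
  {O : Type*} [CommRing O] [IsDedekindDomain O] [Algebra K[X] O] [Module.Finite K[X] O] [Module.IsTorsionFree K[X] O]
  [Algebra K O] [IsScalarTower K K[X] O]
  [Algebra.IsSeparable (FractionRing K[X]) (FractionRing O)]
variable {kb : Type*} [Field kb] [IsAlgClosed kb] [Algebra K kb] [Algebra.IsAlgebraic K kb]
  {F0 : Type*} [Field F0] [Algebra K[X] F0] [IsFractionRing K[X] F0]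
  {L : Type*} [Field L] [Algebra F0 L]
  [Algebra O L] [IsFractionRing O L] [Algebra K[X] L] [IsScalarTower K[X] F0 L] [IsScalarTower K[X] O L]

theorem abs_bound (p : ℕ) [Fact p.Prime] [CharP K p] [CharP kb p] (χ : AddChar K ℂ) (hχ : χ ≠ 0) {g : K[X][X]} {y : O} {Δ : K[X]} (hΔ0 : Δ ≠ 0)
    (hm : g.Monic) (hdp : 0 < g.natDegree) (hd : g.natDegree < p)
    (hgy : aeval y g = 0) (hker : ∀ h, aeval y h = 0 → g ∣ h)
    (hΔ : ∀ o : O, ∃ h : K[X][X], aeval y h = algebraMap K[X] O Δ * o)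
    (b : Module.Basis (Fin g.natDegree) F0 L) (hb : ∀ i, b i = algebraMap O L y ^ (i : ℕ))
    (B : ℕ) (hB : ∀ i, (g.coeff i).natDegree ≤ B)
    (hgood : Good (Δ.map (algebraMap K kb)) (g.map (mapRingHom (algebraMap K kb)))) :
    ‖sumD (kb := kb) χ 1 (Δ.map (algebraMap K kb)) (g.map (mapRingHom (algebraMap K kb)))‖ ≤ 
      (g.natDegree * (2 * (B * g.natDegree) + Δ.natDegree) : ℕ) * Real.sqrt (Fintype.card K) := by
  have hgη : aeval (algebraMap O L y) g = 0 := by rw [aeval_algebraMap_apply, hgy, map_zero]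
  have hinj : Function.Injective (mapRingHom (algebraMap K kb)) := map_injective _ (algebraMap K kb).injective
  have hmG : (g.map (mapRingHom (algebraMap K kb))).Monic := hm.map _
  have hdG : (g.map (mapRingHom (algebraMap K kb))).natDegree = g.natDegree := hm.natDegree_map _
  have hD0 : Δ.map (algebraMap K kb) ≠ 0 := (Polynomial.map_ne_zero_iff (algebraMap K kb).injective).2 hΔ0
  obtain ⟨n0, hn0, C, hC⟩ := sum_all p χ hχ (Δ.map (algebraMap K kb)) hD0 _ (g.map (mapRingHom (algebraMap K kb))) rfl hmG (by rw [hdG]; exact hd) hgood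
  rw [← sR_eq (kb := kb) χ hgy hker hΔ 1 one_pos]
  refine lfun_bound _ (aN χ (algebraMap K[X] O Δ)) _ (aN_zero _ _) ?_ (recur _ _) (Fintype.card K) (by exact_mod_cast Fintype.card_pos) n0 hn0 C ?_
  · intro n hn
    have := sum_zero (b := b) χ n (WI_finite Δ ?_ ?_) (δ := algebraMap K[X] O Δ) ?_
    · rw [aN]; exact this
    · intro o j
      obtain ⟨h, hh⟩ := hΔ o
      rw [← hh, ← aeval_algebraMap_apply, repr_aeval hm hgη hb]
      exact ⟨_, rfl⟩
    · exact ⟨⟨0, hdp⟩, by rw [hb]; simp⟩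
    · rintro I ⟨hI, -, hIn⟩
      have hcard : (g.natDegree : K) ≠ 0 := by
        rw [Ne, CharP.cast_eq_zero_iff K p]
        exact Nat.not_dvd_of_pos_of_lt hdp hd
      obtain ⟨c, hc⟩ := AddChar.ne_zero_iff.1 hχ
      have hMFb : ∀ j, MF K b (-(B * g.natDegree : ℕ)) (b j) := by
        intro j
        rw [hb]
        refine ((MF_gen hm hgη hb B hB).pow j).mono ?_
        have := j.2
        push_cast
        nlinarith [(by exact_mod_cast this : ((j : ℕ) : ℤ) < g.natDegree), (by positivity : (0:ℤ) ≤ B)]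
      have hlt : Fintype.card (Fin g.natDegree) * (2 * (B * g.natDegree) + Δ.natDegree) < (nf K I).natDegree := by
        rw [hIn, Fintype.card_fin]; exact hn
      obtain ⟨w, hw, ht⟩ := exists_W (K := K) (b := b) Δ hΔ0 (fun j => ⟨y ^ (j : ℕ), by rw [hb, map_pow]⟩) (B * g.natDegree) hMFb I hI hlt (-c / g.natDegree)
      refine ⟨w, hw, ?_⟩
      rw [ht, Fintype.card_fin, mul_div_cancel₀ _ hcard, neg_neg]; exact hc
  · intro m hm'
    rw [sR_eq (kb := kb) χ hgy hker hΔ _ (Nat.mul_pos hn0 hm')]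
    exact hC m hm'
end
end

open Polynomial

lemma sep_of_pb {F L : Type*} [Field F] [Field L] [Algebra F L] (pb : PowerBasis F L) (hgs : IsSeparable F pb.gen) : Algebra.IsSeparable F L := by
  have h1 := (IntermediateField.isSeparable_adjoin_simple_iff_isSeparable F L).2 hgs
  have htop : IntermediateField.adjoin F {pb.gen} = ⊤ := IntermediateField.adjoin_eq_top_of_algebra F _ pb.adjoin_gen_eq_top
  rw [htop] at h1
  exact AlgEquiv.Algebra.isSeparable (IntermediateField.topEquiv (F := F) (E := L))

section
attribute [local instance] FractionRing.liftAlgebra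

section
variable {K : Type*} [Field K] [Fintype K]
  {O : Type*} [CommRing O] [IsDedekindDomain O] [Algebra K[X] O] [Module.Finite K[X] O] [Module.IsTorsionFree K[X] O]
  [Algebra K O] [IsScalarTower K K[X] O]
variable {kb : Type*} [Field kb] [IsAlgClosed kb] [Algebra K kb] [Algebra.IsAlgebraic K kb]
  {L : Type*} [Field L] [Algebra (FractionRing K[X]) L]
  [Algebra O L] [IsFractionRing O L] [Algebra K[X] L] [IsScalarTower K[X] (FractionRing K[X]) L] [IsScalarTower K[X] O L]

theorem conc_bound (p : ℕ) [Fact p.Prime] [CharP K p] [CharP kb p] (χ : AddChar K ℂ) (hχ : χ ≠ 0) {g : K[X][X]} {y : O}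
    [Algebra.IsSeparable (FractionRing K[X]) L]
    (hm : g.Monic) (hdp : 0 < g.natDegree) (hd : g.natDegree < p)
    (pb : PowerBasis (FractionRing K[X]) L) (hpb : pb.gen = algebraMap O L y)
    (hmin : minpoly (FractionRing K[X]) (algebraMap O L y) = g.map (algebraMap K[X] (FractionRing K[X])))
    (B : ℕ) (hB : ∀ i, (g.coeff i).natDegree ≤ B) :
    ∃ Δ : K[X], Δ ≠ 0 ∧ Δ.natDegree ≤ g.natDegree * (B * (g.natDegree + 1)) ∧
      ‖sumD (kb := kb) χ 1 (Δ.map (algebraMap K kb)) (g.map (mapRingHom (algebraMap K kb)))‖ ≤ 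
      (g.natDegree * (2 * (B * g.natDegree) + Δ.natDegree) : ℕ) * Real.sqrt (Fintype.card K) := by
  have : FiniteDimensional (FractionRing K[X]) L := pb.finite
  have hsep : Algebra.IsSeparable (FractionRing K[X]) (FractionRing O) := by
    have H : RingHom.comp (algebraMap (FractionRing K[X]) (FractionRing O))
      ↑(FractionRing.algEquiv K[X] (FractionRing K[X])).symm.toRingEquiv =
        RingHom.comp ↑(FractionRing.algEquiv O L).symm.toRingEquiv (algebraMap (FractionRing K[X]) L) := by
      apply IsLocalization.ringHom_ext (nonZeroDivisors K[X])
      ext x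
      all_goals
        simp only [RingHom.coe_comp, RingHom.coe_coe,
          AlgEquiv.coe_ringEquiv, Function.comp_apply, AlgEquiv.commutes,
          ← IsScalarTower.algebraMap_apply]
        rw [IsScalarTower.algebraMap_apply K[X] O L, AlgEquiv.commutes, ← IsScalarTower.algebraMap_apply]
    exact Algebra.IsSeparable.of_equiv_equiv _ _ H
  have hinjA : Function.Injective (algebraMap K[X] (FractionRing K[X])) := IsFractionRing.injective _ _
  have hinjO : Function.Injective (algebraMap O L) := IsFractionRing.injective _ _
  have hcomm : ∀ h : K[X][X], algebraMap O L (aeval y h) = aeval (algebraMap O L y) (h.map (algebraMap K[X] (FractionRing K[X]))) := by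
    intro h
    rw [aeval_map_algebraMap, aeval_algebraMap_apply]
  have hgy : aeval y g = 0 := by
    apply hinjO
    rw [hcomm, ← hmin, minpoly.aeval, map_zero]
  have hker : ∀ h, aeval y h = 0 → g ∣ h := by
    intro h hh
    have h1 := congrArg (algebraMap O L) hh
    rw [hcomm, map_zero] at h1
    have h2 := minpoly.dvd _ _ h1
    rw [hmin] at h2
    exact (map_dvd_map _ hinjA hm).1 h2
  set z : O := aeval y (derivative g) with hz
  have hz1 : algebraMap O L z = aeval pb.gen (derivative (minpoly (FractionRing K[X]) pb.gen)) := by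
    rw [hz, hcomm, hpb, hmin, derivative_map]
  set Δ : K[X] := Algebra.intNorm K[X] O z with hΔd
  have hΔ1 : algebraMap K[X] (FractionRing K[X]) Δ = Algebra.norm (FractionRing K[X]) (algebraMap O L z) := Algebra.algebraMap_intNorm ..
  have hdisc := Algebra.discr_powerBasis_eq_norm (FractionRing K[X]) pb
  rw [← hz1, ← hΔ1] at hdisc
  have hΔ0 : Δ ≠ 0 := by
    intro h0
    rw [h0, map_zero, mul_zero] at hdisc
    exact Algebra.discr_not_zero_of_basis _ pb.basis hdisc
  have hdim : pb.dim = g.natDegree := by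
    rw [← pb.natDegree_minpoly, hpb, hmin, hm.natDegree_map]
  let b : Module.Basis (Fin g.natDegree) (FractionRing K[X]) L := pb.basis.reindex (finCongr hdim)
  have hb : ∀ i, b i = algebraMap O L y ^ (i : ℕ) := by
    intro i
    simp [b, hpb]
  have hgη : aeval (algebraMap O L y) g = 0 := by rw [aeval_algebraMap_apply, hgy, map_zero]
  have hΔ : ∀ o : O, ∃ h : K[X][X], aeval y h = algebraMap K[X] O Δ * o := by
    intro o
    have h1 : IsIntegral K[X] (algebraMap O L o) := (Algebra.IsIntegral.isIntegral o).algebraMap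
    have h2 : IsIntegral K[X] pb.gen := by rw [hpb]; exact (Algebra.IsIntegral.isIntegral y).algebraMap
    have h3 := Algebra.discr_mul_isIntegral_mem_adjoin (FractionRing K[X]) h2 h1
    rw [hdisc, hpb, Algebra.adjoin_singleton_eq_range_aeval] at h3
    obtain ⟨h, hh⟩ := h3
    refine ⟨(-1) ^ (Module.finrank (FractionRing K[X]) L * (Module.finrank (FractionRing K[X]) L - 1) / 2) * h, ?_⟩
    apply hinjO
    have e : ∀ n : ℕ, ((-1 : L) ^ n * (-1) ^ n) = 1 := by intro n; rw [← mul_pow]; simp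
    rw [← aeval_algebraMap_apply, map_mul, map_mul]
    have hh' : aeval (algebraMap O L y) h = _ := hh
    rw [hh', Algebra.smul_def]
    simp only [map_mul, map_pow, map_neg, map_one]
    rw [← mul_assoc, ← mul_assoc, e, one_mul, ← IsScalarTower.algebraMap_apply, ← IsScalarTower.algebraMap_apply]
  have hgood : Good (Δ.map (algebraMap K kb)) (g.map (mapRingHom (algebraMap K kb))) := by
    intro x c hx hg hg'
    rw [derivative_map] at hg'
    rw [evh_ev2] at hg hg'
    rw [eval_map] at hx
    obtain ⟨Φ, h1, h2⟩ := exists_Phi hker hΔ x c hg hx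
    obtain ⟨w, hw⟩ := Algebra.dvd_algebraMap_intNorm_self K[X] O z
    apply hx
    rw [← h1, ← Phi_alg Φ Δ, hΔd, hw, map_mul, hz, Phi_evh, h1, h2, hg', zero_mul]
  refine ⟨Δ, hΔ0, ?_, abs_bound p χ hχ hΔ0 hm hdp hd hgy hker hΔ b hb B hB hgood⟩
  apply natDegree_le_of_LO
  rw [← iot_alg (F0 := FractionRing K[X]), hΔ1, hz, ← aeval_algebraMap_apply]
  have h1 : ∀ i, ((derivative g).coeff i).natDegree ≤ B := by
    intro i
    rw [coeff_derivative]
    refine (natDegree_mul_le).trans ?_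
    have : ((i : K[X]) + 1).natDegree = 0 := by
      have := natDegree_natCast (R := K) (i + 1)
      push_cast at this; exact this
    rw [this, add_zero]; exact hB _
  have := (MF_aeval hm hgη hb B hB (derivative g) g.natDegree ((natDegree_derivative_le g).trans (Nat.sub_le _ _)) h1).norm
  rw [Fintype.card_fin] at this
  convert this using 1
  push_cast; ring
end

section
theorem weil_L {K : Type*} [Field K] [Fintype K] (p : ℕ) [Fact p.Prime] [CharP K p] (χ : AddChar K ℂ) (hχ : χ ≠ 0) {g : K[X][X]} 
    (hm : g.Monic) (hdp : 0 < g.natDegree) (hd : g.natDegree < p)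
    (B : ℕ) (hB : ∀ i, (g.coeff i).natDegree ≤ B)
    {L : Type*} [Field L] [Algebra (FractionRing K[X]) L] [Algebra K[X] L] [IsScalarTower K[X] (FractionRing K[X]) L]
    (hg0 : Irreducible (g.map (algebraMap K[X] (FractionRing K[X])))) (pb : PowerBasis (FractionRing K[X]) L)
    (hmin : minpoly (FractionRing K[X]) pb.gen = g.map (algebraMap K[X] (FractionRing K[X]))) :
    ∃ Δ : K[X], Δ ≠ 0 ∧ Δ.natDegree ≤ g.natDegree * (B * (g.natDegree + 1)) ∧
      ‖sumD (kb := AlgebraicClosure K) χ 1 (Δ.map (algebraMap K _)) (g.map (mapRingHom (algebraMap K _)))‖ ≤ 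
      (g.natDegree * (2 * (B * g.natDegree) + Δ.natDegree) : ℕ) * Real.sqrt (Fintype.card K) := by
  have hfd : FiniteDimensional (FractionRing K[X]) L := pb.finite
  have hcF : CharP (FractionRing K[X]) p := by
    have : CharP K[X] p := inferInstance
    exact charP_of_injective_algebraMap (IsFractionRing.injective K[X] (FractionRing K[X])) p
  have hgs : IsSeparable (FractionRing K[X]) pb.gen := by
    rw [IsSeparable, hmin, separable_iff_derivative_ne_zero hg0]
    intro h0
    have h1 := congrArg (fun f => f.coeff (g.natDegree - 1)) h0
    simp only [coeff_derivative, coeff_zero] at h1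
    have hg0m : (g.map (algebraMap K[X] (FractionRing K[X]))).Monic := hm.map _
    have h2 : (g.map (algebraMap K[X] (FractionRing K[X]))).coeff (g.natDegree - 1 + 1) = 1 := by
      rw [Nat.sub_add_cancel hdp]
      have := hg0m.coeff_natDegree
      rwa [hm.natDegree_map] at this
    rw [h2, one_mul] at h1
    have h3 : ((g.natDegree : ℕ) : FractionRing K[X]) = 0 := by
      rw [← h1, ← Nat.cast_add_one, Nat.sub_add_cancel hdp]
    rw [CharP.cast_eq_zero_iff _ p] at h3
    exact Nat.not_dvd_of_pos_of_lt hdp hd h3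
  have hsep : Algebra.IsSeparable (FractionRing K[X]) L := by
    exact sep_of_pb pb hgs
  let O := integralClosure K[X] L
  have : IsDedekindDomain O := integralClosure.isDedekindDomain K[X] (FractionRing K[X]) L
  have : IsFractionRing O L := integralClosure.isFractionRing_of_finite_extension (FractionRing K[X]) L
  have : Module.Finite K[X] O := IsIntegralClosure.finite K[X] (FractionRing K[X]) L O
  have : Module.IsTorsionFree K[X] O := by
    have h1 : Function.Injective (algebraMap K[X] L) := by
      rw [IsScalarTower.algebraMap_eq K[X] (FractionRing K[X]) L]
      exact (algebraMap (FractionRing K[X]) L).injective.comp (IsFractionRing.injective _ _)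
    rw [Module.isTorsionFree_iff_algebraMap_injective]
    rw [IsScalarTower.algebraMap_eq K[X] O L, RingHom.coe_comp] at h1
    exact Function.Injective.of_comp h1
  have hint : IsIntegral K[X] pb.gen := by
    refine ⟨g, hm, ?_⟩
    have h1 := minpoly.aeval (FractionRing K[X]) pb.gen
    rw [hmin] at h1
    rwa [aeval_map_algebraMap] at h1
  let y : O := ⟨pb.gen, hint⟩
  letI : Algebra K O := ((algebraMap K[X] O).comp C).toAlgebra
  have : IsScalarTower K K[X] O := IsScalarTower.of_algebraMap_eq' rfl
  have : CharP (AlgebraicClosure K) p := charP_of_injective_algebraMap (algebraMap K (AlgebraicClosure K)).injective p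
  exact conc_bound (O := O) (L := L) (y := y) p χ hχ hm hdp hd pb rfl hmin B hB

theorem weil_g {K : Type*} [Field K] [Fintype K] (p : ℕ) [Fact p.Prime] [CharP K p] (χ : AddChar K ℂ) (hχ : χ ≠ 0) {g : K[X][X]} 
    (hm : g.Monic) (hirr : Irreducible g) (hd : g.natDegree < p)
    (B : ℕ) (hB : ∀ i, (g.coeff i).natDegree ≤ B) :
    ∃ Δ : K[X], Δ ≠ 0 ∧ Δ.natDegree ≤ g.natDegree * (B * (g.natDegree + 1)) ∧
      ‖sumD (kb := AlgebraicClosure K) χ 1 (Δ.map (algebraMap K _)) (g.map (mapRingHom (algebraMap K _)))‖ ≤ 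
      (g.natDegree * (2 * (B * g.natDegree) + Δ.natDegree) : ℕ) * Real.sqrt (Fintype.card K) := by
  have hdp : 0 < g.natDegree := by
    by_contra h
    exact hirr.not_isUnit (by rw [hm.natDegree_eq_zero.1 (by omega)]; exact isUnit_one)
  let g0 := g.map (algebraMap K[X] (FractionRing K[X]))
  have hg0m : g0.Monic := hm.map _
  have hg0 : Irreducible g0 := (hm.irreducible_iff_irreducible_map_fraction_map (K := FractionRing K[X])).1 hirr
  have : Fact (Irreducible g0) := ⟨hg0⟩
  let L := AdjoinRoot g0
  let pb : PowerBasis (FractionRing K[X]) L := AdjoinRoot.powerBasis hg0.ne_zero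
  have hmin : minpoly (FractionRing K[X]) pb.gen = g0 := by
    have := AdjoinRoot.minpoly_powerBasis_gen_of_monic hg0m
    exact this
  exact weil_L p χ hχ hm hdp hd B hB hg0 pb hmin
end
end

open Polynomial
section
variable {K : Type*} [Field K] [Fintype K]

open Classical in
/-- zero set -/
noncomputable def ZK (f : K[X][X]) : Finset (K × K) := Finset.univ.filter (fun s => ev2 f s.1 s.2 = 0)

lemma mem_ZK (f : K[X][X]) (s : K × K) : s ∈ ZK f ↔ ev2 f s.1 s.2 = 0 := by simp [ZK]

/-- character sum over the zero set -/
noncomputable def SK (χ : AddChar K ℂ) (f : K[X][X]) : ℂ := ∑ s ∈ ZK f, χ s.1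

lemma norm_sum_le_card (χ : AddChar K ℂ) (S : Finset (K × K)) : ‖∑ s ∈ S, χ s.1‖ ≤ S.card := by
  refine (norm_sum_le _ _).trans ?_
  simp

lemma SK_sumN {kb : Type*} [Field kb] [IsAlgClosed kb] [Algebra K kb] (χ : AddChar K ℂ) (g : K[X][X]) :
    SK χ g = sumN (kb := kb) χ 1 (g.map (mapRingHom (algebraMap K kb))) := by
  classical
  unfold sumN
  rw [SK]
  have hev : ∀ s : K × K, ev2 (g.map (mapRingHom (algebraMap K kb))) (algebraMap K kb s.1) (algebraMap K kb s.2) = algebraMap K kb (ev2 g s.1 s.2) := by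
    intro s
    rw [evh_ev2]
    have : evh K (algebraMap K kb s.1) (algebraMap K kb s.2) = (algebraMap K kb).comp ((evalRingHom s.2).comp (mapRingHom (evalRingHom s.1))) := by
      ext <;> simp [evh]
    rw [this]; simp [ev2]
  refine Finset.sum_bij (fun s _ => (algebraMap K kb s.1, algebraMap K kb s.2)) ?_ ?_ ?_ ?_
  · intro s hs
    rw [mem_ZK] at hs
    rw [Finset.mem_filter, Finset.mem_product, mem_Kn one_pos, mem_Kn one_pos, pow_one, ← map_pow, ← map_pow, FiniteField.pow_card, FiniteField.pow_card, hev, hs, map_zero]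
    simp
  · rintro ⟨a, b⟩ _ ⟨c, d⟩ _ h
    simp only [Prod.mk.injEq] at h ⊢
    exact ⟨(algebraMap K kb).injective h.1, (algebraMap K kb).injective h.2⟩
  · rintro ⟨a, b⟩ h
    rw [Finset.mem_filter, Finset.mem_product, mem_Kn one_pos, mem_Kn one_pos, pow_one] at h
    obtain ⟨c, rfl⟩ := mem_K_of a h.1.1
    obtain ⟨d, rfl⟩ := mem_K_of b h.1.2
    refine ⟨(c, d), ?_, rfl⟩
    rw [mem_ZK]
    have := h.2
    rw [hev (c, d)] at this
    exact (map_eq_zero _).1 this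
  · intro s hs
    simp [trN, chx_alg]

lemma one_le_sqrt_card : (1 : ℝ) ≤ Real.sqrt (Fintype.card K) := by
  rw [Real.one_le_sqrt]
  exact_mod_cast Fintype.card_pos

/-- the constant -/
def CW (k B : ℕ) : ℕ := k * (2 * (B * k) + k * (B * (k + 1))) + k * (B * (k + 1)) * k

theorem SK_irred (p : ℕ) [Fact p.Prime] [CharP K p] (χ : AddChar K ℂ) (hχ : χ ≠ 0) (k B : ℕ) {g : K[X][X]} 
    (hm : g.Monic) (hirr : Irreducible g) (hk : g.natDegree ≤ k) (hd : k < p) (hB : ∀ i, (g.coeff i).natDegree ≤ B) :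
    ‖SK χ g‖ ≤ CW k B * Real.sqrt (Fintype.card K) := by
  obtain ⟨Δ, h0, h1, h2⟩ := weil_g p χ hχ hm hirr (by omega) B hB
  have h3 := sumD_close χ 1 (Δ.map (algebraMap K (AlgebraicClosure K))) ((Polynomial.map_ne_zero_iff (algebraMap K _).injective).2 h0) (g.map (mapRingHom (algebraMap K _))) (hm.map _)
  rw [← SK_sumN, natDegree_map, hm.natDegree_map] at h3
  have h4 := norm_le_norm_sub_add (SK χ g) (sumD (kb := AlgebraicClosure K) χ 1 (Δ.map (algebraMap K _)) (g.map (mapRingHom (algebraMap K _))))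
  have h5 := one_le_sqrt_card (K := K)
  have h6 : Δ.natDegree ≤ k * (B * (k + 1)) := h1.trans (by gcongr)
  have h7 : ((g.natDegree * (2 * (B * g.natDegree) + Δ.natDegree) : ℕ) : ℝ) ≤ ((k * (2 * (B * k) + k * (B * (k + 1))) : ℕ) : ℝ) := by
    exact_mod_cast by gcongr
  have h8 : (Δ.natDegree : ℝ) * g.natDegree ≤ ((k * (B * (k + 1)) * k : ℕ) : ℝ) := by
    exact_mod_cast by gcongr
  have h9 : ((k * (B * (k + 1)) * k : ℕ) : ℝ) ≤ ((k * (B * (k + 1)) * k : ℕ) : ℝ) * Real.sqrt (Fintype.card K) := le_mul_of_one_le_right (by positivity) h5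
  have h10 := mul_le_mul_of_nonneg_right h7 (Real.sqrt_nonneg (Fintype.card K))
  rw [CW, Nat.cast_add, add_mul]
  linarith
end

open Polynomial

lemma coeff_swap {K : Type*} [Field K] (f : K[X][X]) (i j : ℕ) : ((Bivariate.swap f).coeff i).coeff j = (f.coeff j).coeff i := by
  induction f using Polynomial.induction_on' with
  | add a b ha hb => simp [ha, hb]
  | monomial n u =>
    induction u using Polynomial.induction_on' with
    | add a b ha hb => simp only [map_add, coeff_add, ha, hb]
    | monomial m r =>
      rw [Bivariate.swap_monomial_monomial]
      simp only [coeff_monomial]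
      split_ifs <;> simp [coeff_monomial, *]

lemma swap_deg {K : Type*} [Field K] (f : K[X][X]) (B : ℕ) : (Bivariate.swap f).natDegree ≤ B ↔ ∀ i, (f.coeff i).natDegree ≤ B := by
  simp only [natDegree_le_iff_coeff_eq_zero]
  constructor
  · intro h i j hj
    rw [← coeff_swap, h j hj, coeff_zero]
  · intro h j hj
    ext i
    rw [coeff_swap, h i j hj, coeff_zero]

lemma factor_deg {K : Type*} [Field K] {g f : K[X][X]} (hf : f ≠ 0) (hd : g ∣ f) {B : ℕ} (hB : ∀ i, (f.coeff i).natDegree ≤ B) : ∀ i, (g.coeff i).natDegree ≤ B := by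
  rw [← swap_deg] at hB ⊢
  obtain ⟨h, rfl⟩ := hd
  rw [map_mul, natDegree_mul] at hB
  · omega
  · simpa using left_ne_zero_of_mul hf
  · simpa using right_ne_zero_of_mul hf

lemma monic_factor {K : Type*} [Field K] : ∀ (n : ℕ) (f : K[X][X]), f.natDegree ≤ n → f.Monic → f ≠ 1 → ∃ g h : K[X][X], f = g * h ∧ g.Monic ∧ h.Monic ∧ Irreducible g := by
  intro n
  induction n with
  | zero =>
    intro f hn hm h1
    exact absurd (hm.natDegree_eq_zero.1 (by omega)) h1
  | succ n ih =>
    intro f hn hm h1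
    by_cases hi : Irreducible f
    · exact ⟨f, 1, by simp, hm, monic_one, hi⟩
    · rw [hm.irreducible_iff_natDegree] at hi
      push Not at hi
      obtain ⟨G1, G2, hm1, hm2, rfl, h1, h2⟩ := hi h1
      rw [hm1.natDegree_mul hm2] at hn
      obtain ⟨g, h, rfl, hg, hh, hgi⟩ := ih G1 (by omega) hm1 (by rintro rfl; simp at h1)
      exact ⟨g, h * G2, by ring, hg, hh.mul hm2, hgi⟩

section
variable {K : Type*} [Field K] [Fintype K]

lemma SK_monic (p : ℕ) [Fact p.Prime] [CharP K p] (χ : AddChar K ℂ) (hχ : χ ≠ 0) (k B : ℕ) (hd : k < p) : ∀ (n : ℕ) (f : K[X][X]), f.natDegree ≤ n → n ≤ k →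
    f.Monic → (∀ i, (f.coeff i).natDegree ≤ B) → ‖SK χ f‖ ≤ n * ((CW k B + k * (B + B * k + B * k) : ℕ) * Real.sqrt (Fintype.card K)) := by
  classical
  intro n
  induction n with
  | zero =>
    intro f hn hk hm hB
    have : f = 1 := hm.natDegree_eq_zero.1 (by omega)
    have : ZK f = ∅ := by
      ext s; rw [mem_ZK, this]; simp [ev2]
    rw [SK, this]; simp
  | succ n ih =>
    intro f hn hk hm hB
    have hpos : (0:ℝ) ≤ ((CW k B + k * (B + B * k + B * k) : ℕ) * Real.sqrt (Fintype.card K)) := by positivity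
    by_cases h1 : f = 1
    · have : ZK f = ∅ := by
        ext s; rw [mem_ZK, h1]; simp [ev2]
      rw [SK, this, Finset.sum_empty, norm_zero]
      positivity
    obtain ⟨g, h, rfl, hg, hh, hgi⟩ := monic_factor _ f le_rfl hm h1
    have hgp : 0 < g.natDegree := by
      by_contra h
      exact hgi.not_isUnit (by rw [hg.natDegree_eq_zero.1 (by omega)]; exact isUnit_one)
    have hBg := factor_deg hm.ne_zero (dvd_mul_right g h) hB
    have hBh := factor_deg hm.ne_zero (dvd_mul_left h g) hB
    rw [hg.natDegree_mul hh] at hn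
    have e1 := ih h (by omega) (by omega) hh hBh
    push_cast at e1 hpos ⊢
    by_cases hgh : g ∣ h
    · have : ZK (g * h) = ZK h := by
        ext s
        rw [mem_ZK, mem_ZK, ev2_mul]
        obtain ⟨u, rfl⟩ := hgh
        rw [ev2_mul]
        simp
      rw [SK, this]
      refine e1.trans ?_
      rw [add_mul (n : ℝ) 1, one_mul]
      linarith
    · have hU : ZK (g * h) = ZK g ∪ ZK h := by
        ext s
        rw [Finset.mem_union, mem_ZK, mem_ZK, mem_ZK, ev2_mul, mul_eq_zero]
      have e2 := Finset.sum_union_inter (s₁ := ZK g) (s₂ := ZK h) (f := fun s => χ s.1)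
      rw [← hU] at e2
      have e3 : SK χ (g * h) = SK χ g + SK χ h - ∑ s ∈ ZK g ∩ ZK h, χ s.1 := by
        rw [eq_sub_iff_add_eq]; exact e2
      have e4 := SK_irred p χ hχ k B hg hgi (by omega) hd hBg
      have e5 := norm_sum_le_card χ (ZK g ∩ ZK h)
      have e6 : (ZK g ∩ ZK h).card ≤ k * (B + B * k + B * k) := by
        refine (pairs_card_le g hg hgi B hBg h hgh B k hBh (by omega) _ ?_).trans ?_
        · intro s hs
          rw [Finset.mem_inter, mem_ZK, mem_ZK] at hs
          exact hs
        · have : g.natDegree ≤ k := by omega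
          gcongr
      have e6' : ((ZK g ∩ ZK h).card : ℝ) ≤ k * (B + B * k + B * k) := by exact_mod_cast e6
      have e7 := one_le_sqrt_card (K := K)
      have e8 : (k * (B + B * k + B * k) : ℝ) ≤ (k * (B + B * k + B * k) : ℝ) * Real.sqrt (Fintype.card K) := le_mul_of_one_le_right (by positivity) e7
      have e9 : ‖SK χ (g * h)‖ ≤ ‖SK χ g‖ + ‖SK χ h‖ + ‖∑ s ∈ ZK g ∩ ZK h, χ s.1‖ := by
        rw [e3]
        exact (norm_sub_le _ _).trans (by gcongr; exact norm_add_le _ _)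
      rw [add_mul (n : ℝ) 1, one_mul]
      linarith

lemma fiber_card (A : K[X]) (hA : A ≠ 0) (k : ℕ) (hAk : A.natDegree ≤ k) (f : K[X][X]) (hf : f.natDegree ≤ k)
    (h0 : ∀ a, f.map (evalRingHom a) ≠ 0) [DecidablePred fun s : K × K => A.eval s.1 = 0] : ((ZK f).filter (fun s => A.eval s.1 = 0)).card ≤ k * k := by
  classical
  have hsub : (ZK f).filter (fun s => A.eval s.1 = 0) ⊆ A.roots.toFinset.biUnion (fun a => (f.map (evalRingHom a)).roots.toFinset.image (fun b => (a, b))) := by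
    intro s hs
    rw [Finset.mem_filter, mem_ZK] at hs
    rw [Finset.mem_biUnion]
    refine ⟨s.1, ?_, ?_⟩
    · rw [Multiset.mem_toFinset, mem_roots hA]; exact hs.2
    · rw [Finset.mem_image]
      refine ⟨s.2, ?_, rfl⟩
      rw [Multiset.mem_toFinset, mem_roots (h0 _)]; exact hs.1
  refine (Finset.card_le_card hsub).trans (Finset.card_biUnion_le.trans ?_)
  calc _ ≤ ∑ a ∈ A.roots.toFinset, k := by
        refine Finset.sum_le_sum fun a _ => Finset.card_image_le.trans ?_
        exact (Multiset.toFinset_card_le _).trans ((card_roots' _).trans ((natDegree_map_le).trans hf))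
    _ ≤ _ := by
        rw [Finset.sum_const, smul_eq_mul]
        gcongr
        exact (Multiset.toFinset_card_le _).trans ((card_roots' _).trans hAk)

/-- the final constant -/
def CP (k : ℕ) : ℕ := k * (CW k (k + k * k) + k * ((k + k * k) + (k + k * k) * k + (k + k * k) * k)) + 2 * (k * k)

theorem SK_bound (p : ℕ) [Fact p.Prime] [CharP K p] (χ : AddChar K ℂ) (hχ : χ ≠ 0) (k : ℕ) (hd : k < p) (f : K[X][X]) (hk : f.natDegree ≤ k)
    (hB : ∀ i, (f.coeff i).natDegree ≤ k) (h0 : ∀ a, f.map (evalRingHom a) ≠ 0) : ‖SK χ f‖ ≤ CP k * Real.sqrt (Fintype.card K) := by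
  classical
  have hf0 : f ≠ 0 := by rintro rfl; exact h0 0 (by simp)
  rcases Nat.eq_zero_or_pos f.natDegree with hn | hn
  · have : ZK f = ∅ := by
      ext s
      rw [mem_ZK]
      simp only [Finset.notMem_empty, iff_false]
      intro h
      apply h0 s.1
      rw [eq_C_of_natDegree_eq_zero hn] at h ⊢
      simp only [ev2, map_C, eval_C] at h ⊢
      rw [h, C_0]
    rw [SK, this, Finset.sum_empty, norm_zero]; positivity
  set A := f.leadingCoeff with hA
  have hA0 : A ≠ 0 := leadingCoeff_ne_zero.2 hf0
  have hAk : A.natDegree ≤ k := hB _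
  set F := f.integralNormalization with hF
  have hFm : F.Monic := monic_integralNormalization hf0
  have hFd : F.natDegree = f.natDegree := natDegree_integralNormalization
  have hFB : ∀ i, (F.coeff i).natDegree ≤ k + k * k := by
    intro i
    by_cases hi : i = f.natDegree
    · rw [hi, ← hFd, hFm.coeff_natDegree]; simp
    · rw [hF, integralNormalization_coeff_ne_natDegree hi]
      refine natDegree_mul_le.trans (add_le_add (hB i) (natDegree_pow_le.trans ?_))
      exact Nat.mul_le_mul (by omega) hAk
  have hev : ∀ x y : K, ev2 F x (A.eval x * y) = (A.eval x) ^ (f.natDegree - 1) * ev2 f x y := by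
    intro x y
    have := integralNormalization_eval₂_leadingCoeff_mul hn (evalRingHom x) y
    rw [ev2, ev2, eval_map, eval_map, mul_comm]
    rw [mul_comm] 
    simpa using this
  have e1 := SK_monic p χ hχ k (k + k * k) hd k F (by omega) le_rfl hFm hFB
  have s1 := Finset.sum_filter_add_sum_filter_not (ZK f) (fun s => A.eval s.1 = 0) (fun s => χ s.1)
  have s2 := Finset.sum_filter_add_sum_filter_not (ZK F) (fun s => A.eval s.1 = 0) (fun s => χ s.1)
  have s3 : ∑ s ∈ (ZK f).filter (fun s => ¬ A.eval s.1 = 0), χ s.1 = ∑ s ∈ (ZK F).filter (fun s => ¬ A.eval s.1 = 0), χ s.1 := by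
    refine Finset.sum_bij (fun s _ => (s.1, A.eval s.1 * s.2)) ?_ ?_ ?_ ?_
    · intro s hs
      rw [Finset.mem_filter, mem_ZK] at hs ⊢
      refine ⟨?_, hs.2⟩
      rw [hev, hs.1, mul_zero]
    · rintro ⟨a, b⟩ hs ⟨c, d⟩ _ h
      rw [Finset.mem_filter] at hs
      simp only [Prod.mk.injEq] at h ⊢
      obtain ⟨rfl, h⟩ := h
      exact ⟨rfl, mul_left_cancel₀ hs.2 h⟩
    · rintro ⟨a, b⟩ hs
      rw [Finset.mem_filter, mem_ZK] at hs
      have e : A.eval a * (b / A.eval a) = b := mul_div_cancel₀ _ hs.2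
      refine ⟨(a, b / A.eval a), ?_, by rw [e]⟩
      rw [Finset.mem_filter, mem_ZK]
      refine ⟨?_, hs.2⟩
      have := hev a (b / A.eval a)
      rw [e, hs.1] at this
      exact (mul_eq_zero.1 this.symm).resolve_left (pow_ne_zero _ hs.2)
    · intro s _; rfl
  have t1 := norm_sum_le_card χ ((ZK f).filter (fun s => A.eval s.1 = 0))
  have t2 := norm_sum_le_card χ ((ZK F).filter (fun s => A.eval s.1 = 0))
  have c1 : (((ZK f).filter (fun s => A.eval s.1 = 0)).card : ℝ) ≤ k * k := by exact_mod_cast fiber_card A hA0 k hAk f hk h0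
  have c2 : (((ZK F).filter (fun s => A.eval s.1 = 0)).card : ℝ) ≤ k * k := by exact_mod_cast fiber_card A hA0 k hAk F (by omega) (fun a => (hFm.map _).ne_zero)
  have e7 := one_le_sqrt_card (K := K)
  have e8 : (2 * (k * k) : ℝ) ≤ (2 * (k * k) : ℝ) * Real.sqrt (Fintype.card K) := le_mul_of_one_le_right (by positivity) e7
  have e2 : SK χ f = ∑ s ∈ (ZK f).filter (fun s => A.eval s.1 = 0), χ s.1 + SK χ F - ∑ s ∈ (ZK F).filter (fun s => A.eval s.1 = 0), χ s.1 := by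
    rw [SK, SK, ← s1, s3, ← s2]; ring
  have e9 : ‖SK χ f‖ ≤ ‖∑ s ∈ (ZK f).filter (fun s => A.eval s.1 = 0), χ s.1‖ + ‖SK χ F‖ + ‖∑ s ∈ (ZK F).filter (fun s => A.eval s.1 = 0), χ s.1‖ := by
    rw [e2]
    exact (norm_sub_le _ _).trans (by gcongr; exact norm_add_le _ _)
  rw [CP]
  push_cast at e1 ⊢
  rw [add_mul, mul_assoc]
  linarith
end

open Polynomial

/-- linear change of variables -/
noncomputable def PhV {K : Type*} [Field K] (a b c d : K) : Fin 2 → K[X][X] :=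
  ![C (C d * X) - C (C b) * X, C (C (-c) * X) + C (C a) * X]

noncomputable def Ph {K : Type*} [Field K] (a b c d : K) : MvPolynomial (Fin 2) K →ₐ[K] K[X][X] :=
  MvPolynomial.aeval (PhV a b c d)

lemma ev2_Ph {K : Type*} [Field K] (a b c d : K) (P : MvPolynomial (Fin 2) K) (x y : K) :
    ev2 (Ph a b c d P) x y = MvPolynomial.eval ![d * x - b * y, -c * x + a * y] P := by
  induction P using MvPolynomial.induction_on with
  | C r => simp [ev2, Ph, Polynomial.algebraMap_apply]
  | add p q hp hq => 
    simp only [ev2, map_add, Polynomial.map_add, eval_add] at *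
    rw [hp, hq]
  | mul_X p i hp => 
    rw [map_mul, ev2_mul, hp, map_mul]
    congr 1
    fin_cases i <;> simp [ev2, Ph, PhV]

lemma aeval_deg {K : Type*} [Field K] (f : Fin 2 → K[X][X]) (hf : ∀ i, (f i).natDegree ≤ 1)
    (P : MvPolynomial (Fin 2) K) : (MvPolynomial.aeval f P).natDegree ≤ P.totalDegree := by
  have h1 : (MvPolynomial.map (C : K →+* K[X]) P).totalDegree ≤ P.totalDegree :=
    Finset.sup_mono (MvPolynomial.support_map_subset _ _)
  have := MvPolynomial.aeval_natDegree_le (R := K[X]) (MvPolynomial.map (C : K →+* K[X]) P) h1 f hf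
  have e : MvPolynomial.aeval f (MvPolynomial.map (C : K →+* K[X]) P) = MvPolynomial.aeval f P := by
    have := MvPolynomial.aeval_map_algebraMap K[X] f P
    exact this
  rw [e] at this
  omega

lemma Ph_deg {K : Type*} [Field K] (a b c d : K) (P : MvPolynomial (Fin 2) K) :
    (Ph a b c d P).natDegree ≤ P.totalDegree := by
  apply aeval_deg
  intro i
  fin_cases i <;> simp only [PhV] <;> simp <;> compute_degree

lemma lin_coeff {K : Type*} [Field K] (u v : K) (j : ℕ) :
    ((C (C u * X) + C (C v) * X : K[X][X]).coeff j).natDegree ≤ 1 := by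
  rw [coeff_add, coeff_C, coeff_C_mul, coeff_X]
  refine (natDegree_add_le _ _).trans (max_le ?_ ?_)
  · split_ifs
    · exact (natDegree_C_mul_le u X).trans natDegree_X_le
    · simp
  · split_ifs <;> simp

lemma PhV_coeff {K : Type*} [Field K] (a b c d : K) (i : Fin 2) (j : ℕ) :
    ((PhV a b c d i).coeff j).natDegree ≤ 1 := by
  fin_cases i
  · have := lin_coeff d (-b) j
    have e : (C (C d * X) + C (C (-b)) * X : K[X][X]) = C (C d * X) - C (C b) * X := by
      rw [C_neg, C_neg]; ring
    rw [e] at this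
    exact this
  · exact lin_coeff (-c) a j

lemma Ph_swap {K : Type*} [Field K] (a b c d : K) (P : MvPolynomial (Fin 2) K) : 
    Bivariate.swap (Ph a b c d P) = MvPolynomial.aeval (fun i => Bivariate.swap (PhV a b c d i)) P := by
  rw [Ph]
  induction P using MvPolynomial.induction_on with
  | C r => rw [MvPolynomial.aeval_C, MvPolynomial.aeval_C, AlgEquiv.commutes]
  | add p q hp hq => rw [map_add, map_add, hp, hq, map_add]
  | mul_X p i hp => 
    rw [map_mul, map_mul, hp, map_mul, MvPolynomial.aeval_X, MvPolynomial.aeval_X]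

lemma Ph_deg' {K : Type*} [Field K] (a b c d : K) (P : MvPolynomial (Fin 2) K) (i : ℕ) :
    ((Ph a b c d P).coeff i).natDegree ≤ P.totalDegree := by
  revert i
  rw [← swap_deg, Ph_swap]
  apply aeval_deg
  intro i
  rw [swap_deg]
  exact PhV_coeff a b c d i

lemma Ps_Ph {K : Type*} [Field K] (a b c d : K) (h : a * d - b * c = 1) (P : MvPolynomial (Fin 2) K) :
    (Ph a b c d P).eval₂ (eval₂RingHom (MvPolynomial.C : K →+* MvPolynomial (Fin 2) K)
      (MvPolynomial.C a * MvPolynomial.X 0 + MvPolynomial.C b * MvPolynomial.X 1))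
      (MvPolynomial.C c * MvPolynomial.X 0 + MvPolynomial.C d * MvPolynomial.X 1) = P := by
  have hC : (MvPolynomial.C a * MvPolynomial.C d - MvPolynomial.C b * MvPolynomial.C c : MvPolynomial (Fin 2) K) = 1 := by
    rw [← MvPolynomial.C_mul, ← MvPolynomial.C_mul, ← MvPolynomial.C_sub, h, MvPolynomial.C_1]
  induction P using MvPolynomial.induction_on with
  | C r => simp [Ph, Polynomial.algebraMap_apply]
  | add p q hp hq => rw [map_add, eval₂_add, hp, hq]
  | mul_X p i hp => 
    rw [map_mul, eval₂_mul, hp]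
    congr 1
    fin_cases i <;> simp [Ph, PhV, eval₂_sub]
    · linear_combination (MvPolynomial.X 0) * hC
    · linear_combination (MvPolynomial.X 1) * hC

open Polynomial

def BadL {K : Type*} [Field K] (P : MvPolynomial (Fin 2) K) (t : K) : Prop :=
  ∃ a b x : K, (a ≠ 0 ∨ b ≠ 0) ∧ ∀ v : Fin 2 → K, a * v 0 + b * v 1 = x → MvPolynomial.eval v P = t

lemma exists_cd {K : Type*} [Field K] (a b : K) (h : a ≠ 0 ∨ b ≠ 0) : ∃ c d : K, a * d - b * c = 1 := by
  by_cases ha : a = 0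
  · have hb : b ≠ 0 := by tauto
    exact ⟨-b⁻¹, 0, by field_simp; simp⟩
  · exact ⟨0, a⁻¹, by field_simp; simp⟩

lemma bad_card {K : Type*} [Field K] [Fintype K] [DecidableEq K] (P : MvPolynomial (Fin 2) K) (k : ℕ)
    (hk : P.totalDegree = k) (hq : k < Fintype.card K)
    (hnd : ¬ ∃ (G : Polynomial K) (α β : K),
            P = Polynomial.eval₂ (MvPolynomial.C : K →+* MvPolynomial (Fin 2) K)
                  (MvPolynomial.C α * MvPolynomial.X 0 +
                   MvPolynomial.C β * MvPolynomial.X 1) G)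
    (T : Finset K) (hT : ∀ t ∈ T, BadL P t) : T.card ≤ k := by
  by_contra hc
  push Not at hc
  obtain ⟨t0, ht0⟩ : T.Nonempty := Finset.card_pos.1 (by omega)
  obtain ⟨a, b, x0, hab, h0⟩ := hT t0 ht0
  obtain ⟨c, d, hdet⟩ := exists_cd a b hab
  have key : ∀ t ∈ T, ∃ x, ∀ y, ev2 (Ph a b c d P) x y = t := by
    intro t ht
    obtain ⟨a', b', x', hab', h'⟩ := hT t ht
    by_cases hD : a * b' - b * a' = 0
    · have e1 : (a' * d - b' * c) * a = a' := by linear_combination a' * hdet - c * hD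
      have e2 : (a' * d - b' * c) * b = b' := by linear_combination b' * hdet - d * hD
      set l := a' * d - b' * c with hl
      have hl0 : l ≠ 0 := by
        intro h
        rw [h] at e1 e2
        simp at e1 e2
        rcases hab' with h | h
        · exact h e1.symm
        · exact h e2.symm
      refine ⟨x' / l, fun y => ?_⟩
      rw [ev2_Ph]
      apply h'
      simp only [Matrix.cons_val_zero, Matrix.cons_val_one]
      rw [← e1, ← e2]
      have : l * (x' / l) = x' := by field_simp
      linear_combination this + l * (x' / l) * hdet
    · have hv := h0 ![(x0 * b' - b * x') / (a * b' - b * a'), (a * x' - a' * x0) / (a * b' - b * a')] (by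
        simp only [Matrix.cons_val_zero, Matrix.cons_val_one]
        rw [← mul_div_assoc, ← mul_div_assoc, ← add_div, div_eq_iff hD]; ring)
      have hv' := h' ![(x0 * b' - b * x') / (a * b' - b * a'), (a * x' - a' * x0) / (a * b' - b * a')] (by
        simp only [Matrix.cons_val_zero, Matrix.cons_val_one]
        rw [← mul_div_assoc, ← mul_div_assoc, ← add_div, div_eq_iff hD]; ring)
      have : t = t0 := by rw [← hv, ← hv']
      subst this
      refine ⟨x0, fun y => ?_⟩
      rw [ev2_Ph]
      apply h0
      simp only [Matrix.cons_val_zero, Matrix.cons_val_one]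
      linear_combination x0 * hdet
  choose! g hg using key
  have ginj : Set.InjOn g T := by
    intro t ht s hs h
    rw [← hg t ht 0, ← hg s hs 0, h]
  have hcard : (T.image g).card = T.card := Finset.card_image_of_injOn ginj
  have hconst : ∀ t ∈ T, (Ph a b c d P).map (evalRingHom (g t)) = C t := by
    intro t ht
    rw [← sub_eq_zero]
    apply eq_zero_of_natDegree_lt_card_of_eval_eq_zero' _ Finset.univ
    · intro y _
      have := hg t ht y
      simp only [ev2] at this
      rw [eval_sub, this, eval_C, sub_self]
    · refine lt_of_le_of_lt ?_ hq
      refine (natDegree_sub_le _ _).trans ?_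
      rw [natDegree_C, max_eq_left (Nat.zero_le _), ← hk]
      exact natDegree_map_le.trans (Ph_deg a b c d P)
  have hz : ∀ i, i ≠ 0 → (Ph a b c d P).coeff i = 0 := by
    intro i hi
    apply eq_zero_of_natDegree_lt_card_of_eval_eq_zero' _ (T.image g)
    · intro x hx
      obtain ⟨t, ht, rfl⟩ := Finset.mem_image.1 hx
      have := congrArg (fun u => coeff u i) (hconst t ht)
      simpa [coeff_map, coeff_C, hi] using this
    · rw [hcard]
      have := Ph_deg' a b c d P i
      omega
  have hC : Ph a b c d P = C ((Ph a b c d P).coeff 0) := by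
    ext1 i
    rw [coeff_C]
    split_ifs with h
    · rw [h]
    · exact hz i h
  apply hnd
  refine ⟨(Ph a b c d P).coeff 0, a, b, ?_⟩
  have := Ps_Ph a b c d hdet P
  rw [hC, eval₂_C] at this
  exact this.symm

lemma S_bound {K : Type*} [Field K] [Fintype K] [DecidableEq K] (p : ℕ) [Fact p.Prime] [CharP K p]
    (χ : AddChar K ℂ) (hχ : χ ≠ 0) (P : MvPolynomial (Fin 2) K) (k : ℕ)
    (hk : P.totalDegree = k) (hp : k < p) (t : K) (ht : ¬ BadL P t) (a b : K) (hab : a ≠ 0 ∨ b ≠ 0) :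
    ‖∑ v ∈ (Finset.univ : Finset (Fin 2 → K)).filter (fun v => MvPolynomial.eval v P = t), χ (a * v 0 + b * v 1)‖
      ≤ CP k * Real.sqrt (Fintype.card K) := by
  obtain ⟨c, d, hdet⟩ := exists_cd a b hab
  have hev : ∀ v : Fin 2 → K, ev2 (Ph a b c d P - C (C t)) (a * v 0 + b * v 1) (c * v 0 + d * v 1) = MvPolynomial.eval v P - t := by
    intro v
    rw [ev2_sub, ev2_Ph]
    have : ![d * (a * v 0 + b * v 1) - b * (c * v 0 + d * v 1), -c * (a * v 0 + b * v 1) + a * (c * v 0 + d * v 1)] = v := by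
      ext i
      fin_cases i
      · simp
        linear_combination v 0 * hdet
      · simp
        linear_combination v 1 * hdet
    rw [this]
    simp [ev2]
  have key := SK_bound p χ hχ k hp (Ph a b c d P - C (C t)) (by
    refine (natDegree_sub_le _ _).trans ?_
    rw [natDegree_C, max_eq_left (Nat.zero_le _), ← hk]
    exact Ph_deg a b c d P) (by
    intro i
    rw [coeff_sub]
    refine (natDegree_sub_le _ _).trans (max_le ?_ ?_)
    · rw [← hk]; exact Ph_deg' a b c d P i
    · rw [coeff_C]
      split_ifs <;> simp) (by
    intro x hx
    apply ht
    refine ⟨a, b, x, hab, fun v hv => ?_⟩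
    have := hev v
    rw [hv, ev2, hx, eval_zero] at this
    exact (sub_eq_zero.1 this.symm))
  convert key using 2
  rw [SK]
  refine Finset.sum_nbij' (fun v => (a * v 0 + b * v 1, c * v 0 + d * v 1)) (fun s => ![d * s.1 - b * s.2, -c * s.1 + a * s.2]) ?_ ?_ ?_ ?_ ?_
  · intro v hv
    rw [mem_ZK]
    simp only [Finset.mem_filter, Finset.mem_univ, true_and] at hv
    rw [hev v, hv, sub_self]
  · intro s hs
    rw [mem_ZK, ev2_sub, ev2_Ph] at hs
    simp only [Finset.mem_filter, Finset.mem_univ, true_and]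
    rw [sub_eq_zero] at hs
    rw [hs]
    simp [ev2]
  · intro v hv
    ext i
    fin_cases i
    · simp
      linear_combination v 0 * hdet
    · simp
      linear_combination v 1 * hdet
  · intro s hs
    ext
    · simp
      linear_combination s.1 * hdet
    · simp
      linear_combination s.2 * hdet
  · intro v hv
    rfl

open Polynomial

section
variable {K : Type*} [Field K] [Fintype K] [DecidableEq K]

/-- plane character -/
noncomputable def eX (χ : AddChar K ℂ) (ξ : K × K) (v : Fin 2 → K) : ℂ := χ (ξ.1 * v 0 + ξ.2 * v 1)

lemma eX_add (χ : AddChar K ℂ) (ξ : K × K) (v w : Fin 2 → K) : eX χ ξ (v + w) = eX χ ξ v * eX χ ξ w := by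
  rw [eX, eX, eX, ← AddChar.map_add_eq_mul]
  congr 1
  simp only [Pi.add_apply]; ring

lemma eX_neg (χ : AddChar K ℂ) (ξ : K × K) (v : Fin 2 → K) : eX χ ξ (-v) = (starRingEnd ℂ) (eX χ ξ v) := by
  rw [eX, eX, ← AddChar.map_neg_eq_conj]
  congr 1
  simp only [Pi.neg_apply]; ring

lemma eX_norm (χ : AddChar K ℂ) (ξ : K × K) (v : Fin 2 → K) : ‖eX χ ξ v‖ = 1 := AddChar.norm_apply _ _

lemma eX_orth (χ : AddChar K ℂ) (hχ : χ.IsPrimitive) (v : Fin 2 → K) :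
    ∑ ξ, eX χ ξ v = if v = 0 then (Fintype.card K : ℂ) ^ 2 else 0 := by
  simp only [eX, AddChar.map_add_eq_mul]
  rw [Fintype.sum_prod_type]
  dsimp only
  rw [← Finset.sum_mul_sum, AddChar.sum_mulShift _ hχ, AddChar.sum_mulShift _ hχ]
  have : v = 0 ↔ v 0 = 0 ∧ v 1 = 0 := by
    rw [funext_iff, Fin.forall_fin_two]; rfl
  by_cases h0 : v 0 = 0 <;> by_cases h1 : v 1 = 0 <;> simp [this, h0, h1, sq]

lemma count_id (χ : AddChar K ℂ) (hχ : χ.IsPrimitive) (A E : Finset (Fin 2 → K)) :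
    ∑ ξ, (∑ v ∈ A, eX χ ξ v) * ((starRingEnd ℂ) (∑ x ∈ E, eX χ ξ x) * (∑ y ∈ E, eX χ ξ y)) =
    (Fintype.card K : ℂ) ^ 2 * (((E ×ˢ E).filter (fun s => s.1 - s.2 ∈ A)).card : ℂ) := by
  have h1 : ∀ ξ, (∑ v ∈ A, eX χ ξ v) * ((starRingEnd ℂ) (∑ x ∈ E, eX χ ξ x) * (∑ y ∈ E, eX χ ξ y)) =
      ∑ s ∈ E ×ˢ E, ∑ v ∈ A, eX χ ξ (v + (-s.1 + s.2)) := by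
    intro ξ
    rw [map_sum, Finset.sum_mul_sum, ← Finset.sum_product', Finset.sum_mul_sum, Finset.sum_comm]
    simp only [eX_add, eX_neg]
  rw [Finset.sum_congr rfl (fun ξ _ => h1 ξ), Finset.sum_comm]
  have h2 : ∀ s ∈ E ×ˢ E, ∑ ξ, ∑ v ∈ A, eX χ ξ (v + (-s.1 + s.2)) =
      if s.1 - s.2 ∈ A then (Fintype.card K : ℂ) ^ 2 else 0 := by
    intro s _
    rw [Finset.sum_comm]
    simp only [eX_orth χ hχ]
    have : ∀ v : Fin 2 → K, v + (-s.1 + s.2) = 0 ↔ s.1 - s.2 = v := by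
      intro v
      constructor
      · intro h
        linear_combination (exp := 1) -h
      · rintro rfl; abel
    simp only [this, Finset.sum_ite_eq]
  rw [Finset.sum_congr rfl h2, ← Finset.sum_filter, Finset.sum_const, nsmul_eq_mul, mul_comm]

lemma plancherel' (χ : AddChar K ℂ) (hχ : χ.IsPrimitive) (E : Finset (Fin 2 → K)) :
    ∑ ξ, ‖∑ x ∈ E, eX χ ξ x‖ ^ 2 = (Fintype.card K : ℝ) ^ 2 * E.card := by
  have h := count_id χ hχ {0} E
  have h3 : ((E ×ˢ E).filter (fun s => s.1 - s.2 ∈ ({0} : Finset (Fin 2 → K)))).card = E.card := by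
    refine Finset.card_nbij' (fun s => s.1) (fun x => (x, x)) ?_ ?_ ?_ ?_
    · intro s hs; simp at hs; exact hs.1.1
    · intro s hs; simpa using hs
    · intro s hs
      simp [sub_eq_zero] at hs
      ext1
      · rfl
      · exact hs.2
    · intro s hs; rfl
  rw [h3] at h
  have h4 : ∀ ξ, ∑ v ∈ ({0} : Finset (Fin 2 → K)), eX χ ξ v = 1 := by
    intro ξ; simp [eX]
  simp only [h4, one_mul, Complex.conj_mul'] at h
  exact_mod_cast h

lemma count_bound (χ : AddChar K ℂ) (hχ : χ.IsPrimitive) (A E : Finset (Fin 2 → K)) (B : ℝ) (hB : 0 ≤ B)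
    (h : ∀ ξ : K × K, ξ ≠ 0 → ‖∑ v ∈ A, eX χ ξ v‖ ≤ B) :
    (Fintype.card K : ℝ) ^ 2 * (((E ×ˢ E).filter (fun s => s.1 - s.2 ∈ A)).card : ℝ) ≤
      A.card * (E.card : ℝ) ^ 2 + B * ((Fintype.card K : ℝ) ^ 2 * E.card) := by
  have h1 := congrArg norm (count_id χ hχ A E)
  rw [norm_mul, norm_pow, Complex.norm_natCast, Complex.norm_natCast] at h1
  rw [← h1, ← plancherel' χ hχ E]
  refine (norm_sum_le _ _).trans ?_
  rw [← Finset.add_sum_erase _ _ (Finset.mem_univ (0 : K × K))]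
  have e0 : ∀ S : Finset (Fin 2 → K), ∑ v ∈ S, eX χ 0 v = S.card := by
    intro S; simp [eX]
  refine add_le_add ?_ ?_
  · rw [e0, e0]
    simp [sq]
  · calc _ ≤ ∑ ξ ∈ Finset.univ.erase (0 : K × K), B * ‖∑ x ∈ E, eX χ ξ x‖ ^ 2 := by
          refine Finset.sum_le_sum fun ξ hξ => ?_
          rw [norm_mul, Complex.conj_mul', norm_pow, Complex.norm_real, norm_norm]
          exact mul_le_mul_of_nonneg_right (h ξ (Finset.ne_of_mem_erase hξ)) (by positivity)
      _ ≤ _ := by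
        rw [Finset.mul_sum]
        exact Finset.sum_le_sum_of_subset_of_nonneg (Finset.erase_subset _ _) (fun _ _ _ => by positivity)

lemma curve_card (P : MvPolynomial (Fin 2) K) (k : ℕ) (hk : P.totalDegree = k) (h2 : 2 ≤ k) (t : K) :
    ((Finset.univ : Finset (Fin 2 → K)).filter (fun v => MvPolynomial.eval v P = t)).card ≤ k * Fintype.card K := by
  have hne : P - MvPolynomial.C t ≠ 0 := by
    intro h
    rw [sub_eq_zero] at h
    rw [h, MvPolynomial.totalDegree_C] at hk
    omega
  have hd : (P - MvPolynomial.C t).totalDegree ≤ k := by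
    refine (MvPolynomial.totalDegree_sub _ _).trans ?_
    rw [MvPolynomial.totalDegree_C, hk]; simp
  have h := MvPolynomial.schwartz_zippel_totalDegree hne (Finset.univ : Finset K)
  have e : (Finset.univ : Finset (Fin 2 → K)).filter (fun v => MvPolynomial.eval v P = t) =
      (Fintype.piFinset fun _ : Fin 2 => (Finset.univ : Finset K)).filter (fun v => MvPolynomial.eval v (P - MvPolynomial.C t) = 0) := by
    ext v
    simp [sub_eq_zero]
  rw [← e, Finset.card_univ] at h
  have hq : (0 : ℚ≥0) < Fintype.card K := by exact_mod_cast Fintype.card_pos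
  rw [div_le_div_iff₀ (by positivity) hq] at h
  have h' : ((Finset.univ : Finset (Fin 2 → K)).filter (fun v => MvPolynomial.eval v P = t)).card * Fintype.card K ≤
     (P - MvPolynomial.C t).totalDegree * Fintype.card K ^ 2 := by exact_mod_cast h
  have hq' : 0 < Fintype.card K := Fintype.card_pos
  have h'' : ((Finset.univ : Finset (Fin 2 → K)).filter (fun v => MvPolynomial.eval v P = t)).card * Fintype.card K ≤
     (k * Fintype.card K) * Fintype.card K := by
    calc _ ≤ _ := h'
      _ ≤ k * Fintype.card K ^ 2 := by gcongr
      _ = _ := by ring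
  exact Nat.le_of_mul_le_mul_right h'' hq'

lemma triv_count (A E : Finset (Fin 2 → K)) :
    ((E ×ˢ E).filter (fun s => s.1 - s.2 ∈ A)).card ≤ A.card * E.card := by
  rw [← Finset.card_product]
  refine Finset.card_le_card_of_injOn (fun s => (s.1 - s.2, s.1)) ?_ ?_
  · intro s hs
    simp at hs ⊢
    tauto
  · intro s _ r _ h
    simp at h
    obtain ⟨h1, h2⟩ := h
    rw [h2] at h1
    ext1
    · exact h2
    · simpa using h1

end

open Polynomial

lemma final_arith (k C q e N : ℝ) (hk : 0 ≤ k) (hC : 0 < C) (hq : 0 < q) (he : 0 < e) (hN : 0 ≤ N)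
    (h0 : 2 * k ^ 2 * q ≤ e) (h : e ^ 2 ≤ k * (k * q * e) + N * (k * e ^ 2 / q + C * Real.sqrt q * e)) :
    1 / (2 * (k + C)) * min q (e * q ^ (-(1 / 2 : ℝ))) ≤ N := by
  have hs : 0 < Real.sqrt q := Real.sqrt_pos.2 hq
  have hss : Real.sqrt q * Real.sqrt q = q := Real.mul_self_sqrt hq.le
  have hr : q ^ (-(1 / 2 : ℝ)) = (Real.sqrt q)⁻¹ := by
    rw [Real.rpow_neg hq.le, ← Real.sqrt_eq_rpow]
  rw [hr]
  set m := min q (e * (Real.sqrt q)⁻¹) with hm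
  have hm0 : 0 < m := lt_min hq (by positivity)
  have hm1 : m ≤ q := min_le_left _ _
  have hm2 : m ≤ e * (Real.sqrt q)⁻¹ := min_le_right _ _
  have hm3 : m * Real.sqrt q ≤ e := by
    rw [← div_eq_mul_inv, le_div_iff₀ hs] at hm2
    exact hm2
  set D := k * e / q + C * Real.sqrt q with hD
  have hDp : 0 < D := by positivity
  have hDm : D * m ≤ (k + C) * e := by
    have a1 : k * e / q * m ≤ k * e := by
      rw [div_mul_eq_mul_div, div_le_iff₀ hq]
      gcongr
    have a2 : C * Real.sqrt q * m ≤ C * e := by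
      rw [mul_assoc, mul_comm _ m]; gcongr
    rw [hD]; linarith
  have hND : e / 2 ≤ N * D := by
    have b1 : N * (k * e ^ 2 / q + C * Real.sqrt q * e) = e * (N * D) := by
      rw [hD]; field_simp
    rw [b1] at h
    have b2 : k * (k * q * e) ≤ e * (e / 2) := by nlinarith
    have b3 : e * (e / 2) ≤ e * (N * D) := by nlinarith
    exact le_of_mul_le_mul_left b3 he
  have hkC : 0 < k + C := by linarith
  have h5 : D * m ≤ D * (2 * (k + C) * N) := by
    calc D * m ≤ (k + C) * e := hDm
      _ = 2 * (k + C) * (e / 2) := by ring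
      _ ≤ 2 * (k + C) * (N * D) := by gcongr
      _ = _ := by ring
  have h6 := le_of_mul_le_mul_left h5 hDp
  rw [div_mul_eq_mul_div, one_mul, div_le_iff₀ (by positivity)]
  linarith

/-- Vu: for a non-degenerate polynomial `P ∈ F_q[x₁,x₂]` of degree
`k` (over a field of large enough characteristic) and `E ⊆ F_q²` with
`|E| ≥ c₀ q`, the distance set satisfies `|Δ_P(E,E)| ≥ c·min(q, |E| q^{-1/2})`. -/
theorem stmt17 (k : ℕ) (hk : 2 ≤ k) :
    ∃ c₀ : ℝ, 0 < c₀ ∧ ∃ c : ℝ, 0 < c ∧ ∃ p₀ : ℕ,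
      ∀ (K : Type) [Field K] [Fintype K] [DecidableEq K],
        p₀ ≤ ringChar K →
        ∀ P : MvPolynomial (Fin 2) K, P.totalDegree = k →
          (¬ ∃ (G : Polynomial K) (α β : K),
            P = Polynomial.eval₂ (MvPolynomial.C : K →+* MvPolynomial (Fin 2) K)
                  (MvPolynomial.C α * MvPolynomial.X 0 +
                   MvPolynomial.C β * MvPolynomial.X 1) G) →
        ∀ E : Finset (Fin 2 → K),
          c₀ * (Fintype.card K : ℝ) ≤ (E.card : ℝ) →
          c * min (Fintype.card K : ℝ)
              ((E.card : ℝ) * (Fintype.card K : ℝ) ^ (-(1 / 2 : ℝ))) ≤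
            (((E ×ˢ E).image
              (fun p => MvPolynomial.eval (p.1 - p.2) P)).card : ℝ) := by
  classical
  refine ⟨2 * (k : ℝ) ^ 2, by positivity, 1 / (2 * ((k : ℝ) + (CP k + 1))), by positivity, k + 1, ?_⟩
  intro K _ _ _ hp P hP hnd E hE
  have hprime : (ringChar K).Prime := CharP.char_is_prime K (ringChar K)
  haveI : Fact (ringChar K).Prime := ⟨hprime⟩
  have hq0 : 0 < Fintype.card K := Fintype.card_pos
  have hq : (0 : ℝ) < Fintype.card K := by exact_mod_cast hq0
  have hqp : ringChar K ≤ Fintype.card K := by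
    obtain ⟨n, _, hn⟩ := FiniteField.card K (ringChar K)
    rw [hn]
    exact Nat.le_self_pow n.ne_zero _
  have hk0 : (0 : ℝ) < k := by exact_mod_cast (by omega : 0 < k)
  have he : (0 : ℝ) < E.card := lt_of_lt_of_le (by positivity) hE
  set χ := AddChar.FiniteField.primitiveChar_to_Complex K with hχdef
  have hχ : χ.IsPrimitive := AddChar.FiniteField.primitiveChar_to_Complex_isPrimitive K
  have hχ0 : χ ≠ 0 := by
    have h1 := hχ one_ne_zero
    intro h
    apply h1
    rw [h]
    ext x
    simp
  set Δ := (E ×ˢ E).image (fun p => MvPolynomial.eval (p.1 - p.2) P) with hΔ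
  set A : K → Finset (Fin 2 → K) := fun t => Finset.univ.filter (fun v => MvPolynomial.eval v P = t) with hA
  set ν : K → ℕ := fun t => ((E ×ˢ E).filter (fun s => s.1 - s.2 ∈ A t)).card with hν
  have hsum : E.card ^ 2 = ∑ t ∈ Δ, ν t := by
    have := Finset.card_eq_sum_card_image (fun p : (Fin 2 → K) × (Fin 2 → K) => MvPolynomial.eval (p.1 - p.2) P) (E ×ˢ E)
    rw [Finset.card_product, ← sq] at this
    rw [this]
    refine Finset.sum_congr rfl fun t _ => ?_
    simp [hν, hA]
  have hAc : ∀ t, ((A t).card : ℝ) ≤ k * Fintype.card K := by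
    intro t
    exact_mod_cast curve_card P k hP hk t
  have hbad : ∀ t, (ν t : ℝ) ≤ k * Fintype.card K * E.card := by
    intro t
    have h1 : (ν t : ℝ) ≤ (A t).card * E.card := by exact_mod_cast triv_count (A t) E
    exact h1.trans (mul_le_mul_of_nonneg_right (hAc t) he.le)
  have hgood : ∀ t, ¬ BadL P t → (ν t : ℝ) ≤ k * (E.card : ℝ) ^ 2 / Fintype.card K + ((CP k : ℝ) + 1) * Real.sqrt (Fintype.card K) * E.card := by
    intro t ht
    have h1 := count_bound χ hχ (A t) E (((CP k : ℝ) + 1) * Real.sqrt (Fintype.card K)) (by positivity) (by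
      intro ξ hξ
      have hξ' : ξ.1 ≠ 0 ∨ ξ.2 ≠ 0 := by
        by_contra hc
        push Not at hc
        exact hξ (Prod.ext hc.1 hc.2)
      refine (S_bound (ringChar K) χ hχ0 P k hP (by omega) t ht ξ.1 ξ.2 hξ').trans ?_
      gcongr
      linarith)
    have h2 : (Fintype.card K : ℝ) ^ 2 * (ν t : ℝ) ≤ (Fintype.card K : ℝ) ^ 2 * (k * (E.card : ℝ) ^ 2 / Fintype.card K + ((CP k : ℝ) + 1) * Real.sqrt (Fintype.card K) * E.card) := by
      refine h1.trans ?_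
      have h3 : ((A t).card : ℝ) * (E.card : ℝ) ^ 2 ≤ k * Fintype.card K * (E.card : ℝ) ^ 2 := mul_le_mul_of_nonneg_right (hAc t) (by positivity)
      have h4 : (Fintype.card K : ℝ) ^ 2 * (k * (E.card : ℝ) ^ 2 / Fintype.card K) = k * Fintype.card K * (E.card : ℝ) ^ 2 := by
        field_simp
      rw [mul_add, h4]
      linarith
    exact le_of_mul_le_mul_left h2 (by positivity)
  have hmain : (E.card : ℝ) ^ 2 ≤ k * (k * Fintype.card K * E.card) + Δ.card * (k * (E.card : ℝ) ^ 2 / Fintype.card K + ((CP k : ℝ) + 1) * Real.sqrt (Fintype.card K) * E.card) := by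
    have h1 : (E.card : ℝ) ^ 2 = ∑ t ∈ Δ, (ν t : ℝ) := by exact_mod_cast hsum
    refine h1.le.trans ?_
    rw [← Finset.sum_filter_add_sum_filter_not Δ (fun t => BadL P t)]
    refine add_le_add ?_ ?_
    · refine (Finset.sum_le_card_nsmul _ _ _ (fun t _ => hbad t)).trans ?_
      rw [nsmul_eq_mul]
      have : ((Δ.filter (fun t => BadL P t)).card : ℝ) ≤ k := by
        exact_mod_cast bad_card P k hP (by omega) hnd _ (fun t ht => (Finset.mem_filter.1 ht).2)
      gcongr
    · refine (Finset.sum_le_card_nsmul _ _ _ (fun t ht => hgood t (Finset.mem_filter.1 ht).2)).trans ?_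
      rw [nsmul_eq_mul]
      have : ((Δ.filter (fun t => ¬ BadL P t)).card : ℝ) ≤ Δ.card := by
        exact_mod_cast Finset.card_filter_le _ _
      gcongr
  exact final_arith k (CP k + 1) (Fintype.card K) E.card Δ.card hk0.le (by positivity) hq he (by positivity) hE hmain
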